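/- Let (R, m) be a Cohen-Macaulay commutative Noetherian local ring, let C be a semidualizing R-module, and let M be a d-dimensional non-zero finitely generated R-module of finite G_C-projective dimension. Then the following are equivalent: (i) M is Cohen-Macaulay; (ii) G_C-fd_R(H^d_m(M)) = G_C-pd_R(M) + d; (iii) G_C-pd_R(H^d_m(M)) = G_C-pd_R(M) + d. -/

import Mathlib

/-!
Definitions needed to state results of "On flat and Gorenstein flat dimensions of
local cohomology modules" by M.R. Zargar and H. Zakeri.
-/

open CategoryTheory IsLocalRing

universe u

namespace Paper

variable (R : Type u) [CommRing R]

/-! ## Resolution/coresolution dimensions with respect to a class of modules -/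

/-- `ResDimLE R P n M` : `M` admits a resolution `0 → Xₙ → ⋯ → X₀ → M → 0`
with each `Xᵢ` in the class `P`. -/
def ResDimLE (P : ModuleCat.{u} R → Prop) : ℕ → ModuleCat.{u} R → Prop
  | 0, M => P M
  | n + 1, M => ResDimLE P n M ∨
      ∃ (X : ModuleCat.{u} R) (f : X →ₗ[R] M), P X ∧ Function.Surjective f ∧
        ResDimLE P n (ModuleCat.of R (LinearMap.ker f))

/-- `CoresDimLE R P n M` : `M` admits a coresolution `0 → M → X₀ → ⋯ → Xₙ → 0`
with each `Xᵢ` in the class `P`. -/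
def CoresDimLE (P : ModuleCat.{u} R → Prop) : ℕ → ModuleCat.{u} R → Prop
  | 0, M => P M
  | n + 1, M => CoresDimLE P n M ∨
      ∃ (X : ModuleCat.{u} R) (f : M →ₗ[R] X), P X ∧ Function.Injective f ∧
        CoresDimLE P n (ModuleCat.of R (X ⧸ LinearMap.range f))

/-- The resolution dimension of `M` with respect to the class `P`, as an
extended natural number (`⊤` if there is no finite resolution). -/
noncomputable def ResDim (P : ModuleCat.{u} R → Prop) (M : ModuleCat.{u} R) : ℕ∞ :=
  sInf {n : ℕ∞ | ∃ k : ℕ, (k : ℕ∞) = n ∧ ResDimLE R P k M}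

/-- The coresolution dimension of `M` with respect to the class `P`. -/
noncomputable def CoresDim (P : ModuleCat.{u} R → Prop) (M : ModuleCat.{u} R) : ℕ∞ :=
  sInf {n : ℕ∞ | ∃ k : ℕ, (k : ℕ∞) = n ∧ CoresDimLE R P k M}

/-- Flat dimension `fd_R M`. -/
noncomputable def flatDim (M : Type u) [AddCommGroup M] [Module R M] : ℕ∞ :=
  ResDim R (fun N => Module.Flat R N) (ModuleCat.of R M)

/-- Projective dimension `pd_R M`. -/
noncomputable def projDim (M : Type u) [AddCommGroup M] [Module R M] : ℕ∞ :=
  ResDim R (fun N => Module.Projective R N) (ModuleCat.of R M)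

/-- Injective dimension `id_R M`. -/
noncomputable def injDim (M : Type u) [AddCommGroup M] [Module R M] : ℕ∞ :=
  CoresDim R (fun N => Module.Injective R N) (ModuleCat.of R M)

/-! ## Local cohomology -/

/-- The local cohomology module `H^i_𝔞(M)`, as an object of `ModuleCat R`. -/
noncomputable def lcoh (𝔞 : Ideal R) (i : ℕ) (M : Type u) [AddCommGroup M] [Module R M] :
    ModuleCat.{u} R :=
  (localCohomology 𝔞 i).obj (ModuleCat.of R M)

/-- `M` is relative Cohen-Macaulay with respect to `𝔞` with `ht_M 𝔞 = n`, i.e. the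
`n`-th local cohomology of `M` with respect to `𝔞` is the only non-vanishing one. -/
def IsRelCM (𝔞 : Ideal R) (n : ℕ) (M : Type u) [AddCommGroup M] [Module R M] : Prop :=
  (∀ i : ℕ, i ≠ n → Subsingleton (lcoh R 𝔞 i M)) ∧ ¬ Subsingleton (lcoh R 𝔞 n M)

/-! ## Depth, dimension, Cohen-Macaulay -/

/-- The depth of a module over a local ring: the supremum of the lengths of
`M`-regular sequences contained in the maximal ideal. -/
noncomputable def depth [IsLocalRing R] (M : Type u) [AddCommGroup M] [Module R M] : ℕ∞ :=
  sSup {n : ℕ∞ | ∃ rs : List R, (rs.length : ℕ∞) = n ∧ (∀ x ∈ rs, x ∈ maximalIdeal R) ∧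
    RingTheory.Sequence.IsRegular M rs}

/-- The (Krull) dimension of a module: the Krull dimension of `R` modulo
the annihilator of `M` (`⊥` for the zero module). -/
noncomputable def moduleDim (M : Type u) [AddCommGroup M] [Module R M] : WithBot ℕ∞ :=
  ringKrullDim (R ⧸ Module.annihilator R M)

/-- A finitely generated module over a local ring is Cohen-Macaulay
if its depth equals its dimension. -/
def IsCohenMacaulayModule [IsLocalRing R] (M : Type u) [AddCommGroup M] [Module R M] : Prop :=
  (depth R M : WithBot ℕ∞) = moduleDim R M

/-- A local ring is Cohen-Macaulay if it is so as a module over itself. -/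
def IsCohenMacaulayRing [IsLocalRing R] : Prop := IsCohenMacaulayModule R R

/-- A local ring is Gorenstein if it has finite injective dimension over itself. -/
def IsGorensteinRing : Prop := injDim R R ≠ ⊤

/-! ## Ext, Tor, semidualizing modules -/

/-- `Ext^i_R(A, B)`. -/
noncomputable def ext (i : ℕ) (A B : Type u) [AddCommGroup A] [Module R A]
    [AddCommGroup B] [Module R B] : ModuleCat.{u} R :=
  ((Ext R (ModuleCat.{u} R) i).obj (Opposite.op (ModuleCat.of R A))).obj (ModuleCat.of R B)

/-- `Tor^R_p(A, B)` indexed by `p : ℤ`, with the convention that it vanishes in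
negative degrees. -/
noncomputable def tor (p : ℤ) (A B : Type u) [AddCommGroup A] [Module R A]
    [AddCommGroup B] [Module R B] : ModuleCat.{u} R :=
  if 0 ≤ p then ((Tor (ModuleCat.{u} R) p.toNat).obj (ModuleCat.of R A)).obj (ModuleCat.of R B)
  else ModuleCat.of R PUnit

/-- A finitely generated module `C` is semidualizing if the natural map
`R → Hom_R(C, C)` is bijective and `Ext^i_R(C, C) = 0` for all `i ≥ 1`. -/
def IsSemidualizing (C : Type u) [AddCommGroup C] [Module R C] : Prop :=
  Module.Finite R C ∧
  Function.Bijective (fun r : R => (r • LinearMap.id : C →ₗ[R] C)) ∧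
  ∀ i : ℕ, 1 ≤ i → Subsingleton (ext R i C C)

/-! ## Gorenstein homological classes -/

/-- `N` is Gorenstein injective: it is the kernel of the `0`-th differential of some
exact complex `Y` of injective modules which stays exact under `Hom(I, -)` for every
injective module `I`. (The complex is written cohomologically.) -/
def IsGorensteinInjective (N : Type u) [AddCommGroup N] [Module R N] : Prop :=
  ∃ (Y : ℤ → ModuleCat.{u} R) (d : ∀ i : ℤ, Y i →ₗ[R] Y (i + 1)),
    (∀ i, Module.Injective R (Y i)) ∧
    (∀ i, Function.Exact (d i) (d (i + 1))) ∧
    (∀ (I : ModuleCat.{u} R), Module.Injective R I →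
      ∀ (i : ℤ) (g : I →ₗ[R] Y (i + 1)), (d (i + 1)).comp g = 0 →
        ∃ h : I →ₗ[R] Y i, (d i).comp h = g) ∧
    ∃ ι : N →ₗ[R] Y 0, Function.Injective ι ∧ Function.Exact ι (d 0)

/-- `N` is Gorenstein projective: it is the cokernel of a differential of some
exact complex `X` of projective modules which stays exact under `Hom(-, P)` for
every projective module `P`. -/
def IsGorensteinProjective (N : Type u) [AddCommGroup N] [Module R N] : Prop :=
  ∃ (X : ℤ → ModuleCat.{u} R) (d : ∀ i : ℤ, X i →ₗ[R] X (i + 1)),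
    (∀ i, Module.Projective R (X i)) ∧
    (∀ i, Function.Exact (d i) (d (i + 1))) ∧
    (∀ (P : ModuleCat.{u} R), Module.Projective R P →
      ∀ (i : ℤ) (g : X (i + 1) →ₗ[R] P), g.comp (d i) = 0 →
        ∃ h : X (i + 1 + 1) →ₗ[R] P, h.comp (d (i + 1)) = g) ∧
    ∃ π : X 0 →ₗ[R] N, Function.Surjective π ∧ Function.Exact (d (-1)) π

/-- `N` is Gorenstein flat: it is the cokernel of a differential of some exact
complex `Z` of flat modules which stays exact under `- ⊗ I` for every injective
module `I`. -/
def IsGorensteinFlat (N : Type u) [AddCommGroup N] [Module R N] : Prop :=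
  ∃ (Z : ℤ → ModuleCat.{u} R) (d : ∀ i : ℤ, Z i →ₗ[R] Z (i + 1)),
    (∀ i, Module.Flat R (Z i)) ∧
    (∀ i, Function.Exact (d i) (d (i + 1))) ∧
    (∀ (I : ModuleCat.{u} R), Module.Injective R I →
      ∀ i : ℤ, Function.Exact (LinearMap.rTensor (R := R) I (d i))
        (LinearMap.rTensor (R := R) I (d (i + 1)))) ∧
    ∃ π : Z 0 →ₗ[R] N, Function.Surjective π ∧ Function.Exact (d (-1)) π

/-- Gorenstein injective dimension `Gid_R M`. -/
noncomputable def GinjDim (M : Type u) [AddCommGroup M] [Module R M] : ℕ∞ :=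
  CoresDim R (fun N => IsGorensteinInjective R N) (ModuleCat.of R M)

/-- Gorenstein projective dimension `Gpd_R M`. -/
noncomputable def GprojDim (M : Type u) [AddCommGroup M] [Module R M] : ℕ∞ :=
  ResDim R (fun N => IsGorensteinProjective R N) (ModuleCat.of R M)

/-- Gorenstein flat dimension `Gfd_R M`. -/
noncomputable def GflatDim (M : Type u) [AddCommGroup M] [Module R M] : ℕ∞ :=
  ResDim R (fun N => IsGorensteinFlat R N) (ModuleCat.of R M)

/-! ## `C`-injective, `C`-projective, `C`-flat modules and the `G_C`-classes -/

/-- `N` is `C`-injective if `N ≅ Hom_R(C, I)` for some injective module `I`. -/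
def IsCInjective (C : Type u) [AddCommGroup C] [Module R C]
    (N : Type u) [AddCommGroup N] [Module R N] : Prop :=
  ∃ I : ModuleCat.{u} R, Module.Injective R I ∧ Nonempty (N ≃ₗ[R] (C →ₗ[R] I))

/-- `N` is `C`-projective if `N ≅ C ⊗_R P` for some projective module `P`. -/
def IsCProjective (C : Type u) [AddCommGroup C] [Module R C]
    (N : Type u) [AddCommGroup N] [Module R N] : Prop :=
  ∃ P : ModuleCat.{u} R, Module.Projective R P ∧ Nonempty (N ≃ₗ[R] TensorProduct R C P)

/-- `N` is `C`-flat if `N ≅ C ⊗_R F` for some flat module `F`. -/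
def IsCFlat (C : Type u) [AddCommGroup C] [Module R C]
    (N : Type u) [AddCommGroup N] [Module R N] : Prop :=
  ∃ F : ModuleCat.{u} R, Module.Flat R F ∧ Nonempty (N ≃ₗ[R] TensorProduct R C F)

/-- `C`-injective dimension `cid_R M`. -/
noncomputable def cInjDim (C : Type u) [AddCommGroup C] [Module R C]
    (M : Type u) [AddCommGroup M] [Module R M] : ℕ∞ :=
  CoresDim R (fun N => IsCInjective R C N) (ModuleCat.of R M)

/-- `C`-projective dimension `cpd_R M`. -/
noncomputable def cProjDim (C : Type u) [AddCommGroup C] [Module R C]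
    (M : Type u) [AddCommGroup M] [Module R M] : ℕ∞ :=
  ResDim R (fun N => IsCProjective R C N) (ModuleCat.of R M)

/-- `N` is `G_C`-injective: `N` is the kernel of the `0`-th differential of an exact
complex `Y` (a complete `I_C I`-coresolution) with `Y i` injective in degrees belonging
to the coresolution part and `C`-injective elsewhere, such that `Hom(I', Y)` is exact
for every `C`-injective module `I'`. -/
def IsGCInjective (C : Type u) [AddCommGroup C] [Module R C]
    (N : Type u) [AddCommGroup N] [Module R N] : Prop :=
  ∃ (Y : ℤ → ModuleCat.{u} R) (d : ∀ i : ℤ, Y i →ₗ[R] Y (i + 1)),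
    (∀ i : ℤ, 0 ≤ i → Module.Injective R (Y i)) ∧
    (∀ i : ℤ, i < 0 → IsCInjective R C (Y i)) ∧
    (∀ i, Function.Exact (d i) (d (i + 1))) ∧
    (∀ (I : ModuleCat.{u} R), IsCInjective R C I →
      ∀ (i : ℤ) (g : I →ₗ[R] Y (i + 1)), (d (i + 1)).comp g = 0 →
        ∃ h : I →ₗ[R] Y i, (d i).comp h = g) ∧
    ∃ ι : N →ₗ[R] Y 0, Function.Injective ι ∧ Function.Exact ι (d 0)

/-- `N` is `G_C`-projective: the cokernel of the degree `0` differential of a complete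
`P_C P`-resolution. -/
def IsGCProjective (C : Type u) [AddCommGroup C] [Module R C]
    (N : Type u) [AddCommGroup N] [Module R N] : Prop :=
  ∃ (X : ℤ → ModuleCat.{u} R) (d : ∀ i : ℤ, X i →ₗ[R] X (i + 1)),
    (∀ i : ℤ, i ≤ 0 → Module.Projective R (X i)) ∧
    (∀ i : ℤ, 0 < i → IsCProjective R C (X i)) ∧
    (∀ i, Function.Exact (d i) (d (i + 1))) ∧
    (∀ (Q : ModuleCat.{u} R), IsCProjective R C Q →
      ∀ (i : ℤ) (g : X (i + 1) →ₗ[R] Q), g.comp (d i) = 0 →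
        ∃ h : X (i + 1 + 1) →ₗ[R] Q, h.comp (d (i + 1)) = g) ∧
    ∃ π : X 0 →ₗ[R] N, Function.Surjective π ∧ Function.Exact (d (-1)) π

/-- `N` is `G_C`-flat: the cokernel of the degree `0` differential of a complete
`F_C F`-resolution. -/
def IsGCFlat (C : Type u) [AddCommGroup C] [Module R C]
    (N : Type u) [AddCommGroup N] [Module R N] : Prop :=
  ∃ (Z : ℤ → ModuleCat.{u} R) (d : ∀ i : ℤ, Z i →ₗ[R] Z (i + 1)),
    (∀ i : ℤ, i ≤ 0 → Module.Flat R (Z i)) ∧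
    (∀ i : ℤ, 0 < i → IsCFlat R C (Z i)) ∧
    (∀ i, Function.Exact (d i) (d (i + 1))) ∧
    (∀ (J : ModuleCat.{u} R), IsCInjective R C J →
      ∀ i : ℤ, Function.Exact (LinearMap.rTensor (R := R) J (d i))
        (LinearMap.rTensor (R := R) J (d (i + 1)))) ∧
    ∃ π : Z 0 →ₗ[R] N, Function.Surjective π ∧ Function.Exact (d (-1)) π

/-- `G_C`-injective dimension `Gid_C M`. -/
noncomputable def GCinjDim (C : Type u) [AddCommGroup C] [Module R C]
    (M : Type u) [AddCommGroup M] [Module R M] : ℕ∞ :=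
  CoresDim R (fun N => IsGCInjective R C N) (ModuleCat.of R M)

/-- `G_C`-projective dimension `G_C-pd_R M`. -/
noncomputable def GCprojDim (C : Type u) [AddCommGroup C] [Module R C]
    (M : Type u) [AddCommGroup M] [Module R M] : ℕ∞ :=
  ResDim R (fun N => IsGCProjective R C N) (ModuleCat.of R M)

/-- `G_C`-flat dimension `G_C-fd_R M`. -/
noncomputable def GCflatDim (C : Type u) [AddCommGroup C] [Module R C]
    (M : Type u) [AddCommGroup M] [Module R M] : ℕ∞ :=
  ResDim R (fun N => IsGCFlat R C N) (ModuleCat.of R M)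

end Paper


section
open CategoryTheory IsLocalRing


namespace GC

variable {R : Type u} [CommRing R]

/-- `Ext` groups of modules. -/
abbrev EX (A B : ModuleCat.{u} R) (n : ℕ) : Type u := Abelian.Ext.{u} A B n

variable {A B D A' B' D' N w : ModuleCat.{u} R}

/-- Functoriality of `EX` in the first variable. -/
noncomputable def pre (f : A →ₗ[R] B) (w : ModuleCat.{u} R) (n : ℕ) : EX B w n →ₗ[R] EX A w n where
  toFun x := (Abelian.Ext.mk₀ (ModuleCat.ofHom f)).comp x (zero_add n)
  map_add' := by simp
  map_smul' := by simp

/-- Functoriality of `EX` in the second variable. -/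
noncomputable def post (N : ModuleCat.{u} R) (f : A →ₗ[R] B) (n : ℕ) : EX N A n →ₗ[R] EX N B n where
  toFun x := x.comp (Abelian.Ext.mk₀ (ModuleCat.ofHom f)) (add_zero n)
  map_add' := by simp
  map_smul' := by simp

lemma pre_apply (f : A →ₗ[R] B) (n : ℕ) (x : EX B w n) :
  pre f w n x = (Abelian.Ext.mk₀ (ModuleCat.ofHom f)).comp x (zero_add n) := rfl

lemma post_apply (f : A →ₗ[R] B) (n : ℕ) (x : EX N A n) :
  post N f n x = x.comp (Abelian.Ext.mk₀ (ModuleCat.ofHom f)) (add_zero n) := rfl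

lemma pre_comp (f : A →ₗ[R] B) (g : B →ₗ[R] D) (n : ℕ) (x : EX D w n) :
    pre (g ∘ₗ f) w n x = pre f w n (pre g w n x) := by
  simp [pre_apply, ModuleCat.ofHom_comp]

lemma pre_id (n : ℕ) (x : EX A w n) : pre LinearMap.id w n x = x := by
  simp [pre_apply]

lemma pre_add (f g : A →ₗ[R] B) (n : ℕ) (x : EX B w n) :
    pre (f + g) w n x = pre f w n x + pre g w n x := by
  simp only [pre_apply]
  rw [← Abelian.Ext.add_comp, ← Abelian.Ext.mk₀_add]; rfl

lemma pre_smul (r : R) (f : A →ₗ[R] B) (n : ℕ) (x : EX B w n) :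
    pre (r • f) w n x = r • pre f w n x := by
  simp only [pre_apply]
  rw [← Abelian.Ext.smul_comp, ← Abelian.Ext.mk₀_smul]; rfl

lemma pre_zero (n : ℕ) (x : EX B w n) :
    pre (0 : A →ₗ[R] B) w n x = 0 := by
  have := pre_smul 0 (0 : A →ₗ[R] B) n x
  simpa using this

lemma pre_sub (f g : A →ₗ[R] B) (n : ℕ) (x : EX B w n) :
    pre (f - g) w n x = pre f w n x - pre g w n x := by
  have := pre_add (f - g) g n x
  rw [sub_add_cancel] at this
  rw [this]; abel

lemma post_comp (f : A →ₗ[R] B) (g : B →ₗ[R] D) (n : ℕ) (x : EX N A n) :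
    post N (g ∘ₗ f) n x = post N g n (post N f n x) := by
  simp [post_apply, ModuleCat.ofHom_comp]

lemma post_id (n : ℕ) (x : EX N A n) : post N LinearMap.id n x = x := by
  simp [post_apply]

lemma post_add (f g : A →ₗ[R] B) (n : ℕ) (x : EX N A n) :
    post N (f + g) n x = post N f n x + post N g n x := by
  simp only [post_apply]
  rw [← Abelian.Ext.comp_add, ← Abelian.Ext.mk₀_add]; rfl

lemma post_smul (r : R) (f : A →ₗ[R] B) (n : ℕ) (x : EX N A n) :
    post N (r • f) n x = r • post N f n x := by
  simp only [post_apply]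
  rw [← Abelian.Ext.comp_smul, ← Abelian.Ext.mk₀_smul]; rfl

lemma post_zero (n : ℕ) (x : EX N A n) :
    post N (0 : A →ₗ[R] B) n x = 0 := by
  have := post_smul 0 (0 : A →ₗ[R] B) n x
  simpa using this

lemma pre_post (f : A →ₗ[R] B) (g : D →ₗ[R] D') (n : ℕ) (x : EX B D n) :
    pre f D' n (post B g n x) = post A g n (pre f D n x) := by
  simp only [pre_apply, post_apply]
  rw [Abelian.Ext.comp_assoc]; simp

/-- Degree zero. -/
noncomputable def e0 (A B : ModuleCat.{u} R) : EX A B 0 ≃ₗ[R] (A →ₗ[R] B) :=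
  (Abelian.Ext.linearEquiv₀ (R := R)).trans (ModuleCat.homLinearEquiv (S := R))

lemma e0_symm_apply (f : A →ₗ[R] B) : (e0 A B).symm f = Abelian.Ext.mk₀ (ModuleCat.ofHom f) := by
  simp [e0]; rfl

lemma e0_pre (f : A →ₗ[R] B) (x : EX B D 0) : e0 A D (pre f D 0 x) = e0 B D x ∘ₗ f := by
  obtain ⟨g, rfl⟩ := (e0 B D).symm.surjective x
  apply (e0 A D).symm.injective
  rw [LinearEquiv.symm_apply_apply, LinearEquiv.apply_symm_apply]
  simp [ModuleCat.ofHom_comp, e0_symm_apply, pre_apply]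

lemma e0_post (f : A →ₗ[R] B) (x : EX N A 0) : e0 N B (post N f 0 x) = f ∘ₗ e0 N A x := by
  obtain ⟨g, rfl⟩ := (e0 N A).symm.surjective x
  apply (e0 N B).symm.injective
  rw [LinearEquiv.symm_apply_apply, LinearEquiv.apply_symm_apply]
  simp [ModuleCat.ofHom_comp, e0_symm_apply, post_apply]

/-- Short exact sequences of modules. -/
structure SES (f : A →ₗ[R] B) (g : B →ₗ[R] D) : Prop where
  inj : Function.Injective f
  exact : Function.Exact f g
  surj : Function.Surjective g

namespace SES

variable {f : A →ₗ[R] B} {g : B →ₗ[R] D}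

lemma comp_zero (h : SES f g) : g ∘ₗ f = 0 := h.exact.linearMap_comp_eq_zero

/-- the short complex -/
abbrev sc (h : SES f g) : ShortComplex (ModuleCat.{u} R) :=
  ShortComplex.mk (ModuleCat.ofHom f) (ModuleCat.ofHom g)
    (by rw [← ModuleCat.ofHom_comp, h.comp_zero]; rfl)

lemma shortExact (h : SES f g) : h.sc.ShortExact where
  exact := (ShortComplex.ShortExact.moduleCat_exact_iff_function_exact h.sc).2 h.exact
  mono_f := (ModuleCat.mono_iff_injective _).2 h.inj
  epi_g := (ModuleCat.epi_iff_surjective _).2 h.surj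

/-- connecting map, first variable -/
noncomputable def dl (h : SES f g) (w : ModuleCat.{u} R) (n : ℕ) :
    EX A w n →ₗ[R] EX D w (n + 1) where
  toFun x := h.shortExact.extClass.comp x (add_comm 1 n)
  map_add' := by simp
  map_smul' := by simp

/-- connecting map, second variable -/
noncomputable def dr (h : SES f g) (N : ModuleCat.{u} R) (n : ℕ) :
    EX N D n →ₗ[R] EX N A (n + 1) where
  toFun x := x.comp h.shortExact.extClass rfl
  map_add' := by simp
  map_smul' := by simp

lemma dl_exact₁ (h : SES f g) (w : ModuleCat.{u} R) (n : ℕ) :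
    Function.Exact (pre f w n) (h.dl w n) := by
  intro x
  constructor
  · intro hx
    exact Abelian.Ext.contravariant_sequence_exact₁ h.shortExact w x (add_comm 1 n) hx
  · rintro ⟨y, rfl⟩
    exact h.shortExact.extClass_comp_assoc y (h := add_comm 1 n)

lemma dl_exact₂ (h : SES f g) (w : ModuleCat.{u} R) (n : ℕ) :
    Function.Exact (pre g w n) (pre f w n) := by
  intro x
  constructor
  · intro hx
    exact Abelian.Ext.contravariant_sequence_exact₂ h.shortExact w x hx
  · rintro ⟨y, rfl⟩
    rw [← pre_comp, h.comp_zero, pre_zero]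

lemma dl_exact₃ (h : SES f g) (w : ModuleCat.{u} R) (n : ℕ) :
    Function.Exact (h.dl w n) (pre g w (n + 1)) := by
  intro x
  constructor
  · intro hx
    exact Abelian.Ext.contravariant_sequence_exact₃ h.shortExact w x hx (add_comm 1 n)
  · rintro ⟨y, rfl⟩
    exact h.shortExact.comp_extClass_assoc y (add_comm 1 n)

lemma dr_exact₁ (h : SES f g) (N : ModuleCat.{u} R) (n : ℕ) :
    Function.Exact (h.dr N n) (post N f (n + 1)) := by
  intro x
  constructor
  · intro hx
    exact Abelian.Ext.covariant_sequence_exact₁ N h.shortExact x hx rfl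
  · rintro ⟨y, rfl⟩
    change (y.comp h.shortExact.extClass rfl).comp (Abelian.Ext.mk₀ h.sc.f) (add_zero _) = 0
    rw [Abelian.Ext.comp_assoc_of_third_deg_zero, ShortComplex.ShortExact.extClass_comp,
      Abelian.Ext.comp_zero]

lemma dr_exact₂ (h : SES f g) (N : ModuleCat.{u} R) (n : ℕ) :
    Function.Exact (post N f n) (post N g n) := by
  intro x
  constructor
  · intro hx
    exact Abelian.Ext.covariant_sequence_exact₂ N h.shortExact x hx
  · rintro ⟨y, rfl⟩
    rw [← post_comp, h.comp_zero, post_zero]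

lemma dr_exact₃ (h : SES f g) (N : ModuleCat.{u} R) (n : ℕ) :
    Function.Exact (post N g n) (h.dr N n) := by
  intro x
  constructor
  · intro hx
    exact Abelian.Ext.covariant_sequence_exact₃ N h.shortExact x rfl hx
  · rintro ⟨y, rfl⟩
    change (y.comp (Abelian.Ext.mk₀ h.sc.g) (add_zero _)).comp h.shortExact.extClass rfl = 0
    rw [Abelian.Ext.comp_assoc_of_second_deg_zero, ShortComplex.ShortExact.comp_extClass,
      Abelian.Ext.comp_zero]

lemma pre_dr (h : SES f g) (k : A' →ₗ[R] B') (n : ℕ) (x : EX B' D n) :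
    pre k A (n + 1) (h.dr B' n x) = h.dr A' n (pre k D n x) := by
  change (Abelian.Ext.mk₀ (ModuleCat.ofHom k)).comp (x.comp h.shortExact.extClass rfl) (zero_add _) =
    ((Abelian.Ext.mk₀ (ModuleCat.ofHom k)).comp x (zero_add _)).comp h.shortExact.extClass rfl
  rw [Abelian.Ext.comp_assoc]; simp

lemma dl_post (h : SES f g) (k : A' →ₗ[R] B') (n : ℕ) (x : EX A A' n) :
    post D k (n + 1) (h.dl A' n x) = h.dl B' n (post A k n x) := by
  change (h.shortExact.extClass.comp x (add_comm 1 n)).comp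
      (Abelian.Ext.mk₀ (ModuleCat.ofHom k)) (add_zero _) =
    h.shortExact.extClass.comp (x.comp (Abelian.Ext.mk₀ (ModuleCat.ofHom k)) (add_zero _))
      (add_comm 1 n)
  rw [Abelian.Ext.comp_assoc]; simp; omega

end SES

lemma ses_ker {f : A →ₗ[R] B} (hf : Function.Surjective f) :
    SES (A := ModuleCat.of R (LinearMap.ker f)) (LinearMap.ker f).subtype f where
  inj := Subtype.val_injective
  exact := LinearMap.exact_subtype_ker_map f
  surj := hf

lemma ses_coker {f : A →ₗ[R] B} (hf : Function.Injective f) :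
    SES (D := ModuleCat.of R (B ⧸ LinearMap.range f)) f (LinearMap.range f).mkQ where
  inj := hf
  exact := LinearMap.exact_map_mkQ_range f
  surj := Submodule.mkQ_surjective _

/-- Vanishing of Ext. -/
def EV (n : ℕ) (N w : ModuleCat.{u} R) : Prop := ∀ x : EX N w n, x = 0

lemma EV.of_iso {n : ℕ} (e : A ≃ₗ[R] B) (h : EV n A w) : EV n B w := by
  intro x
  have := congrArg (pre e.symm.toLinearMap w n) (h (pre e.toLinearMap w n x))
  rw [← pre_comp, map_zero] at this
  simpa [pre_id] using this

lemma EV.of_iso_right {n : ℕ} (e : A ≃ₗ[R] B) (h : EV n N A) : EV n N B := by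
  intro x
  have := congrArg (post N e.toLinearMap n) (h (post N e.symm.toLinearMap n x))
  rw [← post_comp, map_zero] at this
  simpa [post_id] using this

lemma EV_of_projective (h : Module.Projective R N) (n : ℕ) : EV (n + 1) N w := by
  have : Projective N := (IsProjective.iff_projective N).1 h
  intro x
  exact x.eq_zero_of_projective

lemma EV_of_injective (h : Module.Injective R w) (n : ℕ) : EV (n + 1) N w := by
  have : Injective w := (Module.injective_iff_injective_object R w).1 h
  intro x
  exact x.eq_zero_of_injective

section
variable {f : A →ₗ[R] B} {g : B →ₗ[R] D} {n : ℕ}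

lemma SES.EV_mid (h : SES f g) (h1 : EV n A w) (h3 : EV n D w) : EV n B w := fun x => by
  obtain ⟨y, rfl⟩ := (h.dl_exact₂ w n x).1 (h1 _)
  rw [h3 y, map_zero]

lemma SES.EV_left (h : SES f g) (h1 : EV n B w) (h3 : EV (n + 1) D w) : EV n A w := fun x => by
  obtain ⟨y, rfl⟩ := (h.dl_exact₁ w n x).1 (h3 _)
  rw [h1 y, map_zero]

lemma SES.EV_right (h : SES f g) (h1 : EV n A w) (h3 : EV (n + 1) B w) : EV (n + 1) D w := fun x => by
  obtain ⟨y, rfl⟩ := (h.dl_exact₃ w n x).1 (h3 _)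
  rw [h1 y, map_zero]

lemma SES.EV_mid' (h : SES f g) (h1 : EV n N A) (h3 : EV n N D) : EV n N B := fun x => by
  obtain ⟨y, rfl⟩ := (h.dr_exact₂ N n x).1 (h3 _)
  rw [h1 y, map_zero]

lemma SES.EV_left' (h : SES f g) (h1 : EV n N D) (h3 : EV (n + 1) N B) : EV (n + 1) N A := fun x => by
  obtain ⟨y, rfl⟩ := (h.dr_exact₁ N n x).1 (h3 _)
  rw [h1 y, map_zero]

lemma SES.EV_right' (h : SES f g) (h1 : EV n N B) (h3 : EV (n + 1) N A) : EV n N D := fun x => by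
  obtain ⟨y, rfl⟩ := (h.dr_exact₃ N n x).1 (h3 _)
  rw [h1 y, map_zero]

/-- extension of maps when `Ext^1` vanishes -/
lemma SES.extend (h : SES f g) (h1 : EV 1 D w) (k : A →ₗ[R] w) : ∃ l : B →ₗ[R] w, l ∘ₗ f = k := by
  obtain ⟨y, hy⟩ := (h.dl_exact₁ w 0 ((e0 A w).symm k)).1 (h1 _)
  refine ⟨e0 _ _ y, ?_⟩
  rw [← e0_pre, hy, LinearEquiv.apply_symm_apply]

lemma SES.lift (h : SES f g) (h1 : EV 1 N A) (k : N →ₗ[R] D) : ∃ l : N →ₗ[R] B, g ∘ₗ l = k := by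
  obtain ⟨y, hy⟩ := (h.dr_exact₃ N 0 ((e0 N D).symm k)).1 (h1 _)
  refine ⟨e0 _ _ y, ?_⟩
  rw [← e0_post, hy, LinearEquiv.apply_symm_apply]

/-- converse -/
lemma SES.EV_one_of_extend (h : SES f g) (h1 : EV 1 B w)
    (hk : ∀ k : A →ₗ[R] w, ∃ l : B →ₗ[R] w, l ∘ₗ f = k) : EV 1 D w := fun x => by
  obtain ⟨y, rfl⟩ := (h.dl_exact₃ w 0 x).1 (h1 _)
  obtain ⟨l, hl⟩ := hk (e0 _ _ y)
  refine (h.dl_exact₁ w 0 y).2 ⟨(e0 _ _).symm l, ?_⟩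
  apply (e0 _ _).injective
  rw [e0_pre, LinearEquiv.apply_symm_apply, hl]

end

end GC
end

section
open CategoryTheory IsLocalRing


namespace GC

variable {R : Type u} [CommRing R]
variable {A B D A' B' D' X Y K L : ModuleCat.{u} R}

lemma exists_desc {A B D : Type*} [AddCommGroup A] [AddCommGroup B] [AddCommGroup D]
    [Module R A] [Module R B] [Module R D]
    (p : A →ₗ[R] B) (hp : Function.Surjective p) (h : A →ₗ[R] D)
    (hk : ∀ x, p x = 0 → h x = 0) : ∃ h' : B →ₗ[R] D, ∀ x, h' (p x) = h x := by
  refine ⟨(LinearMap.ker p).liftQ h (fun x hx => hk x hx) ∘ₗ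
    (p.quotKerEquivOfSurjective hp).symm.toLinearMap, fun x => ?_⟩
  have : (p.quotKerEquivOfSurjective hp).symm (p x) = (LinearMap.ker p).mkQ x := by
    rw [LinearEquiv.symm_apply_eq]; rfl
  rw [LinearMap.comp_apply, LinearEquiv.coe_coe, this]; rfl

/-- horseshoe, injective version -/
lemma horseshoe_inj {f : A →ₗ[R] B} {g : B →ₗ[R] D} (h : SES f g)
    {a : A →ₗ[R] X} {a' : X →ₗ[R] A'} (ha : SES a a')
    {e : D →ₗ[R] Y} {e' : Y →ₗ[R] D'} (he : SES e e') (l : B →ₗ[R] X) (hl : ∀ x, l (f x) = a x) :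
    ∃ (B' : ModuleCat.{u} R) (b : B →ₗ[R] (ModuleCat.of R (X × Y) : ModuleCat.{u} R))
      (b' : (ModuleCat.of R (X × Y) : ModuleCat.{u} R) →ₗ[R] B')
      (f' : A' →ₗ[R] B') (g' : B' →ₗ[R] D'), SES b b' ∧ SES f' g' := by
  let b : B →ₗ[R] (X × Y) := l.prod (e ∘ₗ g)
  have hb : ∀ t, b t = (l t, e (g t)) := fun t => rfl
  have gf : ∀ t, g (f t) = 0 := fun t => h.exact.apply_apply_eq_zero t
  let q := (LinearMap.range b).mkQ
  have hq : ∀ t, q t = 0 ↔ ∃ s, b s = t := fun t => by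
    simp [q]
  have qs : Function.Surjective q := Submodule.mkQ_surjective _
  have hbi : Function.Injective b := by
    rw [injective_iff_map_eq_zero]
    intro t ht
    rw [hb, Prod.mk_eq_zero] at ht
    have h2 : g t = 0 := he.inj (by rw [ht.2, map_zero])
    obtain ⟨s, rfl⟩ := (h.exact t).1 h2
    rw [hl] at ht
    rw [ha.inj (ht.1.trans (map_zero a).symm), map_zero]
  obtain ⟨f', hf'⟩ := exists_desc a' ha.surj (q ∘ₗ LinearMap.inl R X Y) (fun x hx => by
    obtain ⟨s, rfl⟩ := (ha.exact x).1 hx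
    refine (hq _).2 ⟨f s, ?_⟩
    simp [hb, hl, gf])
  obtain ⟨g', hg'⟩ := exists_desc q qs (e' ∘ₗ LinearMap.snd R X Y) (fun x hx => by
    obtain ⟨s, rfl⟩ := (hq _).1 hx
    simp [hb, he.exact.apply_apply_eq_zero])
  refine ⟨ModuleCat.of R ((X × Y) ⧸ LinearMap.range b), b, q, f', g', ses_coker hbi, ⟨?_, ?_, ?_⟩⟩
  · rw [injective_iff_map_eq_zero]
    intro t ht
    obtain ⟨x, rfl⟩ := ha.surj t
    rw [hf'] at ht
    obtain ⟨s, hs⟩ := (hq _).1 ht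
    simp only [hb, LinearMap.inl_apply, Prod.mk.injEq] at hs
    have h2 : g s = 0 := he.inj (by rw [hs.2, map_zero])
    obtain ⟨r, rfl⟩ := (h.exact s).1 h2
    rw [← hs.1, hl, ha.exact.apply_apply_eq_zero]
  · intro t
    obtain ⟨⟨x, y⟩, rfl⟩ := qs t
    constructor
    · intro ht
      rw [hg'] at ht
      obtain ⟨z, hz⟩ := (he.exact y).1 ht
      obtain ⟨t, rfl⟩ := h.surj z
      refine ⟨a' (x - l t), ?_⟩
      rw [hf']
      rw [← sub_eq_zero, LinearMap.comp_apply, ← map_sub]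
      refine (hq _).2 ⟨-t, ?_⟩
      simp [hb, hz]
    · rintro ⟨s, hs⟩
      obtain ⟨z, rfl⟩ := ha.surj s
      rw [← hs, hf', LinearMap.comp_apply, hg']
      simp
  · intro t
    obtain ⟨y, rfl⟩ := he.surj t
    exact ⟨q (0, y), by rw [hg']; rfl⟩

/-- pushout -/
lemma pushout_ses {f : A →ₗ[R] B} {g : B →ₗ[R] D} (h : SES f g)
    {a : A →ₗ[R] X} {a' : X →ₗ[R] A'} (ha : SES a a') :
    ∃ (U : ModuleCat.{u} R) (i : X →ₗ[R] U) (p : U →ₗ[R] D) (j : B →ₗ[R] U) (q : U →ₗ[R] A'),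
      SES i p ∧ SES j q ∧ (∀ x, i (a x) = j (f x)) ∧ ∀ x, p (j x) = g x := by
  let b : A →ₗ[R] (X × B) := a.prod (-f)
  have hb : ∀ t, b t = (a t, - f t) := fun t => rfl
  let q := (LinearMap.range b).mkQ
  have hq : ∀ t, q t = 0 ↔ ∃ s, b s = t := fun t => by
    simp [q]
  have qs : Function.Surjective q := Submodule.mkQ_surjective _
  obtain ⟨p, hp⟩ := exists_desc q qs (g ∘ₗ LinearMap.snd R X B) (fun x hx => by
    obtain ⟨s, rfl⟩ := (hq _).1 hx
    simp [hb, h.exact.apply_apply_eq_zero])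
  obtain ⟨p', hp'⟩ := exists_desc q qs (a' ∘ₗ LinearMap.fst R X B) (fun x hx => by
    obtain ⟨s, rfl⟩ := (hq _).1 hx
    simp [hb, ha.exact.apply_apply_eq_zero])
  refine ⟨ModuleCat.of R ((X × B) ⧸ LinearMap.range b), q ∘ₗ LinearMap.inl R X B, p,
    q ∘ₗ LinearMap.inr R X B, p', ⟨?_, ?_, ?_⟩, ⟨?_, ?_, ?_⟩, ?_, ?_⟩
  · rw [injective_iff_map_eq_zero]
    intro x hx
    obtain ⟨s, hs⟩ := (hq _).1 hx
    simp only [hb, LinearMap.inl_apply, Prod.mk.injEq, neg_eq_zero] at hs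
    rw [← hs.1, h.inj (hs.2.trans (map_zero f).symm), map_zero]
  · intro t
    obtain ⟨⟨x, y⟩, rfl⟩ := qs t
    constructor
    · intro ht
      rw [hp] at ht
      obtain ⟨z, hz⟩ := (h.exact y).1 ht
      refine ⟨x + a z, ?_⟩
      rw [← sub_eq_zero, LinearMap.comp_apply, ← map_sub]
      refine (hq _).2 ⟨z, ?_⟩
      simp [hb, hz]
    · rintro ⟨s, hs⟩
      rw [← hs, LinearMap.comp_apply, hp]
      simp
  · intro t
    obtain ⟨y, rfl⟩ := h.surj t
    exact ⟨q (0, y), by rw [hp]; rfl⟩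
  · rw [injective_iff_map_eq_zero]
    intro x hx
    obtain ⟨s, hs⟩ := (hq _).1 hx
    simp only [hb, LinearMap.inr_apply, Prod.mk.injEq] at hs
    rw [← hs.2, ha.inj (hs.1.trans (map_zero a).symm), map_zero, neg_zero]
  · intro t
    obtain ⟨⟨x, y⟩, rfl⟩ := qs t
    constructor
    · intro ht
      rw [hp'] at ht
      obtain ⟨z, hz⟩ := (ha.exact x).1 ht
      refine ⟨y + f z, ?_⟩
      rw [← sub_eq_zero, LinearMap.comp_apply, ← map_sub]
      refine (hq _).2 ⟨-z, ?_⟩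
      simp [hb, hz]
    · rintro ⟨s, hs⟩
      rw [← hs, LinearMap.comp_apply, hp']
      simp
  · intro t
    obtain ⟨y, rfl⟩ := ha.surj t
    exact ⟨q (y, 0), by rw [hp']; rfl⟩
  · intro x
    rw [← sub_eq_zero, LinearMap.comp_apply, LinearMap.comp_apply, ← map_sub]
    refine (hq _).2 ⟨x, ?_⟩
    simp [hb]
  · intro x
    rw [LinearMap.comp_apply, hp]; rfl

/-- composition of injections -/
lemma comp_inj_ses {f : A →ₗ[R] B} {g : B →ₗ[R] D} (h : SES f g)
    {b : B →ₗ[R] X} {b' : X →ₗ[R] B'} (hb : SES b b') :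
    ∃ (Q : ModuleCat.{u} R) (p : X →ₗ[R] Q) (i : D →ₗ[R] Q) (q : Q →ₗ[R] B'),
      SES (b ∘ₗ f) p ∧ SES i q := by
  let q := (LinearMap.range (b ∘ₗ f)).mkQ
  have hq : ∀ t, q t = 0 ↔ ∃ s, b (f s) = t := fun t => by
    simp [q]
  have qs : Function.Surjective q := Submodule.mkQ_surjective _
  obtain ⟨p, hp⟩ := exists_desc q qs b' (fun x hx => by
    obtain ⟨s, rfl⟩ := (hq _).1 hx
    simp [hb.exact.apply_apply_eq_zero])
  obtain ⟨i, hi⟩ := exists_desc g h.surj (q ∘ₗ b) (fun x hx => by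
    obtain ⟨s, rfl⟩ := (h.exact _).1 hx
    exact (hq _).2 ⟨s, rfl⟩)
  refine ⟨ModuleCat.of R (X ⧸ LinearMap.range (b ∘ₗ f)), q, i, p,
    ses_coker (hb.inj.comp h.inj), ⟨?_, ?_, ?_⟩⟩
  · rw [injective_iff_map_eq_zero]
    intro x hx
    obtain ⟨s, rfl⟩ := h.surj x
    rw [hi] at hx
    obtain ⟨t, ht⟩ := (hq _).1 hx
    rw [← hb.inj ht, h.exact.apply_apply_eq_zero]
  · intro t
    obtain ⟨x, rfl⟩ := qs t
    rw [hp]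
    constructor
    · intro ht
      obtain ⟨z, hz⟩ := (hb.exact x).1 ht
      exact ⟨g z, by rw [hi, ← hz]; rfl⟩
    · rintro ⟨s, hs⟩
      obtain ⟨z, rfl⟩ := h.surj s
      rw [← hp, ← hs, hi, LinearMap.comp_apply, hp, hb.exact.apply_apply_eq_zero]
  · intro t
    obtain ⟨y, rfl⟩ := hb.surj t
    exact ⟨q y, hp y⟩

/-- composition of surjections -/
lemma comp_surj_ses {k : K →ₗ[R] X} {p : X →ₗ[R] B} (hk : SES k p)
    {f : A →ₗ[R] B} {g : B →ₗ[R] D} (h : SES f g) :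
    ∃ (L : ModuleCat.{u} R) (i : K →ₗ[R] L) (q : L →ₗ[R] A) (j : L →ₗ[R] X),
      SES i q ∧ SES j (g ∘ₗ p) := by
  let L := LinearMap.ker (g ∘ₗ p)
  have hL : ∀ x, x ∈ L ↔ g (p x) = 0 := fun x => Iff.rfl
  let fe := LinearEquiv.ofInjective f h.inj
  have hfe : ∀ a, ((fe a : LinearMap.range f) : B) = f a := fun a => rfl
  let q0 : L →ₗ[R] LinearMap.range f := (p ∘ₗ L.subtype).codRestrict _ (fun x =>
    (h.exact _).1 x.2)
  let q : L →ₗ[R] A := fe.symm.toLinearMap ∘ₗ q0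
  have hq : ∀ x : L, f (q x) = p x := fun x => by
    rw [← hfe]; simp [q]; rfl
  let i : K →ₗ[R] L := k.codRestrict _ (fun x => by
    rw [hL, hk.exact.apply_apply_eq_zero, map_zero])
  refine ⟨ModuleCat.of R L, i, q, L.subtype, ⟨?_, ?_, ?_⟩, ses_ker (h.surj.comp hk.surj)⟩
  · intro x y hxy
    exact hk.inj (congrArg Subtype.val hxy)
  · intro x
    constructor
    · intro hx
      have : p x = 0 := by rw [← hq, hx, map_zero]
      obtain ⟨y, hy⟩ := (hk.exact _).1 this
      exact ⟨y, Subtype.ext hy⟩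
    · rintro ⟨y, rfl⟩
      apply h.inj
      rw [hq, map_zero]
      exact hk.exact.apply_apply_eq_zero y
  · intro a
    obtain ⟨x, hx⟩ := hk.surj (f a)
    refine ⟨⟨x, by rw [hL, hx, h.exact.apply_apply_eq_zero]⟩, h.inj ?_⟩
    rw [hq, hx]

/-- pullback -/
lemma pullback_ses {f : A →ₗ[R] B} {g : B →ₗ[R] D} (h : SES f g)
    {k : K →ₗ[R] Y} {e : Y →ₗ[R] D} (hk : SES k e) :
    ∃ (P : ModuleCat.{u} R) (i : A →ₗ[R] P) (p : P →ₗ[R] Y) (j : K →ₗ[R] P) (q : P →ₗ[R] B),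
      SES i p ∧ SES j q := by
  let L := LinearMap.ker (g ∘ₗ LinearMap.fst R B Y - e ∘ₗ LinearMap.snd R B Y)
  have hL : ∀ x, x ∈ L ↔ g x.1 = e x.2 := fun x => by simp [L, sub_eq_zero]
  refine ⟨ModuleCat.of R L, (LinearMap.inl R B Y ∘ₗ f).codRestrict _ (fun x => by
      rw [hL]; simp [h.exact.apply_apply_eq_zero]), LinearMap.snd R B Y ∘ₗ L.subtype,
    (LinearMap.inr R B Y ∘ₗ k).codRestrict _ (fun x => by
      rw [hL]; simp [hk.exact.apply_apply_eq_zero]), LinearMap.fst R B Y ∘ₗ L.subtype,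
    ⟨?_, ?_, ?_⟩, ⟨?_, ?_, ?_⟩⟩
  · intro x y hxy
    exact h.inj (congrArg Prod.fst (congrArg Subtype.val hxy))
  · rintro ⟨⟨b, y⟩, hx⟩
    rw [hL] at hx
    constructor
    · intro h0
      have hy : y = 0 := h0
      subst hy
      simp only [map_zero] at hx
      obtain ⟨a, ha⟩ := (h.exact _).1 hx
      exact ⟨a, Subtype.ext (Prod.ext ha rfl)⟩
    · rintro ⟨a, ha⟩
      exact (congrArg Prod.snd (congrArg Subtype.val ha)).symm
  · intro y
    obtain ⟨b, hb⟩ := h.surj (e y)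
    exact ⟨⟨(b, y), (hL _).2 hb⟩, rfl⟩
  · intro x y hxy
    exact hk.inj (congrArg Prod.snd (congrArg Subtype.val hxy))
  · rintro ⟨⟨b, y⟩, hx⟩
    rw [hL] at hx
    constructor
    · intro h0
      have hy : b = 0 := h0
      subst hy
      simp only [map_zero] at hx
      obtain ⟨a, ha⟩ := (hk.exact _).1 hx.symm
      exact ⟨a, Subtype.ext (Prod.ext rfl ha)⟩
    · rintro ⟨a, ha⟩
      exact (congrArg Prod.fst (congrArg Subtype.val ha)).symm
  · intro y
    obtain ⟨b, hb⟩ := hk.surj (g y)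
    exact ⟨⟨(y, b), (hL _).2 hb.symm⟩, rfl⟩

/-- horseshoe, projective version -/
lemma horseshoe_proj {f : A →ₗ[R] B} {g : B →ₗ[R] D} (h : SES f g)
    {a : A' →ₗ[R] X} {a' : X →ₗ[R] A} (ha : SES a a')
    {e : D' →ₗ[R] Y} {e' : Y →ₗ[R] D} (he : SES e e') (l : Y →ₗ[R] B) (hl : ∀ x, g (l x) = e' x) :
    ∃ (B' : ModuleCat.{u} R) (b : B' →ₗ[R] (ModuleCat.of R (X × Y) : ModuleCat.{u} R))
      (b' : (ModuleCat.of R (X × Y) : ModuleCat.{u} R) →ₗ[R] B)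
      (f' : A' →ₗ[R] B') (g' : B' →ₗ[R] D'), SES b b' ∧ SES f' g' := by
  let b' : (X × Y) →ₗ[R] B := (f ∘ₗ a').coprod l
  have hb' : ∀ x, b' x = f (a' x.1) + l x.2 := fun x => rfl
  have gb' : ∀ x, g (b' x) = e' x.2 := fun x => by
    rw [hb', map_add, h.exact.apply_apply_eq_zero, zero_add, hl]
  have hs : Function.Surjective b' := by
    intro t
    obtain ⟨y, hy⟩ := he.surj (g t)
    obtain ⟨s, hs⟩ := (h.exact (t - l y)).1 (by rw [map_sub, hl, hy, sub_self])
    obtain ⟨x, rfl⟩ := ha.surj s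
    exact ⟨(x, y), by rw [hb', hs]; simp⟩
  let L := LinearMap.ker b'
  let ee := LinearEquiv.ofInjective e he.inj
  have hee : ∀ a, ((ee a : LinearMap.range e) : Y) = e a := fun a => rfl
  let q0 : L →ₗ[R] LinearMap.range e := (LinearMap.snd R X Y ∘ₗ L.subtype).codRestrict _ (fun x =>
    (he.exact _).1 (by
      have : b' x = 0 := x.2
      have h2 := gb' x
      rw [this, map_zero] at h2
      exact h2.symm))
  let q : L →ₗ[R] D' := ee.symm.toLinearMap ∘ₗ q0
  have hq : ∀ x : L, e (q x) = (x : X × Y).2 := fun x => by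
    rw [← hee]; simp [q]; rfl
  let i : A' →ₗ[R] L := (LinearMap.inl R X Y ∘ₗ a).codRestrict _ (fun x => by
    change b' _ = 0
    rw [hb']; simp [ha.exact.apply_apply_eq_zero])
  refine ⟨ModuleCat.of R L, L.subtype, b', i, q, ses_ker hs, ⟨?_, ?_, ?_⟩⟩
  · intro x y hxy
    exact ha.inj (congrArg Prod.fst (congrArg Subtype.val hxy))
  · intro x
    constructor
    · intro hx
      have h2 : (x : X × Y).2 = 0 := by rw [← hq, hx, map_zero]
      have h1 : b' x = 0 := x.2
      rw [hb', h2, map_zero, add_zero] at h1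
      have h3 : a' (x : X × Y).1 = 0 := h.inj (by rw [h1, map_zero])
      obtain ⟨z, hz⟩ := (ha.exact _).1 h3
      exact ⟨z, Subtype.ext (Prod.ext hz h2.symm)⟩
    · rintro ⟨y, rfl⟩
      apply he.inj
      rw [hq, map_zero]; rfl
  · intro t
    have h1 : g (l (e t)) = 0 := by rw [hl, he.exact.apply_apply_eq_zero]
    obtain ⟨s, hs⟩ := (h.exact _).1 h1
    obtain ⟨x, hx⟩ := ha.surj (-s)
    refine ⟨⟨(x, e t), ?_⟩, ?_⟩
    · change b' _ = 0
      rw [hb', hx]; simp [hs]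
    · apply he.inj
      rw [hq]

/-- free cover -/
lemma exists_proj_cover (N : ModuleCat.{u} R) :
    ∃ (P K : ModuleCat.{u} R) (i : K →ₗ[R] P) (p : P →ₗ[R] N), Module.Projective R P ∧ SES i p := by
  refine ⟨ModuleCat.of R (N →₀ R), ModuleCat.of R (LinearMap.ker (Finsupp.linearCombination R (id : N → N))),
    _, Finsupp.linearCombination R (id : N → N), inferInstanceAs (Module.Projective R (N →₀ R)),
    ses_ker ?_⟩
  intro x
  exact ⟨Finsupp.single x 1, by simp⟩

end GC
end

section
open CategoryTheory IsLocalRing Paper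


namespace GC

variable {R : Type u} [CommRing R]
variable {A B D A' B' D' X Y K L N w : ModuleCat.{u} R}

/-- the coinductive class -/
def Gp (V W : ModuleCat.{u} R → Prop) (N : ModuleCat.{u} R) : Prop :=
  ∃ S : ModuleCat.{u} R → Prop, S N ∧ ∀ X, S X → (∀ i w, W w → EV (i + 1) X w) ∧
    ∃ (v X' : ModuleCat.{u} R) (f : X →ₗ[R] v) (g : v →ₗ[R] X'), V v ∧ SES f g ∧ S X'

lemma Gp.EV {V W : ModuleCat.{u} R → Prop} (h : Gp V W N) (i : ℕ) (hw : W w) :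
    EV (i + 1) N w := by
  obtain ⟨S, hN, hS⟩ := h
  exact (hS N hN).1 i w hw

lemma Gp.step {V W : ModuleCat.{u} R → Prop} (h : Gp V W N) :
    ∃ (v X' : ModuleCat.{u} R) (f : N →ₗ[R] v) (g : v →ₗ[R] X'), V v ∧ SES f g ∧ Gp V W X' := by
  obtain ⟨S, hN, hS⟩ := h
  obtain ⟨v, X', f, g, hv, hfg, hX⟩ := (hS N hN).2
  exact ⟨v, X', f, g, hv, hfg, S, hX, hS⟩

lemma Gp.of_step {V W : ModuleCat.{u} R → Prop} (hE : ∀ i w, W w → GC.EV (i + 1) N w)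
    {v : ModuleCat.{u} R} (hv : V v) {f : N →ₗ[R] v} {g : v →ₗ[R] X} (h : SES f g)
    (hX : Gp V W X) : Gp V W N := by
  refine ⟨fun Y => Y = N ∨ Gp V W Y, Or.inl rfl, fun Y hY => ?_⟩
  rcases hY with rfl | hY
  · exact ⟨hE, v, X, f, g, hv, h, Or.inr hX⟩
  · refine ⟨fun i w hw => hY.EV i hw, ?_⟩
    obtain ⟨v, X', f, g, hv, hfg, hX⟩ := hY.step
    exact ⟨v, X', f, g, hv, hfg, Or.inr hX⟩

lemma SES.of_iso_left {f : A →ₗ[R] B} {g : B →ₗ[R] D} (h : SES f g) (e : A' ≃ₗ[R] A) :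
    SES (f ∘ₗ e.toLinearMap) g where
  inj := h.inj.comp e.injective
  exact := by
    intro x
    rw [h.exact x]
    constructor
    · rintro ⟨y, rfl⟩
      exact ⟨e.symm y, by simp⟩
    · rintro ⟨y, rfl⟩
      exact ⟨e y, rfl⟩
  surj := h.surj

lemma SES.of_iso_mid {f : A →ₗ[R] B} {g : B →ₗ[R] D} (h : SES f g) (e : B ≃ₗ[R] B') :
    SES (e.toLinearMap ∘ₗ f) (g ∘ₗ e.symm.toLinearMap) where
  inj := e.injective.comp h.inj
  exact := by
    intro x
    simp only [LinearMap.comp_apply, LinearEquiv.coe_coe]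
    rw [h.exact]
    constructor
    · rintro ⟨y, hy⟩
      exact ⟨y, by simp [hy]⟩
    · rintro ⟨y, rfl⟩
      exact ⟨y, by simp⟩
  surj := h.surj.comp e.symm.surjective

lemma SES.of_iso_right {f : A →ₗ[R] B} {g : B →ₗ[R] D} (h : SES f g) (e : D ≃ₗ[R] D') :
    SES f (e.toLinearMap ∘ₗ g) where
  inj := h.inj
  exact := by
    intro x
    simp only [LinearMap.comp_apply, LinearEquiv.coe_coe]
    rw [← h.exact]
    simp
  surj := e.surjective.comp h.surj

/-- uniqueness of kernels -/
lemma SES.kerEquiv {f : A →ₗ[R] B} {g : B →ₗ[R] D} (h : SES f g) :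
    Nonempty (A ≃ₗ[R] LinearMap.ker g) :=
  ⟨(LinearEquiv.ofInjective f h.inj).trans
    (LinearEquiv.ofEq _ _ (LinearMap.exact_iff.1 h.exact).symm)⟩

lemma SES.cokerEquiv {f : A →ₗ[R] B} {g : B →ₗ[R] D} (h : SES f g) :
    Nonempty ((B ⧸ LinearMap.range f) ≃ₗ[R] D) :=
  ⟨(Submodule.quotEquivOfEq _ _ (LinearMap.exact_iff.1 h.exact).symm).trans
    (g.quotKerEquivOfSurjective h.surj)⟩

lemma Gp.of_iso {V W : ModuleCat.{u} R → Prop} (h : Gp V W A) (e : A ≃ₗ[R] B) : Gp V W B := by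
  obtain ⟨v, X', f, g, hv, hfg, hX⟩ := h.step
  exact Gp.of_step (fun i w hw => (h.EV i hw).of_iso e) hv (hfg.of_iso_left e.symm) hX

/-- good classes `W` -/
structure Good (W : ModuleCat.{u} R → Prop) : Prop where
  prod : ∀ {A B : ModuleCat.{u} R}, W A → W B → W (ModuleCat.of R (A × B))
  zero : W (ModuleCat.of R PUnit)
  self : ∀ {A B : ModuleCat.{u} R}, W A → W B → ∀ i, EV (i + 1) A B

variable {W : ModuleCat.{u} R → Prop}

lemma ses_zero_right (A : ModuleCat.{u} R) :
    SES (LinearMap.id : A →ₗ[R] A) (0 : A →ₗ[R] (ModuleCat.of R PUnit : ModuleCat.{u} R)) where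
  inj := fun _ _ h => h
  exact := fun x => by simp
  surj := fun x => ⟨0, Subsingleton.elim (α := PUnit) _ _⟩

lemma Good.zero_mem (hW : Good W) : Gp W W (ModuleCat.of R PUnit) :=
  ⟨fun X => X = ModuleCat.of R PUnit, rfl, fun X hX => by
    subst hX
    refine ⟨fun i w hw => hW.self hW.zero hw i, _, _, _, _, hW.zero, ses_zero_right _, rfl⟩⟩

lemma Good.mem (hW : Good W) (hw : W w) : Gp W W w :=
  Gp.of_step (fun i _ hw' => hW.self hw hw' i) hw (ses_zero_right w) hW.zero_mem

lemma Good.ext (hW : Good W) {f : A →ₗ[R] B} {g : B →ₗ[R] D} (h : SES f g) (hA : Gp W W A)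
    (hD : Gp W W D) : Gp W W B := by
  refine ⟨fun B => ∃ (A D : ModuleCat.{u} R) (f : A →ₗ[R] B) (g : B →ₗ[R] D), SES f g ∧ Gp W W A ∧
    Gp W W D, ⟨A, D, f, g, h, hA, hD⟩, ?_⟩
  clear * - hW
  rintro B ⟨A, D, f, g, h, hA, hD⟩
  refine ⟨fun i w hw => h.EV_mid (hA.EV i hw) (hD.EV i hw), ?_⟩
  obtain ⟨X, A', a, a', hX, ha, hA'⟩ := hA.step
  obtain ⟨Y, D', e, e', hY, he, hD'⟩ := hD.step
  obtain ⟨l, hl⟩ := h.extend (hD.EV 0 hX) a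
  obtain ⟨B', b, b', f', g', h1, h2⟩ := horseshoe_inj h ha he l (fun x => by rw [← hl]; rfl)
  exact ⟨_, B', b, b', hW.prod hX hY, h1, A', D', f', g', h2, hA', hD'⟩

lemma Good.ker (hW : Good W) {f : A →ₗ[R] B} {g : B →ₗ[R] D} (h : SES f g) (hB : Gp W W B)
    (hD : Gp W W D) : Gp W W A := by
  obtain ⟨X, B', b, b', hX, hb, hB'⟩ := hB.step
  obtain ⟨Q, p, i, q, h1, h2⟩ := comp_inj_ses h hb
  exact Gp.of_step (fun i w hw => h.EV_left (hB.EV i hw) (hD.EV (i + 1) hw)) hX h1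
    (hW.ext h2 hD hB')

/-! ### resolution dimension -/

/-- resolving classes -/
structure Resolving (G : ModuleCat.{u} R → Prop) : Prop where
  iso : ∀ {A B : ModuleCat.{u} R}, G A → (A ≃ₗ[R] B) → G B
  ext : ∀ {A B D : ModuleCat.{u} R} {f : A →ₗ[R] B} {g : B →ₗ[R] D}, SES f g → G A → G D → G B
  ker : ∀ {A B D : ModuleCat.{u} R} {f : A →ₗ[R] B} {g : B →ₗ[R] D}, SES f g → G B → G D → G A
  proj : ∀ {A : ModuleCat.{u} R}, Module.Projective R A → G A

lemma Good.resolving (hW : Good W) (hp : ∀ A : ModuleCat.{u} R, Module.Projective R A → Gp W W A) :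
    Resolving (Gp W W) where
  iso := Gp.of_iso
  ext := hW.ext
  ker := hW.ker
  proj := hp _

variable {G : ModuleCat.{u} R → Prop} {k : ℕ}

lemma ResDimLE.mono_succ (h : ResDimLE R G k N) : ResDimLE R G (k + 1) N := Or.inl h

lemma ResDimLE.mono {l : ℕ} (h : ResDimLE R G k N) (hl : k ≤ l) : ResDimLE R G l N := by
  induction l, hl using Nat.le_induction with
  | base => exact h
  | succ n _ ih => exact Or.inl ih

lemma Resolving.dim_iso (hG : Resolving G) (h : ResDimLE R G k A) (e : A ≃ₗ[R] B) :
    ResDimLE R G k B := by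
  induction k generalizing A B with
  | zero => exact hG.iso h e
  | succ k ih =>
    rcases h with h | ⟨X, f, hX, hf, hK⟩
    · exact Or.inl (ih h e)
    · exact Or.inr ⟨X, e.toLinearMap ∘ₗ f, hX, e.surjective.comp hf, ih hK
        (LinearEquiv.ofEq _ _ (by ext; simp))⟩

lemma Resolving.dim_succ (hG : Resolving G) {i : K →ₗ[R] X} {p : X →ₗ[R] N} (h : SES i p)
    (hX : G X) (hK : ResDimLE R G k K) : ResDimLE R G (k + 1) N := by
  obtain ⟨e⟩ := h.kerEquiv
  exact Or.inr ⟨X, p, hX, h.surj, hG.dim_iso hK e⟩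

lemma dim_succ_cases (h : ResDimLE R G (k + 1) N) : ResDimLE R G k N ∨
    ∃ (K X : ModuleCat.{u} R) (i : K →ₗ[R] X) (p : X →ₗ[R] N), SES i p ∧ G X ∧ ResDimLE R G k K := by
  rcases h with h | ⟨X, f, hX, hf, hK⟩
  · exact Or.inl h
  · exact Or.inr ⟨_, X, _, f, ses_ker hf, hX, hK⟩

/-- (P2) -/
lemma Resolving.dim_ker (hG : Resolving G) {f : A →ₗ[R] B} {g : B →ₗ[R] D} (h : SES f g)
    (hB : ResDimLE R G k B) (hD : G D) : ResDimLE R G k A := by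
  induction k with
  | zero => exact hG.ker h hB hD
  | succ k ih =>
    rcases dim_succ_cases hB with hB | ⟨K, X, i, p, hs, hX, hK⟩
    · exact Or.inl (ih hB)
    · obtain ⟨L, i', q, j, h1, h2⟩ := comp_surj_ses hs h
      exact hG.dim_succ h1 (hG.ker h2 hX hD) hK

lemma proj_lift {P : ModuleCat.{u} R} (hP : Module.Projective R P) {g : B →ₗ[R] D}
    (hg : Function.Surjective g) (p : P →ₗ[R] D) : ∃ l : P →ₗ[R] B, ∀ x, g (l x) = p x := by
  obtain ⟨l, hl⟩ := Module.projective_lifting_property g p hg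
  exact ⟨l, fun x => by rw [← hl]; rfl⟩

lemma Resolving.dim_ext_aux (hG : Resolving G) : ∀ k : ℕ,
    (∀ {A B D : ModuleCat.{u} R} {f : A →ₗ[R] B} {g : B →ₗ[R] D}, SES f g →
      ResDimLE R G k A → ResDimLE R G k D → ResDimLE R G k B) ∧
    (∀ {K P N : ModuleCat.{u} R} {i : K →ₗ[R] P} {p : P →ₗ[R] N}, SES i p → Module.Projective R P →
      ResDimLE R G (k + 1) N → ResDimLE R G k K) := by
  have key : ∀ k : ℕ, (∀ {A B D : ModuleCat.{u} R} {f : A →ₗ[R] B} {g : B →ₗ[R] D}, SES f g →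
      ResDimLE R G k A → ResDimLE R G k D → ResDimLE R G k B) →
     (∀ {K P N : ModuleCat.{u} R} {i : K →ₗ[R] P} {p : P →ₗ[R] N}, SES i p → Module.Projective R P →
      ResDimLE R G k N → ResDimLE R G k K) →
    (∀ {K P N : ModuleCat.{u} R} {i : K →ₗ[R] P} {p : P →ₗ[R] N}, SES i p → Module.Projective R P →
      ResDimLE R G (k + 1) N → ResDimLE R G k K) := by
    intro k hext hk K P N i p hs hP hN
    rcases dim_succ_cases hN with hN | ⟨L, X, j, q, hs', hX, hL⟩
    · exact hk hs hP hN
    · obtain ⟨T, i1, p1, j1, q1, h1, h2⟩ := pullback_ses hs' hs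
      exact hG.dim_ker h2 (hext h1 hL (ResDimLE.mono (k := 0) (hG.proj hP) (Nat.zero_le k))) hX
  intro k
  induction k with
  | zero =>
    have h0 : (∀ {A B D : ModuleCat.{u} R} {f : A →ₗ[R] B} {g : B →ₗ[R] D}, SES f g →
      ResDimLE R G 0 A → ResDimLE R G 0 D → ResDimLE R G 0 B) := fun h hA hD => hG.ext h hA hD
    exact ⟨h0, key 0 h0 (fun h hP hN => hG.ker h (hG.proj hP) hN)⟩
  | succ k ih =>
    have h0 : (∀ {A B D : ModuleCat.{u} R} {f : A →ₗ[R] B} {g : B →ₗ[R] D}, SES f g →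
      ResDimLE R G (k + 1) A → ResDimLE R G (k + 1) D → ResDimLE R G (k + 1) B) := by
      intro A B D f g h hA hD
      obtain ⟨P, K, i, p, hP, hs⟩ := exists_proj_cover A
      obtain ⟨P', K', i', p', hP', hs'⟩ := exists_proj_cover D
      obtain ⟨l, hl⟩ := proj_lift hP' h.surj p'
      obtain ⟨B', b, b', f', g', h1, h2⟩ := horseshoe_proj h hs hs' l hl
      refine hG.dim_succ h1 (hG.proj ?_) (ih.1 h2 (ih.2 hs hP hA) (ih.2 hs' hP' hD))
      exact inferInstanceAs (Module.Projective R (P × P'))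
    exact ⟨h0, key _ h0 (fun h hP hN => Or.inl (ih.2 h hP hN))⟩

/-- (P4) -/
lemma Resolving.dim_ext (hG : Resolving G) {f : A →ₗ[R] B} {g : B →ₗ[R] D} (h : SES f g)
    (hA : ResDimLE R G k A) (hD : ResDimLE R G k D) : ResDimLE R G k B :=
  (hG.dim_ext_aux k).1 h hA hD

/-- (P1) -/
lemma Resolving.dim_syz (hG : Resolving G) {i : K →ₗ[R] X} {p : X →ₗ[R] N} (h : SES i p)
    (hX : Module.Projective R X) (hN : ResDimLE R G (k + 1) N) : ResDimLE R G k K :=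
  (hG.dim_ext_aux k).2 h hX hN

/-- (P3) -/
lemma Resolving.dim_coker (hG : Resolving G) {f : A →ₗ[R] B} {g : B →ₗ[R] D} (h : SES f g)
    (hA : ResDimLE R G k A) (hB : ResDimLE R G k B) : ResDimLE R G (k + 1) D := by
  obtain ⟨P, K, i, p, hP, hs⟩ := exists_proj_cover B
  obtain ⟨L, i', q, j, h1, h2⟩ := comp_surj_ses hs h
  exact hG.dim_succ h2 (hG.proj hP) (hG.dim_ext h1 (hG.dim_syz hs hP (Or.inl hB)) hA)

lemma dim_EV {V : ModuleCat.{u} R → Prop} (h : ResDimLE R (Gp V W) k N) (hw : W w) (i : ℕ) :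
    EV (k + i + 1) N w := by
  induction k generalizing N i with
  | zero => exact Gp.EV h _ hw
  | succ k ih =>
    rcases dim_succ_cases h with hN | ⟨K, X, j, p, hs, hX, hK⟩
    · have := ih hN (i + 1)
      rwa [show k + 1 + i + 1 = k + (i + 1) + 1 by omega]
    · rw [show k + 1 + i + 1 = k + i + 1 + 1 by omega]
      exact hs.EV_right (ih hK i) (hX.EV _ hw)

/-- (L5) -/
lemma Good.dim_drop (hW : Good W) (hG : Resolving (Gp W W))
    (h : ResDimLE R (Gp W W) (k + 1) N) (hE : ∀ w, W w → EV (k + 1) N w) :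
    ResDimLE R (Gp W W) k N := by
  induction k generalizing N with
  | zero =>
    rcases dim_succ_cases h with hN | ⟨K, X, j, p, hs, hX, hK⟩
    · exact hN
    · obtain ⟨v, X', f, g, hv, hfg, hX'⟩ := Gp.step hK
      obtain ⟨U, i, q, j', q', h1, h2, -⟩ := pushout_ses hs hfg
      have hU : Gp W W U := hW.ext h2 hX hX'
      obtain ⟨l, hl⟩ := h1.lift (hE v hv) LinearMap.id
      have hl' : ∀ x, q (l x) = x := fun x => LinearMap.congr_fun hl x
      -- retraction
      let e := LinearEquiv.ofInjective i h1.inj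
      let r0 : U →ₗ[R] LinearMap.range i := (LinearMap.id - l ∘ₗ q).codRestrict _ (fun x =>
        (h1.exact _).1 (by simp [hl']))
      have hr0 : ∀ x, ((r0 x : LinearMap.range i) : U) = x - l (q x) := fun x => rfl
      have : SES l (e.symm.toLinearMap ∘ₗ r0) := by
        refine ⟨fun x y hxy => by rw [← hl' x, hxy, hl'], fun x => ?_, fun x => ?_⟩
        · rw [LinearMap.comp_apply, LinearEquiv.coe_coe, LinearEquiv.map_eq_zero_iff]
          rw [← Subtype.coe_inj, hr0]
          simp only [ZeroMemClass.coe_zero, sub_eq_zero]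
          constructor
          · intro hx
            exact ⟨q x, hx.symm⟩
          · rintro ⟨y, rfl⟩
            rw [hl']
        · refine ⟨i x, ?_⟩
          rw [LinearMap.comp_apply, LinearEquiv.coe_coe, LinearEquiv.symm_apply_eq]
          apply Subtype.ext
          rw [hr0, h1.exact.apply_apply_eq_zero, map_zero, sub_zero]; rfl
      exact hW.ker this hU (hW.mem hv)
  | succ k ih =>
    rcases dim_succ_cases h with hN | ⟨K, X, j, p, hs, hX, hK⟩
    · exact hN
    · exact hG.dim_succ hs hX (ih hK (fun w hw => hs.EV_left (hX.EV _ hw) (hE w hw)))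

end GC
end

section
open CategoryTheory IsLocalRing Paper


namespace GC

variable {R : Type u} [CommRing R]
variable {A B D A' B' D' X Y K L N w : ModuleCat.{u} R}

lemma SES.dl_nat {f : A →ₗ[R] B} {g : B →ₗ[R] D} (h : SES f g)
    {f' : A' →ₗ[R] B'} {g' : B' →ₗ[R] D'} (h' : SES f' g')
    (a : A →ₗ[R] A') (b : B →ₗ[R] B') (c : D →ₗ[R] D')
    (h1 : b ∘ₗ f = f' ∘ₗ a) (h2 : c ∘ₗ g = g' ∘ₗ b) (w : ModuleCat.{u} R) (n : ℕ) (x : EX A' w n) :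
    pre c w (n + 1) (h'.dl w n x) = h.dl w n (pre a w n x) := by
  let φ : h.sc ⟶ h'.sc :=
    { τ₁ := ModuleCat.ofHom a
      τ₂ := ModuleCat.ofHom b
      τ₃ := ModuleCat.ofHom c
      comm₁₂ := by
        change ModuleCat.ofHom a ≫ ModuleCat.ofHom f' = ModuleCat.ofHom f ≫ ModuleCat.ofHom b
        rw [← ModuleCat.ofHom_comp, ← ModuleCat.ofHom_comp, h1]
      comm₂₃ := by
        change ModuleCat.ofHom b ≫ ModuleCat.ofHom g' = ModuleCat.ofHom g ≫ ModuleCat.ofHom c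
        rw [← ModuleCat.ofHom_comp, ← ModuleCat.ofHom_comp, h2] }
  have := ShortComplex.ShortExact.extClass_naturality h.shortExact h'.shortExact φ
  change (Abelian.Ext.mk₀ φ.τ₃).comp (h'.shortExact.extClass.comp x (add_comm 1 n)) (zero_add _) =
    h.shortExact.extClass.comp ((Abelian.Ext.mk₀ φ.τ₁).comp x (zero_add _)) (add_comm 1 n)
  rw [← Abelian.Ext.comp_assoc (a₁₂ := 1) _ _ _ (zero_add 1) (by omega) (by omega), ← this,
    Abelian.Ext.comp_assoc_of_second_deg_zero]

/-- countable direct sum -/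
noncomputable abbrev fs (N : ModuleCat.{u} R) : ModuleCat.{u} R := ModuleCat.of R (ℕ →₀ N)

/-- map on direct sums -/
noncomputable abbrev fsMap (f : A →ₗ[R] B) : fs A →ₗ[R] fs B := Finsupp.mapRange.linearMap f

/-- inclusion -/
noncomputable abbrev fsi (N : ModuleCat.{u} R) (j : ℕ) : N →ₗ[R] fs N := Finsupp.lsingle j

lemma fsMap_fsi (f : A →ₗ[R] B) (j : ℕ) : fsMap f ∘ₗ fsi A j = fsi B j ∘ₗ f := by
  ext x
  simp [fsMap, fsi]

lemma SES.fs {f : A →ₗ[R] B} {g : B →ₗ[R] D} (h : SES f g) : SES (fsMap f) (fsMap g) where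
  inj := Finsupp.mapRange_injective f (map_zero f) h.inj
  exact := by
    intro x
    constructor
    · intro hx
      have : ∀ j, ∃ y, f y = x j := fun j => (h.exact _).1 (by
        have := DFunLike.congr_fun hx j
        simpa using this)
      choose y hy using this
      refine ⟨Finsupp.onFinset x.support y (fun j hj => ?_), ?_⟩
      · rw [Finsupp.mem_support_iff]
        intro h0
        exact hj (h.inj (by rw [hy, h0, map_zero]))
      · ext j
        simp [hy]
    · rintro ⟨y, rfl⟩
      ext j
      simp [h.exact.apply_apply_eq_zero]
  surj := Finsupp.mapRange_surjective g (map_zero g) h.surj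

/-- components of an Ext class on a countable sum -/
noncomputable def cmp (N w : ModuleCat.{u} R) (n : ℕ) : EX (fs N) w n →ₗ[R] (ℕ → EX N w n) :=
  LinearMap.pi (fun j => pre (fsi N j) w n)

lemma cmp_apply (n : ℕ) (x : EX (fs N) w n) (j : ℕ) : cmp N w n x j = pre (fsi N j) w n x := rfl

lemma cmp_fsMap (f : A →ₗ[R] B) (n : ℕ) (x : EX (fs B) w n) (j : ℕ) :
    cmp A w n (pre (fsMap f) w n x) j = pre f w n (cmp B w n x j) := by
  rw [cmp_apply, cmp_apply, ← pre_comp, ← pre_comp, fsMap_fsi]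

lemma cmp_dl {f : A →ₗ[R] B} {g : B →ₗ[R] D} (h : SES f g) (n : ℕ) (x : EX (fs A) w n) (j : ℕ) :
    cmp D w (n + 1) (h.fs.dl w n x) j = h.dl w n (cmp A w n x j) := by
  rw [cmp_apply, cmp_apply]
  exact h.dl_nat h.fs _ (fsi B j) _ (fsMap_fsi f j).symm (fsMap_fsi g j).symm w n x

lemma fs_projective (h : Module.Projective R N) : Module.Projective R (fs N) :=
  have : Module.Projective R (DirectSum ℕ (fun _ => (N : Type u))) := inferInstance
  Module.Projective.of_equiv (finsuppLEquivDirectSum R N ℕ).symm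

lemma cmp_bijective (N w : ModuleCat.{u} R) (n : ℕ) : Function.Bijective (cmp N w n) := by
  induction n generalizing N with
  | zero =>
    constructor
    · rw [injective_iff_map_eq_zero]
      intro x hx
      apply (e0 _ _).injective
      rw [map_zero]
      refine Finsupp.lhom_ext' (fun j => ?_)
      have := congrFun hx j
      rw [cmp_apply] at this
      have h2 := e0_pre (fsi N j) x
      rw [this] at h2
      rw [← h2]; simp
    · intro y
      refine ⟨(e0 _ _).symm (Finsupp.lsum R (fun j => e0 _ _ (y j))), ?_⟩
      funext j
      apply (e0 _ _).injective
      rw [cmp_apply, e0_pre, LinearEquiv.apply_symm_apply]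
      exact Finsupp.lsum_comp_lsingle (R := R) (S := R) (fun j => e0 _ _ (y j)) j
  | succ n ih =>
    obtain ⟨P, K, i, p, hP, hs⟩ := exists_proj_cover N
    constructor
    · rw [injective_iff_map_eq_zero]
      intro x hx
      obtain ⟨y, rfl⟩ := (hs.fs.dl_exact₃ w n x).1 (EV_of_projective (fs_projective hP) n _)
      have : ∀ j, ∃ z, pre i w n z = cmp K w n y j := fun j => (hs.dl_exact₁ w n _).1 (by
        rw [← cmp_dl]; exact congrFun hx j)
      choose z hz using this
      obtain ⟨Z, hZ⟩ := (ih P).2 z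
      refine (hs.fs.dl_exact₁ w n y).2 ⟨Z, (ih K).1 ?_⟩
      funext j
      rw [cmp_fsMap, hZ, hz]
    · intro y
      have : ∀ j, ∃ z, hs.dl w n z = y j := fun j => (hs.dl_exact₃ w n _).1
        (EV_of_projective hP n _)
      choose z hz using this
      obtain ⟨Z, hZ⟩ := (ih K).2 z
      refine ⟨hs.fs.dl w n Z, ?_⟩
      funext j
      rw [cmp_dl hs, hZ, hz]

lemma EV.fs {n : ℕ} (h : EV n N w) : EV n (fs N) w := by
  intro x
  apply (cmp_bijective N w n).1
  funext j
  rw [h (cmp N w n x j), map_zero]; rfl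

lemma Gp.fs {V W : ModuleCat.{u} R → Prop} (hV : ∀ v, V v → V (fs v)) (h : Gp V W N) :
    Gp V W (fs N) := by
  refine ⟨fun X => ∃ Y, Gp V W Y ∧ X = GC.fs Y, ⟨N, h, rfl⟩, ?_⟩
  rintro _ ⟨Y, hY, rfl⟩
  refine ⟨fun i w hw => (hY.EV i hw).fs, ?_⟩
  obtain ⟨v, X', f, g, hv, hfg, hX⟩ := hY.step
  exact ⟨_, _, _, _, hV v hv, hfg.fs, X', hX, rfl⟩

lemma Resolving.dim_fs {G : ModuleCat.{u} R → Prop} (hG : Resolving G) (hfs : ∀ N, G N → G (fs N))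
    {k : ℕ} (h : ResDimLE R G k N) : ResDimLE R G k (fs N) := by
  induction k generalizing N with
  | zero => exact hfs N h
  | succ k ih =>
    rcases dim_succ_cases h with hN | ⟨K, X, j, p, hs, hX, hK⟩
    · exact Or.inl (ih hN)
    · exact hG.dim_succ hs.fs (hfs X hX) (ih hK)

end GC
end

section
open CategoryTheory IsLocalRing Paper
namespace GC
variable {R : Type u} [CommRing R]
variable {A B D A' B' D' X Y K L N w : ModuleCat.{u} R}

/-- the map from cocycles to Ext -/
noncomputable def cyExt (P : ProjectiveResolution X) (Y : ModuleCat.{u} R) (n : ℕ) :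
    (P.complex.linearYonedaObj R Y).cycles n →ₗ[R] EX X Y n := 
  have key (z : (P.complex.linearYonedaObj R Y).cycles n) :
      P.complex.d (n + 1) n ≫ (show P.complex.X n ⟶ Y from
        (P.complex.linearYonedaObj R Y).iCycles n z) = 0 := by
    have := congrArg (fun f => f.hom z) ((P.complex.linearYonedaObj R Y).iCycles_d n (n + 1))
    exact this
  { toFun := fun z => P.extMk (show P.complex.X n ⟶ Y from
        (P.complex.linearYonedaObj R Y).iCycles n z) (n + 1) rfl (key z)
    map_add' := fun a b => by
      rw [P.add_extMk]
      congr 1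
      exact map_add ((P.complex.linearYonedaObj R Y).iCycles n).hom a b
    map_smul' := fun r a => by
      have : (show P.complex.X n ⟶ Y from (P.complex.linearYonedaObj R Y).iCycles n a) ≫ (r • 𝟙 Y)
         = (show P.complex.X n ⟶ Y from (P.complex.linearYonedaObj R Y).iCycles n (r • a)) := by
        rw [map_smul ((P.complex.linearYonedaObj R Y).iCycles n).hom r a, Linear.comp_smul, Category.comp_id]
        rfl
      have h2 := P.extMk_comp_mk₀ (show P.complex.X n ⟶ Y from
        (P.complex.linearYonedaObj R Y).iCycles n a) (n + 1) rfl (key a) (r • 𝟙 Y)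
      rw [Abelian.Ext.mk₀_smul, Abelian.Ext.comp_smul, Abelian.Ext.comp_mk₀_id] at h2
      rw [RingHom.id_apply, h2]
      congr 1
      exact this.symm
       }

lemma cyExt_apply (P : ProjectiveResolution X) (Y : ModuleCat.{u} R) (n : ℕ) 
    (z : (P.complex.linearYonedaObj R Y).cycles n) (h : P.complex.d (n + 1) n ≫ (show P.complex.X n ⟶ Y from
        (P.complex.linearYonedaObj R Y).iCycles n z) = 0) :
    cyExt P Y n z = P.extMk (show P.complex.X n ⟶ Y from
        (P.complex.linearYonedaObj R Y).iCycles n z) (n + 1) rfl h := rfl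

lemma extMk_zero_eq_zero (P : ProjectiveResolution X) (f : P.complex.X 0 ⟶ Y)
    (hf : P.complex.d 1 0 ≫ f = 0) (h : P.extMk f 1 rfl hf = 0) : f = 0 := by
  rw [← P.extEquivCohomologyClass.apply_eq_iff_eq, P.extEquivCohomologyClass_extMk,
    P.extEquivCohomologyClass_zero, CochainComplex.HomComplex.CohomologyClass.mk_eq_zero_iff,
    CochainComplex.HomComplex.Cocycle.toSingleMk_mem_coboundaries_iff _ _ _ _ _ 1 (by simp)] at h
  obtain ⟨g, hg⟩ := h
  have hz : Limits.IsZero (P.cochainComplex.X 1) := P.cochainComplex.isZero_of_isStrictlyLE 0 1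
  rw [hz.eq_of_src g 0, Limits.comp_zero] at hg
  rw [← cancel_epi (P.cochainComplexXIso (-(0:ℕ)) 0 rfl).hom, ← hg, Limits.comp_zero]

section cplx
variable (T : CochainComplex (ModuleCat.{u} R) ℕ) (n : ℕ)

lemma iCycles_inj : Function.Injective (T.iCycles n) :=
  (ModuleCat.mono_iff_injective _).1 inferInstance

lemma homologyπ_surj : Function.Surjective (T.homologyπ n) :=
  (ModuleCat.epi_iff_surjective _).1 inferInstance

lemma exists_cycle (x : T.X n) (h : T.d n (n + 1) x = 0) : ∃ z : T.cycles n, T.iCycles n z = x := by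
  have := T.cyclesIsKernel n (n + 1) (by simp)
  have hex := ShortComplex.exact_of_f_is_kernel (ShortComplex.mk (T.iCycles n) (T.d n (n + 1)) (by simp)) this
  exact (ShortComplex.moduleCat_exact_iff _).1 hex x h

lemma homologyπ_eq_zero (z : T.cycles n) : T.homologyπ n z = 0 ↔
    ∃ y : T.X ((ComplexShape.up ℕ).prev n), T.d _ n y = T.iCycles n z := by
  have := T.homologyIsCokernel _ n rfl
  have hex := ShortComplex.exact_of_g_is_cokernel (ShortComplex.mk (T.toCycles _ n) (T.homologyπ n) (by simp)) this
  have hc (y) : T.iCycles n (T.toCycles ((ComplexShape.up ℕ).prev n) n y) = T.d _ n y :=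
    congrArg (fun f => f.hom y) (T.toCycles_i ((ComplexShape.up ℕ).prev n) n)
  constructor
  · intro h
    obtain ⟨y, hy⟩ := (ShortComplex.moduleCat_exact_iff _).1 hex z h
    exact ⟨y, by rw [← hy]; exact (hc y).symm⟩
  · rintro ⟨y, hy⟩
    have : z = T.toCycles _ n y := iCycles_inj T n (by rw [hc, hy])
    rw [this]
    exact congrArg (fun f => f.hom y) (T.toCycles_comp_homologyπ _ n)
end cplx

lemma cyExt_surj (P : ProjectiveResolution X) (Y : ModuleCat.{u} R) (n : ℕ) :
    Function.Surjective (cyExt P Y n) := by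
  intro x
  obtain ⟨f, hf, rfl⟩ := P.extMk_surjective x (n + 1) rfl
  obtain ⟨z, hz⟩ := exists_cycle (P.complex.linearYonedaObj R Y) n f hf
  refine ⟨z, ?_⟩
  subst hz
  rfl

lemma cyExt_ker (P : ProjectiveResolution X) (Y : ModuleCat.{u} R) (n : ℕ) (z) :
    cyExt P Y n z = 0 ↔ (P.complex.linearYonedaObj R Y).homologyπ n z = 0 := by
  rw [homologyπ_eq_zero]
  have key : P.complex.d (n + 1) n ≫ (show P.complex.X n ⟶ Y from
        (P.complex.linearYonedaObj R Y).iCycles n z) = 0 := by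
    have := congrArg (fun f => f.hom z) ((P.complex.linearYonedaObj R Y).iCycles_d n (n + 1))
    exact this
  rw [cyExt_apply _ _ _ _ key]
  cases n with
  | zero =>
    have h0 : ∀ y, (P.complex.linearYonedaObj R Y).d ((ComplexShape.up ℕ).prev 0) 0 y = 0 := by
      intro y
      rw [(P.complex.linearYonedaObj R Y).shape]
      · rfl
      · simp
    simp only [h0]
    constructor
    · intro h
      exact ⟨0, (extMk_zero_eq_zero P _ key h).symm⟩
    · rintro ⟨-, h⟩
      have := P.extMk_zero (Y := Y) (n := 0) 1 rfl
      rw [← this]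
      congr 1
      exact h.symm
  | succ n =>
    rw [P.extMk_eq_zero_iff _ _ _ _ n rfl]
    have hp : (ComplexShape.up ℕ).prev (n + 1) = n := by simp
    rw [hp]
    rfl

/-- comparison -/
lemma exists_hExt (P : ProjectiveResolution X) (Y : ModuleCat.{u} R) (n : ℕ) :
    ∃ e : (P.complex.linearYonedaObj R Y).homology n ≃ₗ[R] EX X Y n,
      ∀ z, e ((P.complex.linearYonedaObj R Y).homologyπ n z) = cyExt P Y n z := by
  obtain ⟨e, he⟩ := exists_desc ((P.complex.linearYonedaObj R Y).homologyπ n).hom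
    (homologyπ_surj _ n) (cyExt P Y n) (fun z hz => (cyExt_ker P Y n z).2 hz)
  refine ⟨LinearEquiv.ofBijective e ⟨?_, ?_⟩, he⟩
  · rw [injective_iff_map_eq_zero]
    intro a ha
    obtain ⟨z, rfl⟩ := homologyπ_surj _ n a
    exact (cyExt_ker P Y n z).1 (by rw [← he]; exact ha)
  · intro x
    obtain ⟨z, rfl⟩ := cyExt_surj P Y n x
    exact ⟨_, he z⟩

/-- functoriality of `linearYonedaObj` -/
noncomputable def lyMap {P P' : ChainComplex (ModuleCat.{u} R) ℕ} (φ : P' ⟶ P) (Y : ModuleCat.{u} R) :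
    P.linearYonedaObj R Y ⟶ P'.linearYonedaObj R Y where
  f i := ModuleCat.ofHom
    { toFun := fun (g : P.X i ⟶ Y) => (φ.f i ≫ g : P'.X i ⟶ Y)
      map_add' := fun a b => Preadditive.comp_add _ _ _ _ a b
      map_smul' := fun r a => Linear.comp_smul _ _ _ _ r a }
  comm' i j _ := by
    ext (g : P.X i ⟶ Y)
    change P'.d j i ≫ (φ.f i ≫ g) = φ.f j ≫ (P.d j i ≫ g)
    simp

lemma unop_aux {𝒞 : Type*} [Category 𝒞] {a b c a' b' c' : 𝒞ᵒᵖ} (ho : b ⟶ c) (ho' : b' ⟶ c')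
    (i : a ⟶ b) (i' : a' ⟶ b') (ld : a' ⟶ a) (hm : b' ⟶ b) (hm' : c' ⟶ c)
    (h1 : ld ≫ i = i' ≫ hm) (h3 : hm ≫ ho = ho' ≫ hm') :
    (ho.unop ≫ i.unop) ≫ ld.unop = hm'.unop ≫ (ho'.unop ≫ i'.unop) := by
  apply Quiver.Hom.op_inj
  simp only [op_comp, Quiver.Hom.op_unop]
  rw [← Category.assoc, h1, Category.assoc, h3, Category.assoc]

lemma isoExt_nat {P : ProjectiveResolution X} {P' : ProjectiveResolution A} (g : A ⟶ X)
    (φ : ProjectiveResolution.Hom P' P g) (n : ℕ) (Y : ModuleCat.{u} R) :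
    (P.isoExt (R := R) n Y).inv ≫ ((Ext R (ModuleCat.{u} R) n).map g.op).app Y =
      HomologicalComplex.homologyMap (lyMap φ.hom Y) n ≫ (P'.isoExt n Y).inv := by
  have h1 := ProjectiveResolution.isoLeftDerivedObj_hom_naturality g P' P φ.hom (by simpa using φ.hom_f_zero_comp_π_f_zero)
    ((linearYoneda R (ModuleCat.{u} R)).obj Y).rightOp n
  have h3 := HomologicalComplex.homologyOp_hom_naturality (lyMap φ.hom Y) n
  exact unop_aux _ _ _ _ _ _ _ h1 h3

/-- the comparison isomorphism -/
noncomputable def cmpExt (X Y : ModuleCat.{u} R) (n : ℕ) :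
    ((Ext R (ModuleCat.{u} R) n).obj (Opposite.op X)).obj Y ≃ₗ[R] EX X Y n :=
  (((ProjectiveResolution.of X).isoExt (R := R) n Y).toLinearEquiv).trans
    (exists_hExt (ProjectiveResolution.of X) Y n).choose

lemma cmpExt_nat (g : A →ₗ[R] X) (n : ℕ) (Y : ModuleCat.{u} R)
    (x : ((Ext R (ModuleCat.{u} R) n).obj (Opposite.op X)).obj Y) :
    cmpExt A Y n (((Ext R (ModuleCat.{u} R) n).map (ModuleCat.ofHom g).op).app Y x) =
      pre g Y n (cmpExt X Y n x) := by
  set P := ProjectiveResolution.of X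
  set P' := ProjectiveResolution.of A
  let φ : ProjectiveResolution.Hom P' P (ModuleCat.ofHom g) :=
    { hom := ProjectiveResolution.lift (ModuleCat.ofHom g) P' P
      hom_f_zero_comp_π_f_zero := by
        have := ProjectiveResolution.lift_commutes (ModuleCat.ofHom g) P' P
        rw [← HomologicalComplex.comp_f, this]; rfl }
  have h1 := isoExt_nat (ModuleCat.ofHom g) φ n Y
  obtain ⟨y, rfl⟩ := ((P.isoExt (R := R) n Y).toLinearEquiv).symm.surjective x
  have h2 : ((Ext R (ModuleCat.{u} R) n).map (ModuleCat.ofHom g).op).app Y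
      (((P.isoExt (R := R) n Y).toLinearEquiv).symm y) = (P'.isoExt (R := R) n Y).toLinearEquiv.symm
        (HomologicalComplex.homologyMap (lyMap φ.hom Y) n y) :=
    congrArg (fun f => f.hom y) h1
  rw [h2]
  simp only [cmpExt, LinearEquiv.trans_apply]
  rw [LinearEquiv.apply_symm_apply, LinearEquiv.apply_symm_apply]
  obtain ⟨z, rfl⟩ := homologyπ_surj _ n y
  have h3 : HomologicalComplex.homologyMap (lyMap φ.hom Y) n ((P.complex.linearYonedaObj R Y).homologyπ n z)
      = (P'.complex.linearYonedaObj R Y).homologyπ n (HomologicalComplex.cyclesMap (lyMap φ.hom Y) n z) :=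
    congrArg (fun f => f.hom z) (HomologicalComplex.homologyπ_naturality (lyMap φ.hom Y) n)
  rw [h3, (exists_hExt P Y n).choose_spec, (exists_hExt P' Y n).choose_spec]
  have h4 : (P'.complex.linearYonedaObj R Y).iCycles n (HomologicalComplex.cyclesMap (lyMap φ.hom Y) n z) =
    (lyMap φ.hom Y).f n ((P.complex.linearYonedaObj R Y).iCycles n z) :=
    congrArg (fun f => f.hom z) (HomologicalComplex.cyclesMap_i (lyMap φ.hom Y) n)
  have key : P.complex.d (n + 1) n ≫ (show P.complex.X n ⟶ Y from
        (P.complex.linearYonedaObj R Y).iCycles n z) = 0 := by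
    have := congrArg (fun f => f.hom z) ((P.complex.linearYonedaObj R Y).iCycles_d n (n + 1))
    exact this
  rw [cyExt_apply P _ _ _ key, pre_apply]
  refine Eq.trans ?_ (P.mk₀_comp_extMk (show P.complex.X n ⟶ Y from
        (P.complex.linearYonedaObj R Y).iCycles n z) (n + 1) rfl key φ).symm
  have key' : P'.complex.d (n + 1) n ≫ (show P'.complex.X n ⟶ Y from
        (P'.complex.linearYonedaObj R Y).iCycles n (HomologicalComplex.cyclesMap (lyMap φ.hom Y) n z)) = 0 := by
    have := congrArg (fun f => f.hom (HomologicalComplex.cyclesMap (lyMap φ.hom Y) n z))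
      ((P'.complex.linearYonedaObj R Y).iCycles_d n (n + 1))
    exact this
  rw [cyExt_apply P' _ _ _ key']
  congr 1

lemma EV_of_ext {C D : Type u} [AddCommGroup C] [Module R C] [AddCommGroup D] [Module R D] {i : ℕ}
    (h : Subsingleton (ext R i C D)) : EV i (ModuleCat.of R C) (ModuleCat.of R D) := by
  intro x
  obtain ⟨y, rfl⟩ := (cmpExt _ _ i).surjective x
  rw [show y = 0 from h.elim _ _, map_zero]

/-! ### local cohomology as a colimit -/

lemma lcoh_colim (J : Ideal R) (i : ℕ) (M : Type u) [AddCommGroup M] [Module R M] :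
    ∃ (ι : ∀ t : ℕ, EX (ModuleCat.of R (R ⧸ J ^ t)) (ModuleCat.of R M) i →ₗ[R] lcoh R J i M),
      (∀ (s t : ℕ) (h : s ≤ t) (x), ι t (pre (Submodule.mapQ (J ^ t) (J ^ s) LinearMap.id
        (Ideal.pow_le_pow_right h)) _ i x) = ι s x) ∧
      (∀ (T : Type u) [AddCommGroup T] [Module R T]
        (κ : ∀ t : ℕ, EX (ModuleCat.of R (R ⧸ J ^ t)) (ModuleCat.of R M) i →ₗ[R] T),
        (∀ (s t : ℕ) (h : s ≤ t) (x), κ t (pre (Submodule.mapQ (J ^ t) (J ^ s) LinearMap.id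
        (Ideal.pow_le_pow_right h)) _ i x) = κ s x) →
        ∃! l : lcoh R J i M →ₗ[R] T, ∀ t x, l (ι t x) = κ t x) := by
  let F := localCohomology.diagram (localCohomology.idealPowersDiagram J) i
  have : Limits.HasColimit F := localCohomology.hasColimitDiagram.{u, 0} _ i
  let ev := (evaluation (ModuleCat.{u} R) (ModuleCat.{u} R)).obj (ModuleCat.of R M)
  have hc : Limits.IsColimit (ev.mapCocone (Limits.colimit.cocone F)) :=
    Limits.isColimitOfPreserves ev (Limits.colimit.isColimit F)
  let e (t : ℕ) := cmpExt (ModuleCat.of R (R ⧸ J ^ t)) (ModuleCat.of R M) i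
  let o (t : ℕ) : (ℕᵒᵖ)ᵒᵖ := Opposite.op (Opposite.op t)
  let ho {s t : ℕ} (h : s ≤ t) : o s ⟶ o t := (homOfLE h).op.op
  let q {s t : ℕ} (h : s ≤ t) : (ModuleCat.of R (R ⧸ J ^ t) : ModuleCat.{u} R) →ₗ[R]
    (ModuleCat.of R (R ⧸ J ^ s) : ModuleCat.{u} R) := Submodule.mapQ (J ^ t) (J ^ s) LinearMap.id
        (Ideal.pow_le_pow_right h)
  have htr {s t : ℕ} (h : s ≤ t) (x) : e t ((F ⋙ ev).map (ho h) x) = pre (q h) _ i (e s x) :=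
    cmpExt_nat (q h) i (ModuleCat.of R M) x
  refine ⟨fun t => ((ev.mapCocone (Limits.colimit.cocone F)).ι.app (o t)).hom ∘ₗ (e t).symm.toLinearMap,
    fun s t h x => ?_, fun T _ _ κ hκ => ?_⟩
  · obtain ⟨y, rfl⟩ := (e s).surjective x
    have h2 : (e t).symm (pre (q h) _ i (e s y)) = (F ⋙ ev).map (ho h) y :=
      (congrArg (e t).symm (htr h y)).symm.trans ((e t).symm_apply_apply _)
    have h3 := congrArg (fun f => f.hom y) ((ev.mapCocone (Limits.colimit.cocone F)).w (ho h))
    exact Eq.trans (congrArg (((ev.mapCocone (Limits.colimit.cocone F)).ι.app (o t)).hom) h2)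
      (Eq.trans h3 (congrArg (((ev.mapCocone (Limits.colimit.cocone F)).ι.app (o s)).hom)
        ((e s).symm_apply_apply y).symm))
  · let c : Limits.Cocone (F ⋙ ev) :=
      { pt := ModuleCat.of R T
        ι := { app := fun j => ModuleCat.ofHom (κ j.unop.unop ∘ₗ (e j.unop.unop).toLinearMap)
               naturality := fun j k f => by
                ext y
                have h1 : j.unop.unop ≤ k.unop.unop := leOfHom f.unop.unop
                have h2 := htr h1 y
                have h3 := hκ _ _ h1 (e _ y)
                refine Eq.trans ?_ h3
                exact congrArg _ h2 } }
    refine ⟨(hc.desc c).hom, fun t x => ?_, fun l hl => ?_⟩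
    · have := congrArg (fun f => f.hom ((e t).symm x)) (hc.fac c (o t))
      refine Eq.trans this ?_
      change κ t (e t ((e t).symm x)) = _
      rw [LinearEquiv.apply_symm_apply]
    · have : ModuleCat.ofHom l = hc.desc c := by
        refine hc.uniq c (ModuleCat.ofHom l) (fun j => ?_)
        ext y
        have := hl j.unop.unop (e _ y)
        exact Eq.trans (congrArg (fun z => l (((ev.mapCocone (Limits.colimit.cocone F)).ι.app j).hom z))
          ((e _).symm_apply_apply y).symm) this
      rw [← this]; rfl

lemma lcoh_colim' (J : Ideal R) (i : ℕ) (M : Type u) [AddCommGroup M] [Module R M] :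
    ∃ (ι : ∀ t : ℕ, EX (ModuleCat.of R (R ⧸ J ^ t)) (ModuleCat.of R M) i →ₗ[R] lcoh R J i M),
      (∀ y, ∃ t x, ι t x = y) ∧
      (∀ (T : Type u) [AddCommGroup T] [Module R T]
        (κ : ∀ t : ℕ, EX (ModuleCat.of R (R ⧸ J ^ t)) (ModuleCat.of R M) i →ₗ[R] T),
        (∀ (s t : ℕ) (h : s ≤ t) (x), κ t (pre (Submodule.mapQ (J ^ t) (J ^ s) LinearMap.id
        (Ideal.pow_le_pow_right h)) _ i x) = κ s x) →
        ∃ l : lcoh R J i M →ₗ[R] T, ∀ t x, l (ι t x) = κ t x) := by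
  obtain ⟨ι, h1, h2⟩ := lcoh_colim J i M
  refine ⟨ι, ?_, fun T _ _ κ hκ => (h2 T κ hκ).exists⟩
  have hm : Monotone (fun t => LinearMap.range (ι t)) := by
    rintro s t h _ ⟨x, rfl⟩
    exact ⟨_, h1 s t h x⟩
  set U := ⨆ t, LinearMap.range (ι t) with hU
  have hle : ∀ t, LinearMap.range (ι t) ≤ U := fun t => le_iSup (fun t => LinearMap.range (ι t)) t
  have hz : U.mkQ = 0 := by
    refine (h2 (lcoh R J i M ⧸ U) (fun t => 0) (fun _ _ _ _ => rfl)).unique (fun t x => ?_) (fun t x => rfl)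
    simp only [LinearMap.zero_apply, Submodule.mkQ_apply, Submodule.Quotient.mk_eq_zero]
    exact hle t ⟨x, rfl⟩
  intro y
  have hy : y ∈ U := by
    rw [← Submodule.ker_mkQ U, hz]; simp
  rw [hU, Submodule.mem_iSup_of_directed _ hm.directed_le] at hy
  obtain ⟨t, x, hx⟩ := hy
  exact ⟨t, x, hx⟩

/-- local cohomology is torsion -/
lemma lcoh_torsion (J : Ideal R) (i : ℕ) (M : Type u) [AddCommGroup M] [Module R M]
    (x : lcoh R J i M) (r : R) (hr : r ∈ J) : ∃ n : ℕ, r ^ n • x = 0 := by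
  obtain ⟨ι, h1, -⟩ := lcoh_colim' J i M
  obtain ⟨t, y, rfl⟩ := h1 x
  refine ⟨t, ?_⟩
  have h0 : (r ^ t • LinearMap.id : (ModuleCat.of R (R ⧸ J ^ t) : ModuleCat.{u} R) →ₗ[R] (ModuleCat.of R (R ⧸ J ^ t) : ModuleCat.{u} R)) = 0 := by
    refine LinearMap.ext fun z => ?_
    obtain ⟨z, rfl⟩ := Submodule.Quotient.mk_surjective _ z
    change r ^ t • (Submodule.Quotient.mk z : R ⧸ J ^ t) = 0
    rw [← Submodule.Quotient.mk_smul, Submodule.Quotient.mk_eq_zero]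
    exact Ideal.mul_mem_right _ _ (Ideal.pow_mem_pow hr t)
  have h2 : r ^ t • y = 0 := by
    have := pre_smul (w := ModuleCat.of R M) (r ^ t) (LinearMap.id : (ModuleCat.of R (R ⧸ J ^ t) : ModuleCat.{u} R) →ₗ[R] (ModuleCat.of R (R ⧸ J ^ t) : ModuleCat.{u} R)) i y
    rw [h0, pre_zero, pre_id] at this
    exact this.symm
  rw [← map_smul, h2, map_zero]

lemma lcoh_equiv (J : Ideal R) (i : ℕ) (M : Type u) [AddCommGroup M] [Module R M]
    (T : Type u) [AddCommGroup T] [Module R T]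
    (κ : ∀ t : ℕ, EX (ModuleCat.of R (R ⧸ J ^ t)) (ModuleCat.of R M) i →ₗ[R] T)
    (hκ : ∀ (s t : ℕ) (h : s ≤ t) (x), κ t (pre (Submodule.mapQ (J ^ t) (J ^ s) LinearMap.id
        (Ideal.pow_le_pow_right h)) _ i x) = κ s x)
    (hi : ∀ t, Function.Injective (κ t)) (hs : ∀ y, ∃ t x, κ t x = y) :
    Nonempty (lcoh R J i M ≃ₗ[R] T) := by
  obtain ⟨ι, h1, h2⟩ := lcoh_colim' J i M
  obtain ⟨l, hl⟩ := h2 T κ hκ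
  refine ⟨LinearEquiv.ofBijective l ⟨?_, fun y => ?_⟩⟩
  · rw [injective_iff_map_eq_zero]
    intro y hy
    obtain ⟨t, x, rfl⟩ := h1 y
    rw [hl] at hy
    rw [show x = 0 from hi t (hy.trans (map_zero _).symm), map_zero]
  · obtain ⟨t, x, rfl⟩ := hs y
    exact ⟨ι t x, hl t x⟩

end GC
end

section
open CategoryTheory IsLocalRing Paper


namespace GC

variable {R : Type u} [CommRing R]
variable {A B D A' B' D' X Y K L N w : ModuleCat.{u} R}

/-- abstract complete resolutions -/
def Ccx (U V W : ModuleCat.{u} R → Prop) (N : ModuleCat.{u} R) : Prop :=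
  ∃ (X : ℤ → ModuleCat.{u} R) (d : ∀ i : ℤ, X i →ₗ[R] X (i + 1)),
    (∀ i : ℤ, i ≤ 0 → U (X i)) ∧
    (∀ i : ℤ, 0 < i → V (X i)) ∧
    (∀ i, Function.Exact (d i) (d (i + 1))) ∧
    (∀ (Q : ModuleCat.{u} R), W Q →
      ∀ (i : ℤ) (g : X (i + 1) →ₗ[R] Q), g.comp (d i) = 0 →
        ∃ h : X (i + 1 + 1) →ₗ[R] Q, h.comp (d (i + 1)) = g) ∧
    ∃ π : X 0 →ₗ[R] N, Function.Surjective π ∧ Function.Exact (d (-1)) π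

lemma ses_range {X Y T : ModuleCat.{u} R} {d : X →ₗ[R] Y} {d' : Y →ₗ[R] T} (h : Function.Exact d d') :
    SES (A := ModuleCat.of R (LinearMap.range d)) (D := ModuleCat.of R (LinearMap.range d'))
      (LinearMap.range d).subtype d'.rangeRestrict where
  inj := Subtype.val_injective
  exact := by
    rw [LinearMap.exact_iff, LinearMap.ker_rangeRestrict, Submodule.range_subtype]
    exact LinearMap.exact_iff.1 h
  surj := d'.surjective_rangeRestrict

lemma Gp.of_ccx {U V W : ModuleCat.{u} R → Prop}
    (hU : ∀ X w i, U X → W w → GC.EV (i + 1) X w) (hV : ∀ X w i, V X → W w → GC.EV (i + 1) X w)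
    (h : Ccx U V W N) : Gp V W N := by
  obtain ⟨X, d, h1, h2, h3, h4, π, h5, h6⟩ := h
  have hX : ∀ i j w, W w → GC.EV (j + 1) (X i) w := fun i j w hw => by
    rcases le_or_gt i 0 with h | h
    · exact hU _ _ _ (h1 i h) hw
    · exact hV _ _ _ (h2 i h) hw
  let Z (i : ℤ) : ModuleCat.{u} R := ModuleCat.of R (LinearMap.range (d i))
  have hZ (i : ℤ) : SES (A := Z i) (D := Z (i + 1)) (LinearMap.range (d i)).subtype
    (d (i + 1)).rangeRestrict := ses_range (h3 i)
  have hE : ∀ (j : ℕ) (i : ℤ) w, W w → GC.EV (j + 1) (Z i) w := by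
    intro j
    induction j with
    | zero =>
      intro i w hw
      obtain ⟨i, rfl⟩ : ∃ i', i = i' + 1 + 1 := ⟨i - 1 - 1, by ring⟩
      refine (hZ (i + 1)).EV_one_of_extend (hX _ 0 w hw) fun k => ?_
      obtain ⟨h, hh⟩ := h4 w hw i (k ∘ₗ (d (i + 1)).rangeRestrict) (by
        have : (d (i + 1)).rangeRestrict ∘ₗ d i = 0 := by
          ext x
          exact (h3 i).apply_apply_eq_zero x
        rw [LinearMap.comp_assoc, this, LinearMap.comp_zero])
      refine ⟨h, LinearMap.ext fun x => ?_⟩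
      obtain ⟨y, rfl⟩ := (d (i + 1)).surjective_rangeRestrict x
      exact LinearMap.congr_fun hh y
    | succ j ih =>
      intro i w hw
      obtain ⟨i, rfl⟩ : ∃ i', i = i' + 1 := ⟨i - 1, by ring⟩
      exact (hZ i).EV_right (ih i w hw) (hX _ _ w hw)
  have hk : LinearMap.ker π = LinearMap.ker (d 0) := by
    have e1 := LinearMap.exact_iff.1 h6
    have e2 : LinearMap.ker (d 0) = LinearMap.range (d (-1)) := LinearMap.exact_iff.1 (h3 (-1))
    exact e1.trans e2.symm
  let e : N ≃ₗ[R] LinearMap.range (d 0) := ((π.quotKerEquivOfSurjective h5).symm.trans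
    (Submodule.quotEquivOfEq (LinearMap.ker π) (LinearMap.ker (d 0)) hk)).trans
      (d 0).quotKerEquivRange
  refine Gp.of_iso (A := Z 0) ?_ e.symm
  refine ⟨fun X => ∃ i : ℤ, 0 ≤ i ∧ X = Z i, ⟨0, le_rfl, rfl⟩, ?_⟩
  rintro _ ⟨i, hi, rfl⟩
  exact ⟨fun j w hw => hE j i w hw, X (i + 1), Z (i + 1), _, _, h2 _ (by omega), hZ i, i + 1,
    by omega, rfl⟩

lemma exists_chain {α : Type*} (r : ℤ → α → α → Prop) (a : α)
    (h1 : ∀ i : ℤ, 0 < i → ∀ a, ∃ b, r i a b) (h2 : ∀ i : ℤ, i ≤ 0 → ∀ b, ∃ a, r i a b) :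
    ∃ Z : ℤ → α, Z 1 = a ∧ ∀ i, r i (Z i) (Z (i + 1)) := by
  choose f hf using fun (n : ℕ) => h1 (n + 1) (by omega)
  choose g hg using fun (n : ℕ) => h2 (-n) (by omega)
  let rt : ℕ → α := fun n => Nat.rec a (fun n x => f n x) n
  let lf : ℕ → α := fun n => Nat.rec a (fun n x => g n x) n
  refine ⟨fun i => if 1 ≤ i then rt (i - 1).toNat else lf (1 - i).toNat, by simp [rt], fun i => ?_⟩
  by_cases hi : 1 ≤ i
  · obtain ⟨n, rfl⟩ : ∃ n : ℕ, i = n + 1 := ⟨(i - 1).toNat, by omega⟩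
    simp only [hi, if_true, show (1 : ℤ) ≤ (n : ℤ) + 1 + 1 by omega]
    have e1 : ((n : ℤ) + 1 - 1).toNat = n := by omega
    have e2 : ((n : ℤ) + 1 + 1 - 1).toNat = n + 1 := by omega
    rw [e1, e2]
    exact hf n (rt n)
  · obtain ⟨n, rfl⟩ : ∃ n : ℕ, i = -n := ⟨(-i).toNat, by omega⟩
    simp only [hi, if_false]
    have e1 : (1 - (-(n : ℤ))).toNat = n + 1 := by omega
    rw [e1]
    have e2 : (if 1 ≤ -(n : ℤ) + 1 then rt (-(n : ℤ) + 1 - 1).toNat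
        else lf (1 - (-(n : ℤ) + 1)).toNat) = lf n := by
      split_ifs with h
      · obtain rfl : n = 0 := by omega
        rfl
      · congr 1; omega
    rw [e2]
    exact hg n (lf n)

lemma Gp.to_ccx {U V W : ModuleCat.{u} R → Prop} (h : Gp V W N)
    (hl : ∀ N, Gp V W N → ∃ (K P : ModuleCat.{u} R) (i : K →ₗ[R] P) (p : P →ₗ[R] N),
      U P ∧ SES i p ∧ Gp V W K) : Ccx U V W N := by
  obtain ⟨Z, hZ1, hZ⟩ := exists_chain (α := {N : ModuleCat.{u} R // Gp V W N})
    (fun i a b => ∃ (X : ModuleCat.{u} R) (f : a.1 →ₗ[R] X) (p : X →ₗ[R] b.1), SES f p ∧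
      (i ≤ 0 → U X) ∧ (0 < i → V X)) ⟨N, h⟩ (by
      rintro i hi ⟨a, ha⟩
      obtain ⟨v, X', f, g, hv, hfg, hX⟩ := ha.step
      exact ⟨⟨X', hX⟩, v, f, g, hfg, fun h => by omega, fun _ => hv⟩) (by
      rintro i hi ⟨a, ha⟩
      obtain ⟨K, P, f, g, hv, hfg, hX⟩ := hl a ha
      exact ⟨⟨K, hX⟩, P, f, g, hfg, fun _ => hv, fun h => by omega⟩)
  choose X f p hs hU hV using hZ
  have e : Nonempty ((Z (0 + 1)).1 ≃ₗ[R] N) := by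
    rw [zero_add, hZ1]; exact ⟨LinearEquiv.refl _ _⟩
  obtain ⟨e⟩ := e
  have hex : ∀ i, Function.Exact (f (i + 1) ∘ₗ p i) (p (i + 1)) := fun i x => by
    rw [(hs (i + 1)).exact x]
    constructor
    · rintro ⟨y, rfl⟩
      obtain ⟨z, rfl⟩ := (hs i).surj y
      exact ⟨z, rfl⟩
    · rintro ⟨y, rfl⟩
      exact ⟨p i y, rfl⟩
  refine ⟨X, fun i => f (i + 1) ∘ₗ p i, hU, hV, fun i => ?_, fun Q hQ i g hg => ?_,
    e.toLinearMap ∘ₗ p 0, e.surjective.comp (hs 0).surj, ?_⟩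
  · intro x
    rw [← hex i x]
    constructor
    · intro h
      exact (hs (i + 1 + 1)).inj (h.trans (map_zero _).symm)
    · intro h
      simp [h]
  · obtain ⟨g', hg'⟩ := exists_desc (p (i + 1)) (hs (i + 1)).surj g (fun x hx => by
      obtain ⟨y, rfl⟩ := (hex i x).1 hx
      exact LinearMap.congr_fun hg y)
    obtain ⟨l, hl⟩ := (hs (i + 1 + 1)).extend ((Z (i + 1 + 1 + 1)).2.EV 0 hQ) g'
    refine ⟨l, LinearMap.ext fun x => ?_⟩
    rw [← hg']
    exact LinearMap.congr_fun hl _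
  · intro x
    have := hex (-1) x
    refine Iff.trans ?_ this
    simp only [LinearMap.comp_apply, LinearEquiv.coe_coe, EmbeddingLike.map_eq_zero_iff]
    rfl

end GC
end

section
open CategoryTheory IsLocalRing Paper TensorProduct


namespace GC

variable {R : Type u} [CommRing R]

section te

variable (Ω B I : Type u) [AddCommGroup Ω] [Module R Ω] [AddCommGroup B] [Module R B]
  [AddCommGroup I] [Module R I]

/-- tensor evaluation -/
noncomputable def te : Ω ⊗[R] (B →ₗ[R] I) →ₗ[R] ((Ω →ₗ[R] B) →ₗ[R] I) :=
  TensorProduct.lift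
    (LinearMap.mk₂ R (fun ω f => f ∘ₗ LinearMap.applyₗ ω)
      (fun a b f => by ext; simp) (fun c a f => by ext; simp)
      (fun a f g => by ext; simp) (fun c a f => by ext; simp))

variable {Ω B I}

@[simp] lemma te_tmul (ω : Ω) (f : B →ₗ[R] I) (h : Ω →ₗ[R] B) : te Ω B I (ω ⊗ₜ f) h = f (h ω) := rfl

lemma te_nat {P : Type u} [AddCommGroup P] [Module R P] (g : Ω →ₗ[R] P) (x : Ω ⊗[R] (B →ₗ[R] I))
    (h : P →ₗ[R] B) : te P B I (g.rTensor _ x) h = te Ω B I x (h ∘ₗ g) := by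
  induction x with
  | zero => simp
  | tmul ω f => simp
  | add x y hx hy => simp [hx, hy]

lemma te_free_bij (n : ℕ) : Function.Bijective (te (R := R) (Fin n → R) B I) := by
  let b := Pi.basisFun R (Fin n)
  constructor
  · rw [injective_iff_map_eq_zero]
    intro x hx
    obtain ⟨c, rfl⟩ := TensorProduct.eq_repr_basis_left b x
    have hc : c = 0 := by
      ext j y
      have := LinearMap.congr_fun hx (LinearMap.toSpanSingleton R B y ∘ₗ LinearMap.proj j)
      simp only [Finsupp.sum, map_sum, LinearMap.sum_apply, te_tmul, LinearMap.comp_apply,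
        LinearMap.proj_apply, LinearMap.zero_apply, b, Pi.basisFun_apply, LinearMap.toSpanSingleton_apply] at this
      rw [Finset.sum_eq_single j] at this
      · simpa using this
      · intro i _ hij
        simp [Ne.symm hij]
      · intro h
        simp [Finsupp.notMem_support_iff.1 h]
    simp [hc]
  · intro Φ
    refine ⟨∑ i, b i ⊗ₜ (Φ ∘ₗ LinearMap.lcomp R B (LinearMap.proj (R := R) (φ := fun _ : Fin n => R) i)
      ∘ₗ (LinearMap.ringLmapEquivSelf R R B).symm.toLinearMap), ?_⟩
    ext h
    simp only [map_sum, LinearMap.sum_apply, te_tmul, LinearMap.comp_apply]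
    rw [← map_sum]
    congr 1
    refine (Pi.basisFun R (Fin n)).ext fun j => ?_
    simp only [LinearMap.sum_apply]
    rw [Finset.sum_eq_single j]
    · simp [b]
    · intro i _ hij
      simp [hij]
    · simp

lemma te_surj [Module.Finite R Ω] (hI : Module.Injective R I) :
    Function.Surjective (te (R := R) Ω B I) := by
  obtain ⟨n, p, hp⟩ := Module.Finite.exists_fin' R Ω
  intro Φ
  obtain ⟨Ψ, hΨ⟩ := hI.out (LinearMap.lcomp R B p) (fun f g hfg => by
    ext x; obtain ⟨y, rfl⟩ := hp x; exact LinearMap.congr_fun hfg y) Φ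
  obtain ⟨x, rfl⟩ := (te_free_bij n).2 Ψ
  refine ⟨p.rTensor _ x, ?_⟩
  ext h
  rw [te_nat, ← hΨ]; rfl

lemma te_bij [IsNoetherianRing R] [Module.Finite R Ω] (hI : Module.Injective R I) :
    Function.Bijective (te (R := R) Ω B I) := by
  refine ⟨?_, te_surj hI⟩
  obtain ⟨n, p, hp⟩ := Module.Finite.exists_fin' R Ω
  rw [injective_iff_map_eq_zero]
  intro x hx
  obtain ⟨y, rfl⟩ := LinearMap.rTensor_surjective (B →ₗ[R] I) hp x
  let K := LinearMap.ker p
  let ρ := LinearMap.lcomp R B K.subtype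
  obtain ⟨φ0, hφ0⟩ := exists_desc (ρ.rangeRestrict) ρ.surjective_rangeRestrict (te _ B I y) (fun f hf => by
    have hf' : ρ f = 0 := congrArg Subtype.val hf
    obtain ⟨g, hg⟩ := exists_desc p hp f (fun z hz => LinearMap.congr_fun hf' ⟨z, hz⟩)
    have : f = g ∘ₗ p := LinearMap.ext fun z => (hg z).symm
    rw [this, ← te_nat, hx]; rfl)
  obtain ⟨φ, hφ⟩ := hI.out (LinearMap.range ρ).subtype Subtype.val_injective φ0
  obtain ⟨z, rfl⟩ := te_surj (Ω := K) hI φ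
  have : y = K.subtype.rTensor _ z := by
    apply (te_free_bij n).1
    ext1 f
    rw [te_nat, ← hφ0 f, ← hφ]; rfl
  rw [this, ← LinearMap.rTensor_comp_apply]
  have h0 : p ∘ₗ K.subtype = 0 := by ext z; exact z.2
  rw [h0, LinearMap.rTensor_zero, LinearMap.zero_apply]

lemma te_inj_of_surj [IsNoetherianRing R] [Module.Finite R Ω] {P : Type u} [AddCommGroup P] [Module R P]
    (hI : Module.Injective R I) (f : Ω →ₗ[R] P) (hf : ∀ k : Ω →ₗ[R] B, ∃ l : P →ₗ[R] B, l ∘ₗ f = k) :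
    Function.Injective (f.rTensor (B →ₗ[R] I)) := by
  rw [injective_iff_map_eq_zero]
  intro x hx
  apply (te_bij (R := R) hI).1
  ext k
  obtain ⟨l, rfl⟩ := hf k
  rw [← te_nat, hx]; simp

end te

/-! ### character modules -/

section char

variable (R) in
/-- the injective cogenerator -/
abbrev EE : Type u := CharacterModule R

lemma EE_injective : Module.Injective R (EE R) := Module.Flat.iff_characterModule_injective.1 inferInstance

noncomputable def charEquiv (X : Type u) [AddCommGroup X] [Module R X] :
    (X →ₗ[R] EE R) ≃ₗ[R] CharacterModule X :=
  CharacterModule.homEquiv.trans (CharacterModule.congr (TensorProduct.rid R X))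

variable (X : Type u) [AddCommGroup X] [Module R X]

noncomputable def evc : X →ₗ[R] CharacterModule (CharacterModule X) where
  toFun x := (⟨⟨fun c => c x, rfl⟩, fun _ _ => rfl⟩ : CharacterModule X →+ AddCircle (1 : ℚ))
  map_add' x y := CharacterModule.ext _ fun c => map_add c x y
  map_smul' r x := CharacterModule.ext _ fun c => rfl

variable {X}

lemma evc_apply (x : X) (c : CharacterModule X) : evc (R := R) X x c = c x := rfl

lemma evc_extend {F J : Type u} [AddCommGroup F] [Module R F] [AddCommGroup J] [Module R J]
    (g : F →ₗ[R] CharacterModule J) : ∃ l : CharacterModule (CharacterModule F) →ₗ[R] CharacterModule J,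
      ∀ x, l (evc (R := R) F x) = g x :=
  ⟨CharacterModule.dual (evc (R := R) J) ∘ₗ CharacterModule.dual (CharacterModule.dual g), fun _ => rfl⟩

lemma evc_rTensor_inj (F J : Type u) [AddCommGroup F] [Module R F] [AddCommGroup J] [Module R J] :
    Function.Injective ((evc (R := R) F).rTensor J) := by
  rw [rTensor_injective_iff_lcomp_surjective]
  intro g
  obtain ⟨l, hl⟩ := evc_extend g
  exact ⟨l, LinearMap.ext hl⟩

lemma evc_inj (F : Type u) [AddCommGroup F] [Module R F] : Function.Injective (evc (R := R) F) := by
  rw [injective_iff_map_eq_zero]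
  intro x hx
  refine CharacterModule.eq_zero_of_character_apply fun c => ?_
  rw [← evc_apply (R := R), hx]; rfl

lemma flat_char [IsNoetherianRing R] (I : Type u) [AddCommGroup I] [Module R I] (hI : Module.Injective R I) :
    Module.Flat R (CharacterModule I) := by
  have : Module.Flat R (I →ₗ[R] EE R) := by
    rw [Module.Flat.iff_rTensor_injective']
    intro a
    refine te_inj_of_surj EE_injective _ fun k => ?_
    obtain ⟨l, hl⟩ := hI.out a.subtype Subtype.val_injective k
    exact ⟨l, LinearMap.ext hl⟩
  exact Module.Flat.of_linearEquiv (charEquiv I).symm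

lemma flat_coker_evc [IsNoetherianRing R] (F : Type u) [AddCommGroup F] [Module R F] [Module.Flat R F] :
    Module.Flat R (CharacterModule (CharacterModule F) ⧸ LinearMap.range (evc (R := R) F)) := by
  have hI : Module.Injective R (CharacterModule F) := Module.Flat.iff_characterModule_injective.1 inferInstance
  have hf := flat_char _ hI
  have hI3 := Module.Flat.iff_characterModule_injective.1 hf
  rw [Module.Flat.iff_characterModule_injective]
  set T := LinearMap.range (evc (R := R) F) with hT
  let π := CharacterModule.dual T.mkQ
  have hπ : Function.Injective π := CharacterModule.dual_injective_of_surjective _ T.mkQ_surjective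
  let r0 : CharacterModule (CharacterModule (CharacterModule F)) →ₗ[R]
     CharacterModule (CharacterModule (CharacterModule F)) :=
    LinearMap.id - evc (R := R) (CharacterModule F) ∘ₗ CharacterModule.dual (evc (R := R) F)
  have hr0 : ∀ c, r0 c ∈ LinearMap.range π := by
    intro c
    refine ⟨(QuotientAddGroup.lift T.toAddSubgroup (r0 c : _ →+ AddCircle (1 : ℚ)) ?_ : _ →+ AddCircle (1 : ℚ)), ?_⟩
    · rintro _ ⟨x, rfl⟩
      change c _ - c _ = 0
      simp
    · ext x; rfl
  let e := LinearEquiv.ofInjective π hπ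
  let r := e.symm.toLinearMap ∘ₗ r0.codRestrict _ hr0
  have hr : ∀ c, r (π c) = c := by
    intro c
    apply e.injective
    simp only [r, LinearMap.comp_apply, LinearEquiv.coe_coe, LinearEquiv.apply_symm_apply]
    apply Subtype.ext
    change π c - evc (R := R) (CharacterModule F) (CharacterModule.dual (evc (R := R) F) (π c)) = π c
    have : CharacterModule.dual (evc (R := R) F) (π c) = 0 := by
      ext x
      change c (T.mkQ (evc (R := R) F x)) = 0
      rw [show T.mkQ (evc (R := R) F x) = 0 from (Submodule.Quotient.mk_eq_zero _).2 ⟨x, rfl⟩, map_zero]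
    rw [this, map_zero, sub_zero]
  refine ⟨fun X Y _ _ _ _ f hf g => ?_⟩
  obtain ⟨h, hh⟩ := hI3.out f hf (π ∘ₗ g)
  refine ⟨r ∘ₗ h, fun x => ?_⟩
  simp only [LinearMap.comp_apply, hh, hr]

end char

end GC
end

section
open CategoryTheory IsLocalRing Paper TensorProduct


namespace GC

variable {R : Type u} [CommRing R]
variable {A B D A' B' D' X Y K L N w Ω P : ModuleCat.{u} R}

lemma SES.rTensor {f : A →ₗ[R] B} {g : B →ₗ[R] D} (h : SES f g) (F : ModuleCat.{u} R) [Module.Flat R F] :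
    SES (A := ModuleCat.of R (A ⊗[R] F)) (B := ModuleCat.of R (B ⊗[R] F)) (D := ModuleCat.of R (D ⊗[R] F))
      (f.rTensor F) (g.rTensor F) where
  inj := Module.Flat.rTensor_preserves_injective_linearMap f h.inj
  exact := rTensor_exact F h.exact h.surj
  surj := LinearMap.rTensor_surjective F h.surj

lemma exists_fin_cover [IsNoetherianRing R] (X : ModuleCat.{u} R) [Module.Finite R X] :
    ∃ (n : ℕ) (K : ModuleCat.{u} R) (i : K →ₗ[R] (ModuleCat.of R (Fin n → R) : ModuleCat.{u} R))
      (p : (ModuleCat.of R (Fin n → R) : ModuleCat.{u} R) →ₗ[R] X), SES i p ∧ Module.Finite R K := by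
  obtain ⟨n, p, hp⟩ := Module.Finite.exists_fin' R X
  exact ⟨n, _, _, p, ses_ker hp, inferInstanceAs (Module.Finite R (LinearMap.ker p))⟩

lemma SES.rTensor_inj_of_flat {f : A →ₗ[R] B} {g : B →ₗ[R] D} (h : SES f g) (hD : Module.Flat R D)
    (J : Type u) [AddCommGroup J] [Module R J] : Function.Injective (f.rTensor J) := by
  have h1 := LinearMap.lTensor_injective_of_exact_of_flat (R := R) g h.surj f h.inj h.exact J
  rw [← LinearMap.comm_comp_lTensor_comp_comm_eq]
  simpa using h1

lemma SES.flat_ker {f : A →ₗ[R] B} {g : B →ₗ[R] D} (h : SES f g) (hB : Module.Flat R B)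
    (hD : Module.Flat R D) : Module.Flat R A := by
  rw [Module.Flat.iff_lTensor_preserves_injective_linearMap'.{u}]
  intro N N' _ _ _ _ k hk
  have h1 := h.rTensor_inj_of_flat hD N
  have h2 := Module.Flat.lTensor_preserves_injective_linearMap (M := B) k hk
  have h3 : (f.rTensor N') ∘ₗ (k.lTensor A) = (k.lTensor B) ∘ₗ (f.rTensor N) := by
    rw [LinearMap.rTensor_comp_lTensor, LinearMap.lTensor_comp_rTensor]
  have h4 : Function.Injective ((f.rTensor N') ∘ₗ (k.lTensor A)) := by
    rw [h3, LinearMap.coe_comp]; exact h2.comp h1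
  rw [LinearMap.coe_comp] at h4
  exact h4.of_comp

lemma EV_flat_char (F : ModuleCat.{u} R) (hF : Module.Flat R F) (J : Type u) [AddCommGroup J] [Module R J] (i : ℕ) :
    EV (i + 1) F (ModuleCat.of R (CharacterModule J)) := by
  induction i generalizing F with
  | zero =>
    obtain ⟨P, K, i, p, hP, hs⟩ := exists_proj_cover F
    refine hs.EV_one_of_extend (EV_of_projective hP 0) fun k => ?_
    exact (rTensor_injective_iff_lcomp_surjective (f := i) (B := J)).1 (hs.rTensor_inj_of_flat hF J) k
  | succ n ih =>
    obtain ⟨P, K, i, p, hP, hs⟩ := exists_proj_cover F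
    exact hs.EV_right (ih K (hs.flat_ker inferInstance hF)) (EV_of_projective hP _)

/-- A flat/projective test class `Fl` compatible with a class `W` relative to `C`. -/
structure Setting (C : ModuleCat.{u} R) (Fl W : ModuleCat.{u} R → Prop) : Prop where
  flat : ∀ F, Fl F → Module.Flat R F
  ofFin : ∀ n : ℕ, Fl (ModuleCat.of R (Fin n → R))
  tens : ∀ (n : ℕ) (F : ModuleCat.{u} R), Fl F → Fl (ModuleCat.of R ((Fin n → R) ⊗[R] F))
  extend : ∀ (n : ℕ) (Ω X : ModuleCat.{u} R) (f : Ω →ₗ[R] (ModuleCat.of R (Fin n → R) : ModuleCat.{u} R))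
    (g : (ModuleCat.of R (Fin n → R) : ModuleCat.{u} R) →ₗ[R] X), SES f g → Module.Finite R Ω →
    (∀ k : Ω →ₗ[R] C, ∃ l : (Fin n → R) →ₗ[R] C, l ∘ₗ f = k) →
    ∀ F w : ModuleCat.{u} R, Fl F → W w → ∀ k : Ω ⊗[R] F →ₗ[R] w,
      ∃ l : (Fin n → R) ⊗[R] F →ₗ[R] w, l ∘ₗ f.rTensor F = k
  ev : ∀ (n : ℕ) (F w : ModuleCat.{u} R), Fl F → W w → ∀ i,
    EV (i + 1) (ModuleCat.of R ((Fin n → R) ⊗[R] F)) w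

def Wp (C : ModuleCat.{u} R) : ModuleCat.{u} R → Prop := fun N => IsCProjective R C N
def Cf (C : ModuleCat.{u} R) : ModuleCat.{u} R → Prop := fun N => IsCFlat R C N
def Wf (C : ModuleCat.{u} R) : ModuleCat.{u} R → Prop := fun N =>
  ∃ I : ModuleCat.{u} R, Module.Injective R I ∧ Nonempty (N ≃ₗ[R] CharacterModule (C →ₗ[R] I))
def Fp : ModuleCat.{u} R → Prop := fun N => Module.Projective R N
def Ff : ModuleCat.{u} R → Prop := fun N => Module.Flat R N

lemma extend_tensor_proj (C P Q : ModuleCat.{u} R) (hQ : Module.Projective R Q) [Module.Finite R Ω]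
    (f : Ω →ₗ[R] P) (hf : ∀ k : Ω →ₗ[R] C, ∃ l : P →ₗ[R] C, l ∘ₗ f = k)
    (k : Ω →ₗ[R] C ⊗[R] Q) : ∃ l : P →ₗ[R] C ⊗[R] Q, l ∘ₗ f = k := by
  classical
  obtain ⟨s, hs⟩ := (Module.projective_def' (R := R) (P := Q)).1 hQ
  let e := TensorProduct.finsuppScalarRight R R C Q
  let k' : Ω →ₗ[R] (Q →₀ C) := e.toLinearMap ∘ₗ (s.lTensor C) ∘ₗ k
  obtain ⟨S, hS⟩ := Module.Finite.fg_top (R := R) (M := Ω)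
  let T : Finset Q := S.biUnion fun x => (k' x).support
  have hT : ∀ x, k' x ∈ Finsupp.supported C R (T : Set Q) := by
    intro x
    have hx : x ∈ Submodule.span R (S : Set Ω) := by rw [hS]; trivial
    induction hx using Submodule.span_induction with
    | mem x hx =>
      rw [Finsupp.mem_supported]
      intro q hq
      simp only [T, Finset.coe_biUnion, Set.mem_iUnion]
      exact ⟨x, hx, hq⟩
    | zero => rw [map_zero]; exact Submodule.zero_mem _
    | add x y _ _ hx hy => rw [map_add]; exact Submodule.add_mem _ hx hy
    | smul r x _ hx => rw [map_smul]; exact Submodule.smul_mem _ _ hx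
  choose l hl using fun q : Q => hf (Finsupp.lapply q ∘ₗ k')
  let L : P →ₗ[R] (Q →₀ C) := ∑ q ∈ T, Finsupp.lsingle q ∘ₗ l q
  have hL : L ∘ₗ f = k' := by
    ext x q
    have h1 : ∀ q, l q (f x) = k' x q := fun q => by
      have := LinearMap.congr_fun (hl q) x
      simpa using this
    simp only [L, LinearMap.comp_apply, LinearMap.sum_apply, Finsupp.lsingle_apply, h1]
    have h2 : ∑ q ∈ T, Finsupp.single q (k' x q) = k' x := by
      have h3 := Finsupp.sum_of_support_subset (k' x) (s := T) (by
        have := hT x; rw [Finsupp.mem_supported] at this; exact_mod_cast this) Finsupp.single (by simp)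
      rw [← h3, Finsupp.sum_single]
    rw [h2]
  refine ⟨(LinearMap.lTensor C (Finsupp.linearCombination R (id : Q → Q))) ∘ₗ e.symm.toLinearMap ∘ₗ L, ?_⟩
  have h5 : (LinearMap.lTensor C (Finsupp.linearCombination R (id : Q → Q))) ∘ₗ (s.lTensor C) = LinearMap.id := by
    rw [← LinearMap.lTensor_comp, hs, LinearMap.lTensor_id]
  calc _ = (LinearMap.lTensor C (Finsupp.linearCombination R (id : Q → Q))) ∘ₗ e.symm.toLinearMap ∘ₗ (L ∘ₗ f) := rfl
    _ = ((LinearMap.lTensor C (Finsupp.linearCombination R (id : Q → Q))) ∘ₗ (s.lTensor C)) ∘ₗ k := by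
      rw [hL]; ext x; simp [k']
    _ = k := by rw [h5]; rfl

lemma setting_p (C : ModuleCat.{u} R) : Setting C Fp (Wp C) where
  flat F hF := by have : Module.Projective R F := hF; infer_instance
  ofFin n := inferInstanceAs (Module.Projective R (Fin n → R))
  tens n F hF := by
    have hF : Module.Projective R F := hF
    exact inferInstanceAs (Module.Projective R ((Fin n → R) ⊗[R] F))
  extend n Ω X f g hs hΩ hf F w hF hw k := by
    obtain ⟨Q, hQ, ⟨e⟩⟩ := hw
    have hF : Module.Projective R F := hF
    have hsurj : Function.Surjective (LinearMap.lcomp R w f) := by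
      intro k
      obtain ⟨l, hl⟩ := extend_tensor_proj C _ Q hQ f hf (e.toLinearMap ∘ₗ k)
      refine ⟨e.symm.toLinearMap ∘ₗ l, ?_⟩
      ext x
      have := LinearMap.congr_fun hl x
      simp only [LinearMap.comp_apply] at this
      simp [this]
    obtain ⟨l, hl⟩ := Module.projective_lifting_property (LinearMap.lcomp R w f)
      ((TensorProduct.mk R Ω F).flip.compr₂ k) hsurj
    refine ⟨TensorProduct.lift l.flip, ?_⟩
    ext x y
    have := LinearMap.congr_fun (LinearMap.congr_fun hl y) x
    simpa using this
  ev n F w hF hw i := by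
    have hF : Module.Projective R F := hF
    exact EV_of_projective (inferInstanceAs (Module.Projective R ((Fin n → R) ⊗[R] F))) i

lemma setting_f [IsNoetherianRing R] (C : ModuleCat.{u} R) : Setting C Ff (Wf C) where
  flat F hF := hF
  ofFin n := inferInstanceAs (Module.Flat R (Fin n → R))
  tens n F hF := by
    have hF : Module.Flat R F := hF
    exact inferInstanceAs (Module.Flat R ((Fin n → R) ⊗[R] F))
  extend n Ω X f g hs hΩ hf F w hF hw k := by
    obtain ⟨I, hI, ⟨e⟩⟩ := hw
    have hF : Module.Flat R F := hF
    have h1 := te_inj_of_surj (B := C) hI f hf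
    have h2 := Module.Flat.rTensor_preserves_injective_linearMap (M := F) _ h1
    have h3 : Function.Injective ((f.rTensor F).rTensor (C →ₗ[R] I)) := by
      have : (f.rTensor F).rTensor (C →ₗ[R] I) =
          (TensorProduct.rightComm R _ _ _).symm.toLinearMap ∘ₗ ((f.rTensor (C →ₗ[R] I)).rTensor F)
           ∘ₗ (TensorProduct.rightComm R _ _ _).toLinearMap := by
        ext x y z; simp
      rw [this]
      simpa using h2
    obtain ⟨l, hl⟩ := (rTensor_injective_iff_lcomp_surjective).1 h3 (e.toLinearMap ∘ₗ k)
    refine ⟨e.symm.toLinearMap ∘ₗ l, ?_⟩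
    apply LinearMap.ext
    intro x
    have := LinearMap.congr_fun hl x
    simp only [LinearMap.lcomp_apply, LinearMap.comp_apply, LinearEquiv.coe_coe] at this
    simp [this]
  ev n F w hF hw i := by
    obtain ⟨I, hI, ⟨e⟩⟩ := hw
    have hF : Module.Flat R F := hF
    refine EV.of_iso_right e.symm (EV_flat_char _ ?_ _ i)
    exact inferInstanceAs (Module.Flat R ((Fin n → R) ⊗[R] F))

end GC
end

section
open CategoryTheory IsLocalRing Paper TensorProduct


namespace GC

variable {R : Type u} [CommRing R]
variable {A B D A' B' D' X Y K L N w Ω P C : ModuleCat.{u} R} {Fl W : ModuleCat.{u} R → Prop}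

lemma Setting.K2 [IsNoetherianRing R] (hS : Setting C Fl W) (X : ModuleCat.{u} R) [Module.Finite R X]
    (hX : ∀ i, EV (i + 1) X C) {F : ModuleCat.{u} R} (hF : Fl F) (hw : W w) (i : ℕ) :
    EV (i + 1) (ModuleCat.of R (X ⊗[R] F)) w := by
  have := hS.flat F hF
  induction i generalizing X with
  | zero =>
    obtain ⟨n, K, i, p, hs, hK⟩ := exists_fin_cover X
    refine (hs.rTensor F).EV_one_of_extend (hS.ev n F w hF hw 0) fun k => ?_
    exact hS.extend n K X i p hs hK (fun k => hs.extend (hX 0) k) F w hF hw k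
  | succ i ih =>
    obtain ⟨n, K, j, p, hs, hK⟩ := exists_fin_cover X
    refine (hs.rTensor F).EV_right (ih K fun i => ?_) (hS.ev n F w hF hw _)
    refine hs.EV_left (EV_of_projective ?_ i) (hX (i + 1))
    exact inferInstanceAs (Module.Projective R (Fin n → R))

structure Sem (C : ModuleCat.{u} R) : Prop where
  fin : Module.Finite R C
  bij : Function.Bijective (fun r : R => (r • LinearMap.id : C →ₗ[R] C))
  ev : ∀ i, EV (i + 1) C C

/-- modules of the form `C ⊗ F` -/
def CF (C : ModuleCat.{u} R) (Fl : ModuleCat.{u} R → Prop) : ModuleCat.{u} R → Prop := fun N =>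
  ∃ F : ModuleCat.{u} R, Fl F ∧ Nonempty (N ≃ₗ[R] C ⊗[R] F)

lemma Setting.CF_EV [IsNoetherianRing R] (hS : Setting C Fl W) (hC : Sem C) (hA : CF C Fl A) (hw : W w) (i : ℕ) :
    EV (i + 1) A w := by
  obtain ⟨F, hF, ⟨e⟩⟩ := hA
  have := hC.fin
  exact EV.of_iso (A := ModuleCat.of R (C ⊗[R] F)) e.symm (hS.K2 C hC.ev hF hw i)

lemma Wf_sub_Cf [IsNoetherianRing R] (hC : Sem C) (hA : Wf C A) : Cf C A := by
  obtain ⟨I, hI, ⟨e⟩⟩ := hA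
  have := hC.fin
  refine ⟨ModuleCat.of R (I →ₗ[R] EE R), ?_, ⟨?_⟩⟩
  · have := flat_char I hI
    exact Module.Flat.of_linearEquiv (charEquiv I)
  · exact e.trans ((charEquiv _).symm.trans (LinearEquiv.ofBijective _ (te_bij (Ω := C) (B := I) EE_injective)).symm)

/-- totally `C`-reflexive -/
structure Tot (C Ω : ModuleCat.{u} R) : Prop where
  fin : Module.Finite R Ω
  ev : ∀ i, EV (i + 1) Ω C
  ev' : ∀ i, EV (i + 1) (ModuleCat.of R (Ω →ₗ[R] C)) C
  bij : Function.Bijective (LinearMap.applyₗ : Ω →ₗ[R] (Ω →ₗ[R] C) →ₗ[R] C)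

lemma Sem.inj (hC : Sem C) (r : R) (h : ∀ c : C, r • c = 0) : r = 0 :=
  hC.bij.1 (by ext c; simp [h])

lemma Sem.surj (hC : Sem C) (f : C →ₗ[R] C) : ∃ r : R, ∀ c, f c = r • c := by
  obtain ⟨r, hr⟩ := hC.bij.2 f
  exact ⟨r, fun c => by rw [← hr]; simp⟩

noncomputable def homEndEquiv (hC : Sem C) : R ≃ₗ[R] (C →ₗ[R] C) :=
  LinearEquiv.ofBijective (LinearMap.toSpanSingleton R (C →ₗ[R] C) LinearMap.id) hC.bij

lemma Sem.tot (hC : Sem C) : Tot C C where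
  fin := hC.fin
  ev := hC.ev
  ev' i := EV_of_projective (Module.Projective.of_equiv (homEndEquiv hC)) i
  bij := by
    constructor
    · intro x y h
      simpa using LinearMap.congr_fun h LinearMap.id
    · intro Φ
      refine ⟨Φ LinearMap.id, ?_⟩
      ext f
      obtain ⟨r, hr⟩ := hC.surj f
      have : f = r • LinearMap.id := by ext c; simp [hr]
      rw [this]; simp

lemma Sem.fin_refl (hC : Sem C) (n : ℕ) :
    Function.Bijective (LinearMap.applyₗ : (Fin n → R) →ₗ[R] ((Fin n → R) →ₗ[R] C) →ₗ[R] C) := by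
  let s : Fin n → C →ₗ[R] ((Fin n → R) →ₗ[R] C) := fun j =>
    LinearMap.flip (LinearMap.lsmul R C ∘ₗ LinearMap.proj j)
  have hs : ∀ j c y, s j c y = y j • c := fun j c y => rfl
  constructor
  · rw [injective_iff_map_eq_zero]
    intro y hy
    ext j
    refine hC.inj _ fun c => ?_
    exact LinearMap.congr_fun hy (s j c)
  · intro Φ
    choose r hr using fun j => hC.surj (Φ ∘ₗ s j)
    refine ⟨r, ?_⟩
    ext φ
    have h1 : φ = ∑ j, s j (φ (Pi.single j 1)) := by
      refine (Pi.basisFun R (Fin n)).ext fun j => ?_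
      simp [hs, Pi.single_apply, Finset.sum_apply]
    have h2 : Φ φ = ∑ j, r j • φ (Pi.single j 1) := by
      conv_lhs => rw [h1, map_sum]
      exact Finset.sum_congr rfl fun j _ => hr j _
    have h3 : φ r = ∑ j, r j • φ (Pi.single j 1) := by
      conv_lhs => rw [h1]
      simp [hs]
    rw [h2, ← h3]; rfl

noncomputable def homFinEquiv (C : ModuleCat.{u} R) (n : ℕ) :
    ((Fin n → R) →ₗ[R] C) ≃ₗ[R] C ⊗[R] (Fin n → R) :=
  ((Pi.basisFun R (Fin n)).constr R).symm.trans (TensorProduct.piScalarRight R R C (Fin n)).symm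

lemma SES.dual {f : A →ₗ[R] B} {g : B →ₗ[R] D} (h : SES f g) (C : ModuleCat.{u} R) (hC : EV 1 D C) :
    SES (A := ModuleCat.of R (D →ₗ[R] C)) (B := ModuleCat.of R (B →ₗ[R] C)) (D := ModuleCat.of R (A →ₗ[R] C))
      (LinearMap.lcomp R C g) (LinearMap.lcomp R C f) where
  inj := fun a b hab => by
    ext x
    obtain ⟨y, rfl⟩ := h.surj x
    exact LinearMap.congr_fun hab y
  exact := by
    intro k
    constructor
    · intro hk
      obtain ⟨k', hk'⟩ := exists_desc g h.surj k (fun x hx => by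
        obtain ⟨y, rfl⟩ := (h.exact x).1 hx
        exact LinearMap.congr_fun hk y)
      exact ⟨k', LinearMap.ext hk'⟩
    · rintro ⟨k', rfl⟩
      ext x
      simp [h.exact.apply_apply_eq_zero]
  surj := fun k => by
    obtain ⟨l, hl⟩ := h.extend hC k
    exact ⟨l, hl⟩

lemma Tot.syz [IsNoetherianRing R] (hC : Sem C) (h : Tot C Ω) {n : ℕ}
    {i : K →ₗ[R] (ModuleCat.of R (Fin n → R) : ModuleCat.{u} R)}
    {p : (ModuleCat.of R (Fin n → R) : ModuleCat.{u} R) →ₗ[R] Ω} (hs : SES i p) (hK : Module.Finite R K) :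
    Tot C K := by
  have hPC : ∀ i, EV (i + 1) (ModuleCat.of R ((Fin n → R) →ₗ[R] C)) C := fun i => by
    refine (setting_p C).CF_EV hC ?_ ?_ i
    · exact ⟨_, (setting_p C).ofFin n, ⟨homFinEquiv C n⟩⟩
    · exact ⟨ModuleCat.of R R, inferInstanceAs (Module.Projective R R), ⟨(TensorProduct.rid R C).symm⟩⟩
  have hd := hs.dual C (h.ev 0)
  have hb := hC.fin_refl n
  refine ⟨hK, fun i => ?_, fun i => ?_, ?_⟩
  · exact hs.EV_left (EV_of_projective (inferInstanceAs (Module.Projective R (Fin n → R))) i) (h.ev (i + 1))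
  · cases i with
    | zero =>
      refine hd.EV_one_of_extend (hPC 0) fun k => ?_
      obtain ⟨ω, rfl⟩ := h.bij.2 k
      obtain ⟨x, rfl⟩ := hs.surj ω
      exact ⟨LinearMap.applyₗ x, rfl⟩
    | succ i => exact hd.EV_right (h.ev' i) (hPC _)
  · constructor
    · rw [injective_iff_map_eq_zero]
      intro x hx
      apply hs.inj
      rw [map_zero]
      refine (injective_iff_map_eq_zero _).1 hb.1 _ ?_
      ext φ
      exact LinearMap.congr_fun hx (φ ∘ₗ i)
    · intro Φ
      obtain ⟨y, hy⟩ := hb.2 (Φ ∘ₗ LinearMap.lcomp R C i)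
      have hpy : p y = 0 := by
        refine (injective_iff_map_eq_zero _).1 h.bij.1 _ ?_
        ext ψ
        have h1 := LinearMap.congr_fun hy (ψ ∘ₗ p)
        have h2 : (ψ ∘ₗ p) ∘ₗ i = 0 := by ext x; simp [hs.exact.apply_apply_eq_zero]
        refine h1.trans ?_
        change Φ ((ψ ∘ₗ p) ∘ₗ i) = 0
        rw [h2, map_zero]
      obtain ⟨x, rfl⟩ := (hs.exact y).1 hpy
      refine ⟨x, ?_⟩
      ext φ
      obtain ⟨l, rfl⟩ := hd.surj φ
      exact LinearMap.congr_fun hy l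

lemma Setting.proj_mem [IsNoetherianRing R] (hS : Setting C Fl W) (hC : Sem C) {F : ModuleCat.{u} R} (hF : Fl F) :
    Gp (CF C Fl) W F := by
  have hflat := hS.flat F hF
  refine ⟨fun X => ∃ Ω : ModuleCat.{u} R, Tot C Ω ∧ Nonempty (X ≃ₗ[R] (Ω →ₗ[R] C) ⊗[R] F), ?_, ?_⟩
  · exact ⟨C, hC.tot, ⟨(TensorProduct.lid R F).symm.trans
      (TensorProduct.congr (homEndEquiv hC) (LinearEquiv.refl R F))⟩⟩
  · rintro X ⟨Ω, hΩ, ⟨e⟩⟩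
    have := hΩ.fin
    have := hC.fin
    refine ⟨fun i w hw => ?_, ?_⟩
    · have : Module.Finite R (ModuleCat.of R (Ω →ₗ[R] C)) := inferInstanceAs (Module.Finite R (Ω →ₗ[R] C))
      exact EV.of_iso (A := ModuleCat.of R ((Ω →ₗ[R] C) ⊗[R] F)) e.symm
        (hS.K2 (ModuleCat.of R (Ω →ₗ[R] C)) hΩ.ev' hF hw i)
    · obtain ⟨n, K, i, p, hs, hK⟩ := exists_fin_cover Ω
      have h1 := ((hs.dual C (hΩ.ev 0)).rTensor F).of_iso_left e
      refine ⟨_, _, _, _, ?_, h1, K, hΩ.syz hC hs hK, ⟨LinearEquiv.refl R _⟩⟩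
      exact ⟨_, hS.tens n F hF, ⟨(TensorProduct.congr (homFinEquiv C n) (LinearEquiv.refl R F)).trans
        (TensorProduct.assoc R _ _ _)⟩⟩

end GC
end

section
open CategoryTheory IsLocalRing Paper TensorProduct


namespace GC

variable {R : Type u} [CommRing R]
variable {A B D A' B' D' X Y K L N w Ω P C : ModuleCat.{u} R} {Fl W : ModuleCat.{u} R → Prop}

lemma good_p [IsNoetherianRing R] (hC : Sem C) : Good (Wp C) where
  prod := by
    rintro A B ⟨P, hP, ⟨e⟩⟩ ⟨Q, hQ, ⟨e'⟩⟩
    exact ⟨ModuleCat.of R (P × Q), inferInstanceAs (Module.Projective R (P × Q)),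
      ⟨(LinearEquiv.prodCongr e e').trans (TensorProduct.prodRight R R C P Q).symm⟩⟩
  zero := by
    have : Subsingleton (C ⊗[R] PUnit.{u+1}) := by
      have : Subsingleton (PUnit.{u+1} ⊗[R] C) := inferInstance
      exact (TensorProduct.comm R C PUnit.{u+1}).injective.subsingleton
    refine ⟨ModuleCat.of R PUnit, inferInstanceAs (Module.Projective R PUnit.{u+1}), ⟨?_⟩⟩
    exact { (0 : PUnit.{u+1} →ₗ[R] C ⊗[R] PUnit.{u+1}) with
      invFun := 0, left_inv := fun _ => rfl, right_inv := fun _ => Subsingleton.elim _ _ }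
  self hA hB i := (setting_p C).CF_EV hC hA hB i

lemma injective_prod {I J : Type u} [AddCommGroup I] [Module R I] [AddCommGroup J] [Module R J]
    (hI : Module.Injective R I) (hJ : Module.Injective R J) : Module.Injective R (I × J) := by
  refine ⟨fun X Y _ _ _ _ f hf g => ?_⟩
  obtain ⟨a, ha⟩ := hI.out f hf (LinearMap.fst R I J ∘ₗ g)
  obtain ⟨b, hb⟩ := hJ.out f hf (LinearMap.snd R I J ∘ₗ g)
  exact ⟨a.prod b, fun x => Prod.ext (ha x) (hb x)⟩

lemma good_f [IsNoetherianRing R] (hC : Sem C) : Good (Wf C) where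
  prod := by
    rintro A B ⟨I, hI, ⟨e⟩⟩ ⟨J, hJ, ⟨e'⟩⟩
    refine ⟨ModuleCat.of R (I × J), injective_prod hI hJ, ⟨?_⟩⟩
    let e1 : (A × B) ≃ₗ[R] ((C →ₗ[R] I) →ₗ[R] EE R) × ((C →ₗ[R] J) →ₗ[R] EE R) :=
      LinearEquiv.prodCongr (e.trans (charEquiv (C →ₗ[R] I)).symm) (e'.trans (charEquiv (C →ₗ[R] J)).symm)
    let e2 : (((C →ₗ[R] I) →ₗ[R] EE R) × ((C →ₗ[R] J) →ₗ[R] EE R)) ≃ₗ[R]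
      (((C →ₗ[R] I) × (C →ₗ[R] J)) →ₗ[R] EE R) := LinearMap.coprodEquiv R
    exact (e1.trans e2).trans ((charEquiv _).trans (CharacterModule.congr (LinearMap.prodEquiv R)))
  zero := by
    have hs : Subsingleton (CharacterModule (C →ₗ[R] PUnit.{u+1})) :=
      ⟨fun a b => CharacterModule.ext _ fun c => by
        have : c = 0 := Subsingleton.elim _ _
        rw [this, map_zero, map_zero]⟩
    refine ⟨ModuleCat.of R PUnit, ⟨fun X Y _ _ _ _ f hf g => ⟨0, fun _ => rfl⟩⟩, ⟨?_⟩⟩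
    exact { (0 : PUnit.{u+1} →ₗ[R] CharacterModule (C →ₗ[R] PUnit.{u+1})) with
      invFun := 0, left_inv := fun _ => rfl, right_inv := fun _ => Subsingleton.elim _ _ }
  self hA hB i := (setting_f C).CF_EV hC (Wf_sub_Cf hC hA) hB i

inductive ExtCl (C : ModuleCat.{u} R) : ModuleCat.{u} R → Prop
  | base (N : ModuleCat.{u} R) : Gp (Cf C) (Wf C) N → ExtCl C N
  | step (N X D : ModuleCat.{u} R) (f : N →ₗ[R] X) (g : X →ₗ[R] D) : ExtCl C N → Cf C D → SES f g → ExtCl C X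

lemma ses_evc [IsNoetherianRing R] (hC : Sem C) (hA : Cf C A) : ∃ (v X' : ModuleCat.{u} R)
    (f : A →ₗ[R] v) (g : v →ₗ[R] X'), Wf C v ∧ SES f g ∧ Cf C X' := by
  obtain ⟨F, hF, ⟨e⟩⟩ := hA
  have := hC.fin
  have hI : Module.Injective R (CharacterModule F) := Module.Flat.iff_characterModule_injective.1 inferInstance
  let q := (LinearMap.range (evc (R := R) F)).mkQ
  have hs : SES (A := ModuleCat.of R F) (B := ModuleCat.of R (CharacterModule (CharacterModule F)))
    (D := ModuleCat.of R (CharacterModule (CharacterModule F) ⧸ LinearMap.range (evc (R := R) F)))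
    (evc (R := R) F) q := ses_coker (B := ModuleCat.of R (CharacterModule (CharacterModule F))) (evc_inj F)
  have hs2 : SES (A := ModuleCat.of R (C ⊗[R] F)) (B := ModuleCat.of R (C ⊗[R] CharacterModule (CharacterModule F)))
    (D := ModuleCat.of R (C ⊗[R] (CharacterModule (CharacterModule F) ⧸ LinearMap.range (evc (R := R) F))))
    ((evc (R := R) F).lTensor C) (q.lTensor C) := by
    refine ⟨?_, lTensor_exact C hs.exact hs.surj, LinearMap.lTensor_surjective C hs.surj⟩
    have h1 := evc_rTensor_inj (R := R) F C
    have h2 : (evc (R := R) F).lTensor C = (TensorProduct.comm R _ _).toLinearMap ∘ₗ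
      (evc (R := R) F).rTensor C ∘ₗ (TensorProduct.comm R _ _).toLinearMap := by ext; rfl
    rw [h2]
    simpa using h1
  refine ⟨_, _, _, _, ⟨ModuleCat.of R (CharacterModule F), hI, ⟨?_⟩⟩, hs2.of_iso_left e,
    ⟨ModuleCat.of R (CharacterModule (CharacterModule F) ⧸ LinearMap.range (evc (R := R) F)), flat_coker_evc F, ⟨LinearEquiv.refl R _⟩⟩⟩
  let e1 : (C ⊗[R] CharacterModule (CharacterModule F)) ≃ₗ[R] C ⊗[R] (CharacterModule F →ₗ[R] EE R) :=
    TensorProduct.congr (LinearEquiv.refl R C) (charEquiv (CharacterModule F)).symm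
  exact e1.trans <| (LinearEquiv.ofBijective _ (te_bij (Ω := C) (B := CharacterModule F) EE_injective)).trans (charEquiv _)

lemma ExtCl.EV [IsNoetherianRing R] (hC : Sem C) (h : ExtCl C N) (hw : Wf C w) (i : ℕ) : GC.EV (i + 1) N w := by
  induction h with
  | base N h => exact h.EV i hw
  | step N X D f g hN hD hs ih => exact hs.EV_mid ih ((setting_f C).CF_EV hC hD hw i)

lemma ExtCl.step' [IsNoetherianRing R] (hC : Sem C) (h : ExtCl C N) : ∃ (v X' : ModuleCat.{u} R)
    (f : N →ₗ[R] v) (g : v →ₗ[R] X'), Wf C v ∧ SES f g ∧ ExtCl C X' := by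
  induction h with
  | base N h =>
    obtain ⟨v, X', f, g, hv, hs, hX⟩ := h.step
    obtain ⟨v', X'', f', g', hv', hs', hX'⟩ := ses_evc hC hv
    obtain ⟨Q, p, i, q, h1, h2⟩ := comp_inj_ses hs hs'
    exact ⟨v', Q, _, p, hv', h1, .step _ _ _ i q (.base _ hX) hX' h2⟩
  | step N X D f g hN hD hs ih =>
    obtain ⟨v, N', a, a', hv, ha, hN'⟩ := ih
    obtain ⟨y, D', e, e', hy, he, hD'⟩ := ses_evc hC hD
    obtain ⟨l, hl⟩ := hs.extend ((setting_f C).CF_EV hC hD hv 0) a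
    obtain ⟨B', b, b', f', g', h1, h2⟩ := horseshoe_inj hs ha he l (fun x => LinearMap.congr_fun hl x)
    exact ⟨_, B', b, b', (good_f hC).prod hv hy, h1, .step _ _ _ f' g' hN' hD' h2⟩

lemma Gp_Cf_sub [IsNoetherianRing R] (hC : Sem C) (h : Gp (Cf C) (Wf C) N) : Gp (Wf C) (Wf C) N :=
  ⟨ExtCl C, .base _ h, fun _ hX => ⟨fun i _ hw => hX.EV hC hw i, hX.step' hC⟩⟩

lemma Gp_Wf_sub [IsNoetherianRing R] (hC : Sem C) (h : Gp (Wf C) (Wf C) N) : Gp (Cf C) (Wf C) N := by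
  obtain ⟨S, hN, hS⟩ := h
  refine ⟨S, hN, fun X hX => ⟨(hS X hX).1, ?_⟩⟩
  obtain ⟨v, X', f, g, hv, hs, hX'⟩ := (hS X hX).2
  exact ⟨v, X', f, g, Wf_sub_Cf hC hv, hs, hX'⟩

abbrev GP (C : ModuleCat.{u} R) := Gp (Wp C) (Wp C)
abbrev GF (C : ModuleCat.{u} R) := Gp (Wf C) (Wf C)

lemma flat_GF [IsNoetherianRing R] (hC : Sem C) (hA : Module.Flat R A) : GF C A :=
  Gp_Cf_sub hC ((setting_f C).proj_mem hC (F := A) hA)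

lemma res_p [IsNoetherianRing R] (hC : Sem C) : Resolving (GP C) :=
  (good_p hC).resolving fun A hA => (setting_p C).proj_mem hC (F := A) hA

lemma res_f [IsNoetherianRing R] (hC : Sem C) : Resolving (GF C) :=
  (good_f hC).resolving fun _ _ => flat_GF hC inferInstance

end GC
end

section
open CategoryTheory IsLocalRing Paper TensorProduct


namespace GC

variable {R : Type u} [CommRing R]
variable {A B D A' B' D' X Y K L N w Ω P C : ModuleCat.{u} R} {Fl W : ModuleCat.{u} R → Prop}

lemma exact_iff_char {U V Z : Type u} [AddCommGroup U] [Module R U] [AddCommGroup V] [Module R V]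
    [AddCommGroup Z] [Module R Z] (f : U →ₗ[R] V) (g : V →ₗ[R] Z) (hgf : g ∘ₗ f = 0) :
    Function.Exact f g ↔ ∀ c : CharacterModule V, CharacterModule.dual f c = 0 →
      ∃ c' : CharacterModule Z, CharacterModule.dual g c' = c := by
  let T := V ⧸ LinearMap.range f
  let q : V →ₗ[R] T := (LinearMap.range f).mkQ
  let ι : T →ₗ[R] Z := (LinearMap.range f).liftQ g (by
    rintro _ ⟨x, rfl⟩; exact LinearMap.congr_fun hgf x)
  have hι : ∀ x, ι (q x) = g x := fun x => rfl
  constructor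
  · intro h c hc
    have hinj : Function.Injective ι := by
      rw [injective_iff_map_eq_zero]
      intro x hx
      obtain ⟨x, rfl⟩ := Submodule.mkQ_surjective _ x
      rw [show (LinearMap.range f).mkQ = q from rfl, hι] at hx
      obtain ⟨y, rfl⟩ := (h x).1 hx
      exact (Submodule.Quotient.mk_eq_zero _).2 ⟨y, rfl⟩
    have hc' : ∀ x ∈ (LinearMap.range f).toAddSubgroup, c x = 0 := by
      rintro _ ⟨x, rfl⟩
      exact DFunLike.congr_fun hc x
    let c0 : CharacterModule T := QuotientAddGroup.lift (LinearMap.range f).toAddSubgroup c hc'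
    obtain ⟨c', h'⟩ := CharacterModule.dual_surjective_of_injective ι hinj c0
    refine ⟨c', ?_⟩
    refine CharacterModule.ext _ fun x => ?_
    have h1 := DFunLike.congr_fun h' (q x)
    change c' (ι (q x)) = c x at h1
    rw [hι] at h1
    exact h1
  · intro h x
    constructor
    · intro hx
      by_contra hne
      have : q x ≠ 0 := fun h0 => hne ((Submodule.Quotient.mk_eq_zero _).1 h0)
      refine this (CharacterModule.eq_zero_of_character_apply fun c => ?_)
      obtain ⟨c', hc'⟩ := h (CharacterModule.dual q c) (by
        refine CharacterModule.ext _ fun y => ?_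
        change c (q (f y)) = 0
        rw [show q (f y) = 0 from (Submodule.Quotient.mk_eq_zero _).2 ⟨y, rfl⟩, map_zero])
      have h2 := DFunLike.congr_fun hc' x
      change c' (g x) = c (q x) at h2
      rw [← h2, hx, map_zero]
    · rintro ⟨y, rfl⟩
      exact LinearMap.congr_fun hgf y

lemma exact_tensor_iff {U V Z J : Type u} [AddCommGroup U] [Module R U] [AddCommGroup V] [Module R V]
    [AddCommGroup Z] [Module R Z] [AddCommGroup J] [Module R J]
    (f : U →ₗ[R] V) (g : V →ₗ[R] Z) (hgf : g ∘ₗ f = 0) :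
    Function.Exact (f.rTensor J) (g.rTensor J) ↔ ∀ c : V →ₗ[R] CharacterModule J, c ∘ₗ f = 0 →
      ∃ c' : Z →ₗ[R] CharacterModule J, c' ∘ₗ g = c := by
  rw [exact_iff_char _ _ (by rw [← LinearMap.rTensor_comp, hgf, LinearMap.rTensor_zero])]
  have key : ∀ {U V : Type u} [AddCommGroup U] [Module R U] [AddCommGroup V] [Module R V] (f : U →ₗ[R] V)
    (c : V →ₗ[R] CharacterModule J), CharacterModule.homEquiv.symm
      (CharacterModule.dual (f.rTensor J) (CharacterModule.homEquiv c)) = c ∘ₗ f := fun f c => rfl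
  constructor
  · intro h c hc
    obtain ⟨c', hc'⟩ := h (CharacterModule.homEquiv c) (by
      apply CharacterModule.homEquiv.symm.injective
      rw [key, hc, map_zero])
    refine ⟨CharacterModule.homEquiv.symm c', ?_⟩
    rw [← key, LinearEquiv.apply_symm_apply, hc', LinearEquiv.symm_apply_apply]
  · intro h c hc
    obtain ⟨c', hc'⟩ := h (CharacterModule.homEquiv.symm c) (by
      rw [← key, LinearEquiv.apply_symm_apply, hc, map_zero])
    refine ⟨CharacterModule.homEquiv c', ?_⟩
    apply CharacterModule.homEquiv.symm.injective
    rw [key, hc']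

lemma GP_iff [IsNoetherianRing R] (hC : Sem C) (N : ModuleCat.{u} R) : IsGCProjective R C N ↔ GP C N := by
  constructor
  · intro h
    have h : Ccx (fun N => Module.Projective R N) (Wp C) (Wp C) N := h
    exact Gp.of_ccx (fun X w i hX _ => EV_of_projective hX i) (fun X w i hX hw => (good_p hC).self hX hw i) h
  · intro h
    refine Gp.to_ccx (U := fun N => Module.Projective R N) h fun N hN => ?_
    obtain ⟨P, K, i, p, hP, hs⟩ := exists_proj_cover N
    exact ⟨K, P, i, p, hP, hs, (good_p hC).ker hs ((res_p hC).proj hP) hN⟩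

lemma EV_flat_Wf (hX : Module.Flat R X) (hw : Wf C w) (i : ℕ) : EV (i + 1) X w := by
  obtain ⟨I, hI, ⟨e⟩⟩ := hw
  exact EV.of_iso_right e.symm (EV_flat_char _ hX _ i)

lemma GF_iff [IsNoetherianRing R] (hC : Sem C) (N : ModuleCat.{u} R) : IsGCFlat R C N ↔ GF C N := by
  have key : IsGCFlat R C N ↔ Ccx (fun N => Module.Flat R N) (Cf C) (Wf C) N := by
    constructor
    · rintro ⟨Z, d, h1, h2, h3, h4, h5⟩
      refine ⟨Z, d, h1, h2, h3, ?_, h5⟩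
      rintro Q ⟨I, hI, ⟨e⟩⟩ i g hg
      obtain ⟨c, hc⟩ := (exact_tensor_iff (d i) (d (i + 1)) (LinearMap.ext fun x => (h3 i).apply_apply_eq_zero x)).1
        (h4 (ModuleCat.of R (C →ₗ[R] I)) ⟨I, hI, ⟨LinearEquiv.refl R _⟩⟩ i) (e.toLinearMap ∘ₗ g) (by
          rw [LinearMap.comp_assoc, hg, LinearMap.comp_zero])
      refine ⟨e.symm.toLinearMap ∘ₗ c, ?_⟩
      rw [LinearMap.comp_assoc, hc]
      ext x; simp
    · rintro ⟨Z, d, h1, h2, h3, h4, h5⟩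
      refine ⟨Z, d, h1, h2, h3, ?_, h5⟩
      rintro J ⟨I, hI, ⟨e⟩⟩ i
      rw [exact_tensor_iff (d i) (d (i + 1)) (LinearMap.ext fun x => (h3 i).apply_apply_eq_zero x)]
      intro c hc
      exact h4 (ModuleCat.of R (CharacterModule J)) ⟨I, hI, ⟨CharacterModule.congr e⟩⟩ i c hc
  rw [key]
  constructor
  · intro h
    exact Gp_Cf_sub hC (Gp.of_ccx (fun X w i hX hw => EV_flat_Wf hX hw i)
      (fun X w i hX hw => (setting_f C).CF_EV hC hX hw i) h)
  · intro h
    refine Gp.to_ccx (U := fun N => Module.Flat R N) (Gp_Wf_sub hC h) fun N hN => ?_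
    obtain ⟨P, K, i, p, hP, hs⟩ := exists_proj_cover N
    exact ⟨K, P, i, p, inferInstance, hs, Gp_Wf_sub hC ((good_f hC).ker hs ((res_f hC).proj hP) (Gp_Cf_sub hC hN))⟩

lemma fs_CF (hF : ∀ F, Fl F → Fl (fs F)) (v : ModuleCat.{u} R) (hv : CF C Fl v) : CF C Fl (fs v) := by
  obtain ⟨F, hF', ⟨e⟩⟩ := hv
  exact ⟨fs F, hF F hF', ⟨(Finsupp.mapRange.linearEquiv e).trans (TensorProduct.finsuppRight R R C F ℕ).symm⟩⟩

lemma GP_fs (N : ModuleCat.{u} R) (h : GP C N) : GP C (fs N) :=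
  Gp.fs (fun v hv => fs_CF (Fl := Fp) (fun _ hF => fs_projective hF) v hv) h

lemma GF_fs [IsNoetherianRing R] (hC : Sem C) (N : ModuleCat.{u} R) (h : GF C N) : GF C (fs N) :=
  Gp_Cf_sub hC (Gp.fs (fun v hv => fs_CF (Fl := Ff) (fun F hF => by
    have : Module.Flat R F := hF
    exact Module.Flat.of_linearEquiv (finsuppLEquivDirectSum R F ℕ)) v hv) (Gp_Wf_sub hC h))

lemma Sem.of_semidualizing {C : Type u} [AddCommGroup C] [Module R C] (h : IsSemidualizing R C) :
    Sem (ModuleCat.of R C) where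
  fin := h.1
  bij := h.2.1
  ev i := EV_of_ext (h.2.2 (i + 1) (by omega))

end GC
end

section
open CategoryTheory IsLocalRing Paper TensorProduct

universe v

namespace GC

variable {R : Type u} [CommRing R]

section DC

/-- derived completeness -/
structure DC (x : R) (A : Type v) [AddCommGroup A] [Module R A] : Prop where
  inj : ∀ a : ℕ → A, (∀ j, a j = x • a (j + 1)) → ∀ j, a j = 0
  surj : ∀ b : ℕ → A, ∃ a : ℕ → A, ∀ j, a j - x • a (j + 1) = b j

variable {A : Type v} [AddCommGroup A] [Module R A]

lemma DC.quot {x y : R} (h : DC x A) : DC x (A ⧸ LinearMap.range (LinearMap.lsmul R A y)) where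
  inj := by
    intro a ha
    choose a' ha' using fun j => Submodule.Quotient.mk_surjective _ (a j)
    have h1 : ∀ j, ∃ b, y • b = a' j - x • a' (j + 1) := fun j => by
      have := ha j
      rw [← ha', ← ha', ← Submodule.Quotient.mk_smul, Submodule.Quotient.eq] at this
      exact this
    choose b hb using h1
    obtain ⟨c, hc⟩ := h.surj b
    have h2 := h.inj (fun j => a' j - y • c j) (fun j => by
      have h3 := hb j
      rw [← hc, smul_sub, smul_comm y x] at h3
      rw [smul_sub]
      rw [sub_eq_sub_iff_add_eq_add] at h3 ⊢
      rw [← h3, add_comm])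
    intro j
    rw [← ha', Submodule.Quotient.mk_eq_zero]
    exact ⟨c j, (sub_eq_zero.1 (h2 j)).symm⟩
  surj := by
    intro b
    choose b' hb' using fun j => Submodule.Quotient.mk_surjective _ (b j)
    obtain ⟨a, ha⟩ := h.surj b'
    refine ⟨fun j => Submodule.Quotient.mk (a j), fun j => ?_⟩
    rw [← hb', ← ha]; rfl

lemma DC.eq_zero_of {x : R} (h : DC x A) (hA : ∀ a : A, ∃ b, x • b = a) (a : A) : a = 0 := by
  choose f hf using hA
  let s : ℕ → A := fun n => f^[n] a
  refine h.inj s (fun j => ?_) 0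
  simp only [s, Function.iterate_succ_apply', hf]

lemma DC.eq_zero (xs : List R) (h : ∀ x ∈ xs, DC x A)
    (hA : (⊤ : Submodule R A) ≤ Ideal.ofList xs • (⊤ : Submodule R A)) : ∀ a : A, a = 0 := by
  induction xs generalizing A with
  | nil =>
    intro a
    have := hA (Submodule.mem_top : a ∈ ⊤)
    simpa using this
  | cons x ys ih =>
    have h1 := ih (A := A ⧸ LinearMap.range (LinearMap.lsmul R A x))
      (fun y hy => (h y (by simp [hy])).quot) (by
        have h2 := Submodule.map_mono (f := (LinearMap.range (LinearMap.lsmul R A x)).mkQ) hA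
        rw [Submodule.map_top, Submodule.range_mkQ, Submodule.map_smul'', Submodule.map_top, Submodule.range_mkQ,
          Ideal.ofList_cons, Submodule.sup_smul] at h2
        refine h2.trans (sup_le ?_ le_rfl)
        rw [Submodule.smul_le]
        intro r hr n _
        obtain ⟨a, rfl⟩ := Submodule.Quotient.mk_surjective _ n
        obtain ⟨b, rfl⟩ := Ideal.mem_span_singleton'.1 hr
        have : (b * x) • (Submodule.Quotient.mk a : A ⧸ LinearMap.range (LinearMap.lsmul R A x)) = 0 := by
          rw [← Submodule.Quotient.mk_smul, Submodule.Quotient.mk_eq_zero]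
          exact ⟨b • a, by simp [mul_smul, smul_comm b x]⟩
        rw [this]; exact zero_mem _)
    refine DC.eq_zero_of (h x (by simp)) fun a => ?_
    have h3 := h1 (Submodule.Quotient.mk a)
    rwa [Submodule.Quotient.mk_eq_zero] at h3

end DC

variable {A B D A' B' D' X Y K L N w Ω P C H : ModuleCat.{u} R} {Fl W : ModuleCat.{u} R → Prop}

noncomputable def shiftMap (x : R) (H : ModuleCat.{u} R) : fs H →ₗ[R] fs H :=
  LinearMap.id - x • Finsupp.lmapDomain H R Nat.succ

lemma shiftMap_bij (x : R) (H : ModuleCat.{u} R) (hH : ∀ h : H, ∃ n, x ^ n • h = 0) :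
    Function.Bijective (shiftMap x H) := by
  let t : fs H →ₗ[R] fs H := x • Finsupp.lmapDomain H R Nat.succ
  have h0 : ∀ y : fs H, shiftMap x H y = y - t y := fun y => rfl
  have hcomm : ∀ n (y : fs H), (t ^ n) y = x ^ n • ((Finsupp.lmapDomain H R Nat.succ) ^ n) y := fun n y => by
    simp [t, smul_pow]
  have hnil : ∀ y : fs H, ∃ n, (t ^ n) y = 0 := by
    intro y
    have : ∃ n, x ^ n • y = 0 := by
      induction y using Finsupp.induction_linear with
      | zero => exact ⟨0, by simp⟩
      | add a b ha hb =>
        obtain ⟨n, hn⟩ := ha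
        obtain ⟨m, hm⟩ := hb
        exact ⟨n + m, by
          rw [smul_add]
          conv_lhs => rw [pow_add]
          rw [mul_comm, mul_smul, hn, mul_comm, mul_smul, hm]; simp⟩
      | single j h =>
        obtain ⟨n, hn⟩ := hH h
        exact ⟨n, by rw [Finsupp.smul_single, hn, Finsupp.single_zero]⟩
    obtain ⟨n, hn⟩ := this
    exact ⟨n, by rw [hcomm, ← map_smul, hn, map_zero]⟩
  constructor
  · rw [injective_iff_map_eq_zero]
    intro y hy
    rw [h0, sub_eq_zero] at hy
    obtain ⟨n, hn⟩ := hnil y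
    have : ∀ m, (t ^ m) y = y := fun m => by
      induction m with
      | zero => rfl
      | succ m ih => rw [pow_succ, Module.End.mul_apply, ← hy, ih]
    rw [← this n, hn]
  · intro y
    obtain ⟨n, hn⟩ := hnil y
    refine ⟨∑ i ∈ Finset.range n, (t ^ i) y, ?_⟩
    rw [h0, map_sum]
    have : ∀ i, t ((t ^ i) y) = (t ^ (i + 1)) y := fun i => by rw [pow_succ', Module.End.mul_apply]
    simp only [this]
    rw [← Finset.sum_sub_distrib, Finset.sum_range_sub', hn]; simp

lemma ext_DC (x : R) (H w : ModuleCat.{u} R) (hH : ∀ h : H, ∃ n, x ^ n • h = 0) (k : ℕ) : DC x (EX H w k) := by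
  let e := LinearEquiv.ofBijective _ (shiftMap_bij x H hH)
  have he : ∀ y : EX (fs H) w k, ∀ j, cmp H w k (pre (shiftMap x H) w k y) j = cmp H w k y j - x • cmp H w k y (j + 1) := by
    intro y j
    rw [cmp_apply, ← pre_comp, cmp_apply, cmp_apply, ← pre_smul, ← pre_sub]
    congr 1
    congr 1
    ext h
    simp [shiftMap, Finsupp.lmapDomain_apply, Finsupp.mapDomain_single]
  have hb : Function.Bijective (pre (shiftMap x H) w k) := by
    constructor
    · intro a b hab
      have := congrArg (pre e.symm.toLinearMap w k) hab
      rw [← pre_comp, ← pre_comp] at this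
      have h2 : shiftMap x H ∘ₗ e.symm.toLinearMap = LinearMap.id := by
        exact LinearMap.ext fun y => e.apply_symm_apply y
      rwa [h2, pre_id, pre_id] at this
    · intro a
      refine ⟨pre e.symm.toLinearMap w k a, ?_⟩
      rw [← pre_comp]
      have h2 : e.symm.toLinearMap ∘ₗ shiftMap x H = LinearMap.id := by
        exact LinearMap.ext fun y => e.symm_apply_apply y
      rw [h2, pre_id]
  have hc := cmp_bijective H w k
  constructor
  · intro a ha
    obtain ⟨y, rfl⟩ := hc.2 a
    have : pre (shiftMap x H) w k y = 0 := by
      apply hc.1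
      ext j
      rw [he, map_zero, sub_eq_zero.2 (ha j)]; rfl
    have hy : y = 0 := hb.1 (by rw [this, map_zero])
    intro j
    rw [hy, map_zero]; rfl
  · intro b
    obtain ⟨y, rfl⟩ := hc.2 b
    obtain ⟨z, rfl⟩ := hb.2 y
    exact ⟨cmp H w k z, fun j => (he z j).symm⟩

end GC
end

section
open CategoryTheory IsLocalRing Paper TensorProduct


namespace GC

variable {R : Type u} [CommRing R]
variable {A B D A' B' D' X Y K L N w Ω P C H F F0 F1 : ModuleCat.{u} R} {Fl W : ModuleCat.{u} R → Prop}

/-- tensoring with a vector -/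
noncomputable def mkr (B F : ModuleCat.{u} R) : F →ₗ[R] (B →ₗ[R] (ModuleCat.of R (B ⊗[R] F) : ModuleCat.{u} R)) :=
  (TensorProduct.mk R B F).flip

@[simp] lemma mkr_apply (v : F) (b : B) : mkr B F v b = b ⊗ₜ v := rfl

noncomputable def tau (X B F : ModuleCat.{u} R) (n : ℕ) :
    EX X B n ⊗[R] F →ₗ[R] EX X (ModuleCat.of R (B ⊗[R] F)) n :=
  TensorProduct.lift (LinearMap.mk₂ R (fun α v => post X (mkr B F v) n α)
    (fun a b v => map_add _ a b) (fun c a v => map_smul _ c a)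
    (fun a v v' => by rw [map_add, post_add]) (fun c a v => by rw [map_smul, post_smul]))

@[simp] lemma tau_tmul (n : ℕ) (α : EX X B n) (v : F) : tau X B F n (α ⊗ₜ v) = post X (mkr B F v) n α := rfl

lemma tau_pre (f : X →ₗ[R] Y) (n : ℕ) :
    tau X B F n ∘ₗ (pre f B n).rTensor F = pre f _ n ∘ₗ tau Y B F n := by
  ext α v
  simp [pre_post]

lemma tau_dl {f : A →ₗ[R] P} {g : P →ₗ[R] D} (h : SES f g) (n : ℕ) :
    tau D B F (n + 1) ∘ₗ (h.dl B n).rTensor F = h.dl _ n ∘ₗ tau A B F n := by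
  ext α v
  simp [h.dl_post]

lemma tau_post (f : B →ₗ[R] B') (n : ℕ) :
    tau X B' F n ∘ₗ (post X f n).rTensor F =
      post X (A := ModuleCat.of R (B ⊗[R] F)) (B := ModuleCat.of R (B' ⊗[R] F)) (f.rTensor F) n ∘ₗ tau X B F n := by
  ext α v
  simp only [AlgebraTensorModule.curry_apply, LinearMap.restrictScalars_self, curry_apply, LinearMap.comp_apply,
    LinearMap.rTensor_tmul, tau_tmul]
  rw [← post_comp, ← post_comp]
  congr 1

lemma tau_map (a : F1 →ₗ[R] F0) (n : ℕ) :
    tau X B F0 n ∘ₗ a.lTensor (EX X B n) =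
      post X (A := ModuleCat.of R (B ⊗[R] F1)) (B := ModuleCat.of R (B ⊗[R] F0)) (a.lTensor B) n ∘ₗ tau X B F1 n := by
  ext α v
  simp only [AlgebraTensorModule.curry_apply, LinearMap.restrictScalars_self, curry_apply, LinearMap.comp_apply,
    LinearMap.lTensor_tmul, tau_tmul]
  rw [← post_comp]
  congr 1

lemma tau_zero_eq (z : EX X B 0 ⊗[R] F) :
    e0 X _ (tau X B F 0 z) = rTensorHomToHomRTensor (.id R) X B F ((e0 X B).toLinearMap.rTensor F z) := by
  induction z with
  | zero => simp
  | tmul α v => exact e0_post _ _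
  | add a b ha hb => simp [ha, hb]

lemma tau_free (n k : ℕ) : Function.Bijective (tau (ModuleCat.of R (Fin n → R)) B F k) := by
  cases k with
  | zero =>
    have h1 : Function.Bijective (rTensorHomToHomRTensor (.id R) (Fin n → R) B F) := by
      rw [← rTensorHomEquivHomRTensor_toLinearMap]
      exact (rTensorHomEquivHomRTensor R (Fin n → R) B F).bijective
    have h2 := (LinearEquiv.rTensor F (e0 (ModuleCat.of R (Fin n → R)) B)).bijective
    have h3 := h1.comp h2
    have h4 : (rTensorHomToHomRTensor (.id R) (Fin n → R) B F) ∘ (LinearEquiv.rTensor F (e0 (ModuleCat.of R (Fin n → R)) B))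
      = (e0 _ _) ∘ tau (ModuleCat.of R (Fin n → R)) B F 0 := by
      funext z; exact (tau_zero_eq z).symm
    rw [h4] at h3
    exact ((e0 _ _).bijective.of_comp_iff' _).1 h3
  | succ k =>
    have hP : Module.Projective R (ModuleCat.of R (Fin n → R)) := inferInstanceAs (Module.Projective R (Fin n → R))
    have h1 : ∀ z : EX (ModuleCat.of R (Fin n → R)) B (k+1) ⊗[R] F, z = 0 := by
      intro z
      induction z with
      | zero => rfl
      | tmul α v => rw [EV_of_projective hP k α, zero_tmul]
      | add a b ha hb => rw [ha, hb, add_zero]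
    refine ⟨fun a b _ => by rw [h1 a, h1 b], fun y => ⟨0, ?_⟩⟩
    rw [EV_of_projective hP k y, map_zero]

lemma pre_inj_zero {f : A →ₗ[R] P} {g : P →ₗ[R] D} (h : SES f g) (w : ModuleCat.{u} R) :
    Function.Injective (pre g w 0) := by
  rw [injective_iff_map_eq_zero]
  intro x hx
  have := congrArg (e0 _ _) hx
  rw [e0_pre, map_zero] at this
  apply (e0 _ _).injective
  rw [map_zero]
  ext d
  obtain ⟨b, rfl⟩ := h.surj d
  exact LinearMap.congr_fun this b

lemma post_inj_zero {f : A →ₗ[R] P} (h : Function.Injective f) (w : ModuleCat.{u} R) :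
    Function.Injective (post w f 0) := by
  rw [injective_iff_map_eq_zero]
  intro x hx
  have := congrArg (e0 _ _) hx
  rw [e0_post, map_zero] at this
  apply (e0 _ _).injective
  rw [map_zero]
  ext d
  exact h ((LinearMap.congr_fun this d).trans (map_zero f).symm)

lemma tau_inj_zero [IsNoetherianRing R] (X B F : ModuleCat.{u} R) [Module.Finite R X] [Module.Flat R F] :
    Function.Injective (tau X B F 0) := by
  obtain ⟨n, K, i, p, hs, hK⟩ := exists_fin_cover X
  have h1 : Function.Injective (pre p _ 0 ∘ₗ tau X B F 0) := by
    rw [← tau_pre]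
    exact (tau_free n 0).1.comp (Module.Flat.rTensor_preserves_injective_linearMap _ (pre_inj_zero hs B))
  exact Function.Injective.of_comp (f := pre p _ 0) h1

lemma tau_bij [IsNoetherianRing R] (X B F : ModuleCat.{u} R) [Module.Finite R X] [Module.Flat R F] (k : ℕ) :
    Function.Bijective (tau X B F k) := by
  induction k generalizing X with
  | zero =>
    refine ⟨tau_inj_zero X B F, ?_⟩
    obtain ⟨n, K, i, p, hs, hK⟩ := exists_fin_cover X
    exact LinearMap.surjective_of_surjective_of_injective_of_left_exact
      ((pre p B 0).rTensor F) ((pre i B 0).rTensor F) (pre p _ 0) (pre i _ 0) _ _ _ (tau_pre p 0).symm (tau_pre i 0).symm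
      (Module.Flat.rTensor_exact F (hs.dl_exact₂ B 0)) (hs.dl_exact₂ _ 0) (tau_free n 0).2 (tau_inj_zero K B F) (pre_inj_zero hs _)
  | succ k ih =>
    obtain ⟨n, K, i, p, hs, hK⟩ := exists_fin_cover X
    have hP : Module.Projective R (ModuleCat.of R (Fin n → R)) := inferInstanceAs (Module.Projective R (Fin n → R))
    have hsur : ∀ w, Function.Surjective (hs.dl w k) := fun w x =>
      (hs.dl_exact₃ w k x).1 (EV_of_projective hP k _)
    have hex : Function.Exact ((pre i B k).rTensor F) ((hs.dl B k).rTensor F) := rTensor_exact F (hs.dl_exact₁ B k) (hsur B)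
    constructor
    · exact LinearMap.injective_of_surjective_of_injective_of_right_exact
        ((pre i B k).rTensor F) ((hs.dl B k).rTensor F) (pre i _ k) (hs.dl _ k) _ _ _ (tau_pre i k).symm (tau_dl hs k).symm
        hex (hs.dl_exact₁ _ k) (tau_free n k).2 (ih K).1 (LinearMap.rTensor_surjective F (hsur B))
    · have h1 : Function.Surjective (tau X B F (k+1) ∘ₗ (hs.dl B k).rTensor F) := by
        rw [tau_dl]
        exact (hsur _).comp (ih K).2
      exact Function.Surjective.of_comp h1

end GC
end

section
open CategoryTheory IsLocalRing Paper TensorProduct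


namespace GC

variable {R : Type u} [CommRing R]
variable {A B D A' B' D' X Y K L N w Ω P C H F F0 F1 : ModuleCat.{u} R} {Fl W : ModuleCat.{u} R → Prop}

section loc
variable [IsLocalRing R]

/-- residue field as a module -/
noncomputable abbrev kk (R : Type u) [CommRing R] [IsLocalRing R] : ModuleCat.{u} R := ModuleCat.of R (R ⧸ maximalIdeal R)

lemma kk_smul (r : R) (hr : r ∈ maximalIdeal R) (n : ℕ) (x : EX (kk R) w n) : r • x = 0 := by
  have h1 : r • (LinearMap.id : kk R →ₗ[R] kk R) = 0 := by
    ext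
    simp only [LinearMap.comp_apply, LinearMap.smul_apply, LinearMap.id_apply, LinearMap.zero_apply]
    change r • (Submodule.Quotient.mk (1 : R) : R ⧸ maximalIdeal R) = 0
    rw [← Submodule.Quotient.mk_smul, Submodule.Quotient.mk_eq_zero]
    simpa using hr
  rw [← pre_id n x, ← pre_smul, h1, pre_zero]

/-- `depth ≥ i` -/
def Dep (i : ℕ) (X : ModuleCat.{u} R) : Prop := ∀ j < i, EV j (kk R) X

variable [IsNoetherianRing R]

lemma length_le_dim (M : Type u) [AddCommGroup M] [Module R M] [Module.Finite R M] (rs : List R)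
    (h : RingTheory.Sequence.IsRegular M rs) : (rs.length : WithBot ℕ∞) ≤ moduleDim R M := by
  have h1 := Module.supportDim_add_length_eq_supportDim_of_isRegular rs h
  have h2 := Module.supportDim_eq_ringKrullDim_quotient_annihilator R M
  rw [h2] at h1
  change _ = moduleDim R M at h1
  rw [← h1]
  have : Nontrivial (M ⧸ Ideal.ofList rs • (⊤ : Submodule R M)) :=
    Submodule.Quotient.nontrivial_iff.2 h.top_ne_smul.symm
  have h3 : 0 ≤ Module.supportDim R (M ⧸ Ideal.ofList rs • (⊤ : Submodule R M)) := by
    obtain ⟨x, hx⟩ := WithBot.ne_bot_iff_exists.1 ((Module.supportDim_ne_bot_iff_nontrivial R (M ⧸ Ideal.ofList rs • (⊤ : Submodule R M))).2 this)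
    rw [← hx]; exact_mod_cast zero_le
  exact le_add_of_nonneg_left h3

lemma exists_reg_of_Dep (M : ModuleCat.{u} R) [Module.Finite R M] [Nontrivial M] (n : ℕ) (h : Dep n M) :
    ∃ rs : List R, rs.length = n ∧ (∀ r ∈ rs, r ∈ maximalIdeal R) ∧ RingTheory.Sequence.IsRegular M rs := by
  refine ModuleCat.exists_isRegular_of_exists_subsingleton_ext (maximalIdeal R) n M ?_ (kk R) ?_ ?_
  · rw [lt_top_iff_ne_top]
    intro h
    exact not_subsingleton M (Submodule.subsingleton_iff R |>.1 (subsingleton_of_bot_eq_top (Submodule.eq_bot_of_eq_ideal_smul_of_le_jacobson_annihilator (Module.Finite.fg_top) h.symm (by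
      exact (IsLocalRing.maximalIdeal_le_jacobson _)) ).symm))
  · change Module.support R (R ⧸ maximalIdeal R) = _
    rw [Module.support_eq_zeroLocus, Ideal.annihilator_quotient]
  · intro i hi
    exact ⟨fun a b => by rw [h i hi a, h i hi b]⟩

lemma moduleDim_lt_top (M : Type u) [AddCommGroup M] [Module R M] : moduleDim R M < ⊤ :=
  (ringKrullDim_quotient_le _).trans_lt ringKrullDim_lt_top

lemma exists_depth (M : ModuleCat.{u} R) [Module.Finite R M] [Nontrivial M] :
    ∃ s, Dep s M ∧ ¬ EV s (kk R) M := by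
  classical
  have h1 : ∃ s, ¬ EV s (kk R) M := by
    by_contra hcon
    push Not at hcon
    have h2 : ∀ n : ℕ, (n : WithBot ℕ∞) ≤ moduleDim R M := fun n => by
      obtain ⟨rs, h, -, h'⟩ := exists_reg_of_Dep M n fun j _ => hcon j
      rw [← h]; exact length_le_dim M rs h'
    have h3 := moduleDim_lt_top (R := R) M
    generalize moduleDim R M = t at h2 h3
    induction t with
    | bot => exact absurd (h2 0) (by simp)
    | coe t =>
      induction t with
      | top => exact absurd h3 (by simp)
      | coe t => 
        have := h2 (t + 1)
        have : t + 1 ≤ t := by exact_mod_cast this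
        omega
  exact ⟨Nat.find h1, fun j hj => not_not.1 (Nat.find_min h1 hj), Nat.find_spec h1⟩

lemma Sem.nontrivial (hC : Sem C) : Nontrivial C := by
  by_contra h
  rw [not_nontrivial_iff_subsingleton] at h
  exact one_ne_zero (hC.inj 1 (fun c => Subsingleton.elim _ _))

lemma Dep.tensor {i : ℕ} (h : Dep i C) (F : ModuleCat.{u} R) [Module.Flat R F] : Dep i (ModuleCat.of R (C ⊗[R] F)) := by
  intro j hj x
  obtain ⟨z, rfl⟩ := (tau_bij (kk R) C F j).2 x
  induction z with
  | zero => simp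
  | tmul α v => rw [h j hj α, zero_tmul, map_zero]
  | add a b ha hb => rw [map_add, ha, hb, add_zero]

lemma Dep.mono {i j : ℕ} (h : Dep i X) (hij : j ≤ i) : Dep j X := fun l hl => h l (by omega)

lemma Dep.CF {s : ℕ} (h : Dep s C) (hS : ∀ F, Fl F → Module.Flat R F) (hX : CF C Fl X) : Dep s X := by
  obtain ⟨F, hF, ⟨e⟩⟩ := hX
  have := hS F hF
  intro j hj
  exact EV.of_iso_right (A := ModuleCat.of R (C ⊗[R] F)) e.symm (h.tensor F j hj)

lemma Dep.left {i s : ℕ} {f : A →ₗ[R] B} {g : B →ₗ[R] D} (h : SES f g) (hB : Dep s B) (hD : Dep i D) :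
    Dep (min s (i + 1)) A := by
  intro j hj
  cases j with
  | zero => 
    intro x
    exact post_inj_zero h.inj _ (by rw [hB 0 (by omega) (post (kk R) f 0 x), map_zero])
  | succ j => exact h.EV_left' (hD j (by omega)) (hB (j+1) (by omega))

lemma Dep.mid {i : ℕ} {f : A →ₗ[R] B} {g : B →ₗ[R] D} (h : SES f g) (hA : Dep i A) (hD : Dep i D) : Dep i B :=
  fun j hj => h.EV_mid' (hA j hj) (hD j hj)

lemma Dep.right {i : ℕ} {f : A →ₗ[R] B} {g : B →ₗ[R] D} (h : SES f g) (hA : Dep (i+1) A) (hB : Dep i B) : Dep i D :=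
  fun j hj => h.EV_right' (hB j hj) (hA (j+1) (by omega))

lemma Dep.Gp {V : ModuleCat.{u} R → Prop} {s : ℕ} (hV : ∀ v, V v → Dep s v) (hN : Gp V W N) : Dep s N := by
  suffices h : ∀ i N, GC.Gp V W N → Dep (min s i) N from (h s N hN).mono (by omega)
  intro i
  induction i with
  | zero => intro N _ j hj; omega
  | succ i ih =>
    intro N hN
    obtain ⟨v, X', f, g, hv, hs, hX⟩ := hN.step
    exact (Dep.left hs (hV v hv) (ih X' hX)).mono (by omega)

/-- depth of modules of finite dimension -/
lemma Dep.res {V : ModuleCat.{u} R → Prop} {s k : ℕ} (hV : ∀ v, V v → Dep s v) (hN : ResDimLE R (GC.Gp V W) k N) :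
    Dep (s - k) N := by
  induction k generalizing N with
  | zero => exact Dep.Gp hV hN
  | succ k ih =>
    rcases dim_succ_cases hN with hN | ⟨K, X, i, p, hs, hX, hK⟩
    · exact (ih hN).mono (by omega)
    · by_cases h : s ≤ k
      · intro j hj; omega
      · exact Dep.right hs ((ih hK).mono (by omega)) ((Dep.Gp hV hX).mono (by omega))

end loc

end GC
end

section
open CategoryTheory IsLocalRing Paper TensorProduct


namespace GC

variable {R : Type u} [CommRing R]
variable {A B D A' B' D' X Y K L N w Ω P C H F F0 F1 : ModuleCat.{u} R} {Fl W : ModuleCat.{u} R → Prop}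

/-- `F → Hom(C, C ⊗ F)` is bijective -/
lemma hom_C_bij [IsNoetherianRing R] (hC : Sem C) (F : ModuleCat.{u} R) [Module.Flat R F] :
    Function.Bijective (mkr C F) := by
  have := hC.fin
  let e1 : F ≃ₗ[R] R ⊗[R] F := (TensorProduct.lid R F).symm
  let e2 : R ⊗[R] F ≃ₗ[R] (C →ₗ[R] C) ⊗[R] F := LinearEquiv.rTensor F (homEndEquiv hC)
  let e3 : (C →ₗ[R] C) ⊗[R] F ≃ₗ[R] EX C C 0 ⊗[R] F := LinearEquiv.rTensor F (e0 C C).symm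
  let e4 := LinearEquiv.ofBijective _ (tau_bij C C F 0)
  let e5 := e0 C (ModuleCat.of R (C ⊗[R] F))
  have h : (mkr C F : F → _) = e5 ∘ e4 ∘ e3 ∘ e2 ∘ e1 := by
    funext v
    simp only [Function.comp_apply, e1, e2, e3, e4, e5, TensorProduct.lid_symm_apply, LinearEquiv.rTensor_tmul,
      LinearEquiv.ofBijective_apply, tau_tmul]
    refine Eq.trans ?_ (e0_post (N := C) (mkr C F v) ((e0 C C).symm ((homEndEquiv hC) 1))).symm
    rw [LinearEquiv.apply_symm_apply]
    have h1 : (homEndEquiv hC 1) = LinearMap.id := one_smul R (LinearMap.id : C →ₗ[R] C)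
    rw [h1]
    rfl
  rw [h]
  exact e5.bijective.comp (e4.bijective.comp (e3.bijective.comp (e2.bijective.comp e1.bijective)))

lemma exists_lTensor [IsNoetherianRing R] (hC : Sem C) (F1 F0 : ModuleCat.{u} R) [Module.Flat R F0]
    (g : C ⊗[R] F1 →ₗ[R] C ⊗[R] F0) : ∃ a : F1 →ₗ[R] F0, g = a.lTensor C := by
  let e := LinearEquiv.ofBijective _ (hom_C_bij hC F0)
  let a : F1 →ₗ[R] F0 := e.symm.toLinearMap ∘ₗ (LinearMap.llcomp R C _ _ g) ∘ₗ (mkr C F1)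
  refine ⟨a, TensorProduct.ext' fun c v => ?_⟩
  have h : e (a v) = g ∘ₗ mkr C F1 v := e.apply_symm_apply _
  exact (LinearMap.congr_fun h c).symm

section loc
variable [IsLocalRing R] 

def Star (C : ModuleCat.{u} R) (Fl W : ModuleCat.{u} R → Prop) : Prop :=
  ∀ F1 F0 : ModuleCat.{u} R, Fl F1 → Fl F0 → ∀ a : F1 →ₗ[R] F0, Function.Injective (a.lTensor (R ⧸ maximalIdeal R)) →
    ∀ w, W w → ∀ φ : C ⊗[R] F1 →ₗ[R] w,
      φ ∈ maximalIdeal R • (⊤ : Submodule R (C ⊗[R] F1 →ₗ[R] w)) ⊔ LinearMap.range (LinearMap.lcomp R w (a.lTensor C))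

variable [IsNoetherianRing R]

lemma tensor_kk_inj {s : ℕ} (hs : ¬ EV s (kk R) C) (F1 F0 : ModuleCat.{u} R) [Module.Flat R F1] [Module.Flat R F0]
    (a : F1 →ₗ[R] F0) (h : Function.Injective (post (A := ModuleCat.of R (C ⊗[R] F1))
      (B := ModuleCat.of R (C ⊗[R] F0)) (kk R) (a.lTensor C) s)) :
    Function.Injective (a.lTensor (R ⧸ maximalIdeal R)) := by
  unfold EV at hs
  push Not at hs
  obtain ⟨x, hx⟩ := hs
  let j : (R ⧸ maximalIdeal R) →ₗ[R] EX (kk R) C s :=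
    Submodule.liftQ _ (LinearMap.toSpanSingleton R _ x) (fun r hr => by
      simpa using kk_smul r hr s x)
  have hj : Function.Injective j := by
    rw [injective_iff_map_eq_zero]
    intro y hy
    obtain ⟨r, rfl⟩ := Submodule.Quotient.mk_surjective _ y
    rw [Submodule.Quotient.mk_eq_zero]
    by_contra hr
    have hu : IsUnit r := by simpa [mem_maximalIdeal] using hr
    have : r • x = 0 := hy
    exact hx (by rwa [hu.smul_eq_zero] at this)
  have h1 : Function.Injective (a.lTensor (EX (kk R) C s)) := by
    have : Function.Injective (tau (kk R) C F0 s ∘ₗ a.lTensor (EX (kk R) C s)) := by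
      rw [tau_map]
      exact h.comp (tau_bij (kk R) C F1 s).1
    exact Function.Injective.of_comp (f := tau (kk R) C F0 s) this
  have h2 : Function.Injective (j.rTensor F1) := Module.Flat.rTensor_preserves_injective_linearMap j hj
  have h3 := h1.comp h2
  have h4 : (a.lTensor (EX (kk R) C s)) ∘ₗ (j.rTensor F1) = (j.rTensor F0) ∘ₗ (a.lTensor (R ⧸ maximalIdeal R)) := by
    rw [LinearMap.lTensor_comp_rTensor, LinearMap.rTensor_comp_lTensor]
  rw [← LinearMap.coe_comp, h4, LinearMap.coe_comp] at h3
  exact Function.Injective.of_comp h3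

lemma syz_depth {s : ℕ} (hR : Resolving (Gp W W)) (hV : ∀ v, W v → Dep s v) (j i : ℕ) (X : ModuleCat.{u} R)
    (hX : Dep i X) (hd : ResDimLE R (Gp W W) (j + 1) X) :
    ∃ L, Dep (min s (i + j)) L ∧ ResDimLE R (Gp W W) 1 L ∧
      ∀ w, ∃ ψ : EX L w 1 →ₗ[R] EX X w (j + 1), Function.Surjective ψ := by
  induction j generalizing i X with
  | zero => exact ⟨X, hX.mono (by omega), hd, fun w => ⟨LinearMap.id, fun x => ⟨x, rfl⟩⟩⟩
  | succ j ih =>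
    obtain ⟨P, K, f, g, hP, hs⟩ := exists_proj_cover X
    obtain ⟨L, h1, h2, h3⟩ := ih (min s (i + 1)) K (Dep.left hs (Dep.Gp hV (hR.proj hP)) hX) (hR.dim_syz hs hP hd)
    refine ⟨L, h1.mono (by omega), h2, fun w => ?_⟩
    obtain ⟨ψ, hψ⟩ := h3 w
    refine ⟨hs.dl w (j+1) ∘ₗ ψ, ?_⟩
    have h4 : Function.Surjective (hs.dl w (j+1)) := fun x =>
      (hs.dl_exact₃ w (j+1) x).1 (EV_of_projective hP (j+1) _)
    exact h4.comp hψ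

lemma ext_one_eq_m {s : ℕ} (hS : Setting C Fl W) (hC : Sem C) (hW : Good W) (hWC : ∀ w, W w → CF C Fl w)
    (hst : Star C Fl W) (hd : Dep s C) (hs : ¬ EV s (kk R) C) (hL : Dep s L)
    (h1 : ResDimLE R (Gp W W) 1 L) (hw : W w) :
    (⊤ : Submodule R (EX L w 1)) ≤ maximalIdeal R • ⊤ := by
  rcases dim_succ_cases h1 with hN | ⟨G1, G0, i, p, hses, hG0, hG1⟩
  · intro x _
    rw [Gp.EV hN 0 hw x]; exact zero_mem _
  obtain ⟨W1, G1', f1, g1, hW1, hf1, hG1'⟩ := Gp.step hG1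
  obtain ⟨U, i1, p1, j1, q1, hA, hB, -⟩ := pushout_ses hses hf1
  have hU : Gp W W U := hW.ext hB hG0 hG1'
  obtain ⟨W0, U', f0, g0, hW0, hf0, hU'⟩ := hU.step
  obtain ⟨Q, p2, i2, q2, hE, hF⟩ := comp_inj_ses hA hf0
  have hQ : Dep s Q := Dep.mid hF hL (Dep.Gp (fun v hv => hd.CF hS.flat (hWC v hv)) hU')
  obtain ⟨F1, hF1, ⟨e1⟩⟩ := hWC _ hW1
  obtain ⟨F0, hF0, ⟨e0'⟩⟩ := hWC _ hW0
  have := hS.flat _ hF1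
  have := hS.flat _ hF0
  obtain ⟨a, ha⟩ := exists_lTensor hC F1 F0 (e0'.toLinearMap ∘ₗ (f0 ∘ₗ i1) ∘ₗ e1.symm.toLinearMap)
  have hpost : Function.Injective (post (kk R) (f0 ∘ₗ i1) s) := by
    cases s with
    | zero => exact post_inj_zero hE.inj _
    | succ s =>
      rw [injective_iff_map_eq_zero]
      intro x hx
      obtain ⟨y, rfl⟩ := (hE.dr_exact₁ _ s x).1 hx
      rw [hQ s (by omega) y, map_zero]
  have hinj : Function.Injective (post (A := ModuleCat.of R (C ⊗[R] F1))
      (B := ModuleCat.of R (C ⊗[R] F0)) (kk R) (a.lTensor C) s) := by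
    rw [injective_iff_map_eq_zero]
    intro x hx
    rw [← ha] at hx
    have h3 := post_comp (A := ModuleCat.of R (C ⊗[R] F1)) (B := W1) (D := ModuleCat.of R (C ⊗[R] F0))
      (N := kk R) e1.symm.toLinearMap (e0'.toLinearMap ∘ₗ (f0 ∘ₗ i1)) s x
    have h4 := post_comp (A := W1) (B := W0) (D := ModuleCat.of R (C ⊗[R] F0)) (N := kk R) (f0 ∘ₗ i1) e0'.toLinearMap s
      (post (A := ModuleCat.of R (C ⊗[R] F1)) (B := W1) (kk R) e1.symm.toLinearMap s x)
    rw [h4] at h3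
    replace h3 := h3.symm.trans hx
    have h5 := post_comp (A := W0) (B := ModuleCat.of R (C ⊗[R] F0)) (D := W0) (N := kk R) e0'.toLinearMap e0'.symm.toLinearMap s
      (post (kk R) (f0 ∘ₗ i1) s (post (A := ModuleCat.of R (C ⊗[R] F1)) (B := W1) (kk R) e1.symm.toLinearMap s x))
    rw [h3, map_zero, show e0'.symm.toLinearMap ∘ₗ e0'.toLinearMap = LinearMap.id from
      LinearMap.ext fun y => e0'.symm_apply_apply y, post_id] at h5
    have h6 := hpost (h5.trans (map_zero _).symm)
    have h7 := post_comp (A := ModuleCat.of R (C ⊗[R] F1)) (B := W1) (D := ModuleCat.of R (C ⊗[R] F1)) (N := kk R)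
      e1.symm.toLinearMap e1.toLinearMap s x
    rw [h6, map_zero, show e1.toLinearMap ∘ₗ e1.symm.toLinearMap = LinearMap.id from
      LinearMap.ext fun y => e1.apply_symm_apply y] at h7
    exact (post_id s x).symm.trans h7
  have hk := tensor_kk_inj hs F1 F0 a hinj
  let Θ : (C ⊗[R] F1 →ₗ[R] w) →ₗ[R] EX L w 1 :=
    hA.dl w 0 ∘ₗ (e0 W1 w).symm.toLinearMap ∘ₗ LinearMap.lcomp R w e1.toLinearMap
  have hΘ : Function.Surjective Θ := by
    intro x
    obtain ⟨y, rfl⟩ := (hA.dl_exact₃ w 0 x).1 (hU.EV 0 hw _)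
    refine ⟨e0 W1 w y ∘ₗ e1.symm.toLinearMap, ?_⟩
    change hA.dl w 0 ((e0 W1 w).symm ((e0 W1 w y ∘ₗ e1.symm.toLinearMap) ∘ₗ e1.toLinearMap)) = _
    rw [LinearMap.comp_assoc, show e1.symm.toLinearMap ∘ₗ e1.toLinearMap = LinearMap.id from
      LinearMap.ext fun y => e1.symm_apply_apply y, LinearMap.comp_id, LinearEquiv.symm_apply_apply]
  have hle : (⊤ : Submodule R (C ⊗[R] F1 →ₗ[R] w)) ≤ maximalIdeal R • ⊤ ⊔ LinearMap.range (LinearMap.lcomp R w (a.lTensor C)) :=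
    fun φ _ => hst F1 F0 hF1 hF0 a hk w hw φ
  have h8 := Submodule.map_mono (f := Θ) hle
  rw [Submodule.map_top, LinearMap.range_eq_top.2 hΘ, Submodule.map_sup, Submodule.map_smul'', Submodule.map_top,
    LinearMap.range_eq_top.2 hΘ] at h8
  refine h8.trans (sup_le le_rfl ?_)
  rintro _ ⟨_, ⟨h, rfl⟩, rfl⟩
  have h9 : Θ (LinearMap.lcomp R w (a.lTensor C) h) = 0 := by
    change hA.dl w 0 ((e0 W1 w).symm ((h ∘ₗ a.lTensor C) ∘ₗ e1.toLinearMap)) = 0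
    have h10 : (h ∘ₗ a.lTensor C) ∘ₗ e1.toLinearMap = (h ∘ₗ e0'.toLinearMap ∘ₗ f0) ∘ₗ i1 := by
      rw [← ha]
      ext y
      simp
    rw [h10, ← LinearEquiv.apply_symm_apply (e0 U w) (h ∘ₗ e0'.toLinearMap ∘ₗ f0), ← e0_pre, LinearEquiv.symm_apply_apply]
    exact (hA.dl_exact₁ w 0 _).2 ⟨_, rfl⟩
  rw [h9]; exact zero_mem _

/-- the bound -/
lemma bound {s k : ℕ} (hS : Setting C Fl W) (hC : Sem C) (hW : Good W) (hR : Resolving (Gp W W))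
    (hWC : ∀ w, W w → CF C Fl w)
    (hst : Star C Fl W) (hd : Dep s C) (hs : ¬ EV s (kk R) C) (hH : ∀ r ∈ maximalIdeal R, ∀ h : H, ∃ n, r ^ n • h = 0)
    (h1 : ResDimLE R (Gp W W) (k + 1) H) (hk : s ≤ k) : ResDimLE R (Gp W W) k H := by
  refine hW.dim_drop hR h1 fun w hw => ?_
  obtain ⟨L, hL, hL1, hψ⟩ := syz_depth hR (fun v hv => hd.CF hS.flat (hWC v hv)) k 0 H (fun j hj => by omega) h1
  obtain ⟨ψ, hψ⟩ := hψ w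
  have h2 := ext_one_eq_m hS hC hW hWC hst hd hs (hL.mono (by omega)) hL1 hw
  have h3 := Submodule.map_mono (f := ψ) h2
  rw [Submodule.map_top, LinearMap.range_eq_top.2 hψ, Submodule.map_smul'', Submodule.map_top,
    LinearMap.range_eq_top.2 hψ] at h3
  obtain ⟨S, hS'⟩ := IsNoetherian.noetherian (maximalIdeal R)
  have h4 : Ideal.ofList S.toList = maximalIdeal R := by
    rw [← hS']
    exact congrArg Ideal.span (Set.ext fun x => Finset.mem_toList)
  exact DC.eq_zero S.toList (fun x hx => ext_DC x H w (hH x (h4 ▸ Ideal.subset_span hx)) (k + 1)) (h4.symm ▸ h3)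

lemma bound' {s k : ℕ} (hS : Setting C Fl W) (hC : Sem C) (hW : Good W) (hR : Resolving (Gp W W))
    (hWC : ∀ w, W w → CF C Fl w)
    (hst : Star C Fl W) (hd : Dep s C) (hs : ¬ EV s (kk R) C) (hH : ∀ r ∈ maximalIdeal R, ∀ h : H, ∃ n, r ^ n • h = 0)
    (h1 : ResDimLE R (Gp W W) k H) : ResDimLE R (Gp W W) s H := by
  by_cases hk : k ≤ s
  · exact ResDimLE.mono h1 hk
  · obtain ⟨d, rfl⟩ := Nat.exists_eq_add_of_lt (not_le.1 hk)
    clear hk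
    induction d with
    | zero => exact bound hS hC hW hR hWC hst hd hs hH h1 le_rfl
    | succ d ih => exact ih (bound hS hC hW hR hWC hst hd hs hH h1 (by omega))

end loc

end GC
end

section
open CategoryTheory IsLocalRing Paper TensorProduct
namespace GC
variable {R : Type u} [CommRing R]
variable {A B D A' B' D' X Y K L N w Ω P C H F F0 F1 : ModuleCat.{u} R} {Fl W : ModuleCat.{u} R → Prop}

lemma inj_factor (hA : Module.Injective R A) (f : X →ₗ[R] Y) (g : X →ₗ[R] A)
    (h : LinearMap.ker f ≤ LinearMap.ker g) : ∃ l : Y →ₗ[R] A, l ∘ₗ f = g := by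
  obtain ⟨g', hg'⟩ := exists_desc (A := X) (B := ModuleCat.of R (LinearMap.range f)) (D := A) f.rangeRestrict
    f.surjective_rangeRestrict g (fun x hx => h (by
      have := congrArg Subtype.val hx
      simpa using this))
  obtain ⟨l, hl⟩ := hA.out (LinearMap.range f).subtype Subtype.val_injective g'
  refine ⟨l, ?_⟩
  ext x
  have := hl (f.rangeRestrict x)
  rw [hg'] at this
  exact this

section loc
variable [IsLocalRing R]

lemma ext_res (a : F1 →ₗ[R] F0) (ha : Function.Injective (a.lTensor (R ⧸ maximalIdeal R)))
    {T : Type u} [AddCommGroup T] [Module R T] (hT : ∀ r ∈ maximalIdeal R, ∀ t : T, r • t = 0) (g : F1 →ₗ[R] T) :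
    ∃ l : F0 →ₗ[R] T, ∀ x, l (a x) = g x := by
  let _ : Field (R ⧸ maximalIdeal R) := Ideal.Quotient.field _
  obtain ⟨ρ, hρ⟩ := LinearMap.exists_leftInverse_of_injective (a.baseChange (R ⧸ maximalIdeal R))
    (LinearMap.ker_eq_bot.2 ha)
  let q : (R ⧸ maximalIdeal R) →ₗ[R] F1 →ₗ[R] T := Submodule.liftQ _ (LinearMap.toSpanSingleton R _ g) (fun r hr => by
    ext x; simpa using hT r hr (g x))
  refine ⟨TensorProduct.lift q ∘ₗ (ρ.restrictScalars R) ∘ₗ TensorProduct.mk R (R ⧸ maximalIdeal R) F0 1, fun x => ?_⟩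
  have h1 := LinearMap.congr_fun hρ ((1 : R ⧸ maximalIdeal R) ⊗ₜ[R] x)
  simp only [LinearMap.comp_apply, LinearMap.baseChange_tmul, LinearMap.id_apply] at h1
  simp only [LinearMap.comp_apply, TensorProduct.mk_apply, LinearMap.restrictScalars_apply, h1, TensorProduct.lift.tmul]
  have h2 : q 1 = (1 : R) • g := rfl
  rw [h2, one_smul]

lemma star_core (Q : ModuleCat.{u} R) {T : Type u} [AddCommGroup T] [Module R T]
    (hT : ∀ r ∈ maximalIdeal R, ∀ t : T, r • t = 0) (π : Q →ₗ[R] T)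
    (a : F1 →ₗ[R] F0) (ha : Function.Injective (a.lTensor (R ⧸ maximalIdeal R)))
    (h0 : ∀ l : F0 →ₗ[R] T, ∃ l' : F0 →ₗ[R] Q, π ∘ₗ l' = l)
    (h1 : ∀ c : F1 →ₗ[R] Q, π ∘ₗ c = 0 → c ∈ maximalIdeal R • (⊤ : Submodule R (F1 →ₗ[R] Q)))
    (b : F1 →ₗ[R] Q) : b ∈ maximalIdeal R • (⊤ : Submodule R (F1 →ₗ[R] Q)) ⊔ LinearMap.range (LinearMap.lcomp R Q a) := by
  obtain ⟨l, hl⟩ := ext_res a ha hT (π ∘ₗ b)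
  obtain ⟨l', rfl⟩ := h0 l
  have h2 := h1 (b - l' ∘ₗ a) (by ext x; simpa [sub_eq_zero] using (hl x).symm)
  have : b = (b - l' ∘ₗ a) + LinearMap.lcomp R Q a l' := by ext x; simp
  rw [this]
  exact Submodule.add_mem_sup h2 ⟨l', rfl⟩

lemma star_of [IsNoetherianRing R] (hC : Sem C) (hQ : Module.Flat R Y) (e : w ≃ₗ[R] C ⊗[R] Y)
    (a : F1 →ₗ[R] F0)
    (h : ∀ b : F1 →ₗ[R] Y, b ∈ maximalIdeal R • (⊤ : Submodule R (F1 →ₗ[R] Y)) ⊔ LinearMap.range (LinearMap.lcomp R Y a))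
    (φ : C ⊗[R] F1 →ₗ[R] w) : φ ∈ maximalIdeal R • (⊤ : Submodule R (C ⊗[R] F1 →ₗ[R] w)) ⊔
      LinearMap.range (LinearMap.lcomp R w (a.lTensor C)) := by
  obtain ⟨b, hb⟩ := exists_lTensor hC F1 Y (e.toLinearMap ∘ₗ φ)
  let θ : (F1 →ₗ[R] Y) →ₗ[R] (C ⊗[R] F1 →ₗ[R] w) :=
    LinearMap.llcomp R _ _ _ e.symm.toLinearMap ∘ₗ LinearMap.lTensorHom C
  have hθ : φ = θ b := by
    ext c x
    have := LinearMap.congr_fun hb (c ⊗ₜ x)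
    apply e.injective
    simp only [LinearMap.comp_apply, LinearEquiv.coe_coe] at this
    simp [θ, this]
  have h2 := Submodule.mem_map_of_mem (f := θ) (h b)
  rw [← hθ, Submodule.map_sup] at h2
  refine SetLike.le_def.1 (sup_le_sup ?_ ?_) h2
  · rw [Submodule.map_smul'']
    exact Submodule.smul_mono le_rfl le_top
  · rintro _ ⟨_, ⟨l, rfl⟩, rfl⟩
    refine ⟨e.symm.toLinearMap ∘ₗ l.lTensor C, ?_⟩
    ext c x
    simp [θ]

lemma star_p [IsNoetherianRing R] (hC : Sem C) : Star C Fp (Wp C) := by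
  intro F1 F0 hF1 hF0 a ha w ⟨Q, hQ, ⟨e⟩⟩
  have hF1 : Module.Projective R F1 := hF1
  have hF0 : Module.Projective R F0 := hF0
  refine star_of hC inferInstance e a ?_
  refine star_core Q (T := Q ⧸ maximalIdeal R • (⊤ : Submodule R Q)) ?_ (Submodule.mkQ _) a ha ?_ ?_
  · intro r hr t
    obtain ⟨t, rfl⟩ := Submodule.Quotient.mk_surjective _ t
    rw [← Submodule.Quotient.mk_smul, Submodule.Quotient.mk_eq_zero]
    exact Submodule.smul_mem_smul hr trivial
  · intro l
    exact Module.projective_lifting_property _ l (Submodule.mkQ_surjective _)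
  · intro c hc
    obtain ⟨S, hS⟩ := IsNoetherian.noetherian (maximalIdeal R)
    let p : (S → Q) →ₗ[R] Q := ∑ s : S, (s : R) • LinearMap.proj s
    have hp : ∀ q, p q = ∑ s : S, (s : R) • q s := fun q => by simp [p]
    have hr : LinearMap.range c ≤ LinearMap.range p := by
      have h1 : maximalIdeal R • (⊤ : Submodule R Q) ≤ LinearMap.range p := by
        conv_lhs => rw [← hS]
        rw [Submodule.span_smul_eq, Submodule.set_smul_le_iff]
        intro r x hr hx
        classical
        refine ⟨Pi.single ⟨r, hr⟩ x, ?_⟩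
        rw [hp, Finset.sum_eq_single ⟨r, hr⟩]
        · simp
        · intro b _ hb
          rw [Pi.single_eq_of_ne hb, smul_zero]
        · simp
      refine le_trans ?_ h1
      rintro _ ⟨x, rfl⟩
      have := LinearMap.congr_fun hc x
      simpa using this
    obtain ⟨l, hl⟩ := Module.projective_lifting_property p.rangeRestrict
      (c.codRestrict (LinearMap.range p) fun x => hr ⟨x, rfl⟩) p.surjective_rangeRestrict
    have : c = ∑ s : S, (s : R) • (LinearMap.proj s ∘ₗ l) := by
      ext x
      have := congrArg Subtype.val (LinearMap.congr_fun hl x)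
      simp only [LinearMap.comp_apply, LinearMap.codRestrict_apply] at this
      rw [← this]
      refine (hp _).trans ?_
      simp
    rw [this]
    exact Submodule.sum_mem _ fun s _ => Submodule.smul_mem_smul (hS ▸ Submodule.subset_span s.2) trivial

lemma star_f [IsNoetherianRing R] (hC : Sem C) : Star C Ff (Wf C) := by
  intro F1 F0 hF1 hF0 a ha w ⟨I, hI, ⟨e⟩⟩
  have hF1 : Module.Flat R F1 := hF1
  have hF0 : Module.Flat R F0 := hF0
  have := hC.fin
  have hQ : Module.Flat R (I →ₗ[R] EE R) := by
    have := flat_char I hI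
    exact Module.Flat.of_linearEquiv (charEquiv I)
  refine star_of (Y := ModuleCat.of R (I →ₗ[R] EE R)) hC hQ
    (e.trans ((charEquiv _).symm.trans (LinearEquiv.ofBijective _ (te_bij (Ω := C) (B := I) EE_injective)).symm)) a ?_
  let S : Submodule R I :=
    { carrier := {x | ∀ r ∈ maximalIdeal R, r • x = 0}
      add_mem' := fun {x y} hx hy r hr => by rw [smul_add, hx r hr, hy r hr, add_zero]
      zero_mem' := fun r _ => smul_zero r
      smul_mem' := fun c x hx r hr => by rw [smul_comm, hx r hr, smul_zero] }
  refine star_core (ModuleCat.of R (I →ₗ[R] EE R)) (T := S →ₗ[R] EE R) ?_ (LinearMap.lcomp R _ S.subtype) a ha ?_ ?_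
  · intro r hr t
    ext x
    have : r • x = 0 := Subtype.ext (x.2 r hr)
    rw [LinearMap.smul_apply, ← map_smul, this, map_zero, LinearMap.zero_apply]
  · intro l
    obtain ⟨l', hl'⟩ := EE_injective.out (S.subtype.lTensor F0)
      (Module.Flat.lTensor_preserves_injective_linearMap _ Subtype.val_injective) (TensorProduct.lift l)
    refine ⟨TensorProduct.curry l', ?_⟩
    refine LinearMap.ext fun x => LinearMap.ext fun y => ?_
    have := hl' (x ⊗ₜ y)
    simpa using this
  · intro c hc
    obtain ⟨G, hG⟩ := IsNoetherian.noetherian (maximalIdeal R)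
    let μ : I →ₗ[R] (G → I) := LinearMap.pi fun s => (s : R) • LinearMap.id
    have hμ : Function.Exact S.subtype μ := by
      intro x
      simp only [Submodule.coe_subtype, Subtype.range_coe_subtype, Set.mem_ofPred_eq]
      constructor
      · intro hx r hr
        rw [← hG] at hr
        induction hr using Submodule.span_induction with
        | mem r hr => exact congrFun hx ⟨r, hr⟩
        | zero => simp
        | add r s _ _ hr hs => rw [add_smul, hr, hs, add_zero]
        | smul r s _ hs => rw [smul_assoc, hs, smul_zero]
      · intro hx
        funext s
        exact hx s (hG ▸ Submodule.subset_span s.2)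
    have hμ' := Module.Flat.lTensor_exact F1 hμ
    obtain ⟨l, hl⟩ := inj_factor (A := ModuleCat.of R (EE R)) (X := ModuleCat.of R (F1 ⊗[R] I))
      (Y := ModuleCat.of R (F1 ⊗[R] (G → I)))
      EE_injective (μ.lTensor F1) (TensorProduct.lift c) (by
        intro x hx
        obtain ⟨y, rfl⟩ := (hμ' x).1 hx
        have h0 : TensorProduct.lift c ∘ₗ S.subtype.lTensor F1 = 0 := by
          refine TensorProduct.ext' fun x y => ?_
          exact LinearMap.congr_fun (LinearMap.congr_fun hc x) y
        exact LinearMap.congr_fun h0 y)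
    classical
    let cs : G → (F1 →ₗ[R] (I →ₗ[R] EE R)) := fun s =>
      (LinearMap.lcomp R _ (LinearMap.single R (fun _ : G => I) s)) ∘ₗ TensorProduct.curry l
    have : c = ∑ s : G, (s : R) • cs s := by
      refine LinearMap.ext fun x => LinearMap.ext fun y => ?_
      have := LinearMap.congr_fun hl (x ⊗ₜ y)
      have h2 : μ y = ∑ s : G, (s : R) • (Pi.single s y : G → I) := by
        rw [← Finset.univ_sum_single (μ y)]
        refine Finset.sum_congr rfl fun s _ => ?_
        exact Pi.single_smul (f := fun _ : G => (I : Type u)) s (s : R) y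
      simp only [LinearMap.comp_apply, LinearMap.lTensor_tmul, TensorProduct.lift.tmul, h2, TensorProduct.tmul_sum, map_sum,
        TensorProduct.tmul_smul, map_smul] at this
      rw [LinearMap.sum_apply, LinearMap.sum_apply]
      exact this.symm
    rw [this]
    exact Submodule.sum_mem _ fun s _ => Submodule.smul_mem_smul (hG ▸ Submodule.subset_span s.2) trivial

end loc
end GC
end

section
open CategoryTheory IsLocalRing Paper TensorProduct
namespace GC
variable {R : Type u} [CommRing R]
variable {A B D A' B' D' X Y K L N w Ω P C H F F0 F1 : ModuleCat.{u} R} {Fl W : ModuleCat.{u} R → Prop}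

section loc
variable [IsLocalRing R] [IsNoetherianRing R]

lemma CM_iff (M : Type u) [AddCommGroup M] [Module R M] [Module.Finite R M] (d : ℕ)
    (hdim : moduleDim R M = (d : WithBot ℕ∞)) : IsCohenMacaulayModule R M ↔
    ∃ rs : List R, rs.length = d ∧ (∀ r ∈ rs, r ∈ maximalIdeal R) ∧ RingTheory.Sequence.IsRegular M rs := by
  unfold IsCohenMacaulayModule
  rw [hdim]
  have hle : ∀ n ∈ {n : ℕ∞ | ∃ rs : List R, (rs.length : ℕ∞) = n ∧ (∀ x ∈ rs, x ∈ maximalIdeal R) ∧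
    RingTheory.Sequence.IsRegular M rs}, n ≤ d := by
    rintro n ⟨rs, rfl, -, h⟩
    have := length_le_dim M rs h
    rw [hdim] at this
    exact_mod_cast this
  constructor
  · intro h
    have h : depth R M = d := by exact_mod_cast h
    by_contra hcon
    have h2 : depth R M ≠ 0 ∨ d = 0 := by
      by_cases hd : d = 0
      · exact Or.inr hd
      · left; rw [h]; exact_mod_cast hd
    by_cases hne : {n : ℕ∞ | ∃ rs : List R, (rs.length : ℕ∞) = n ∧ (∀ x ∈ rs, x ∈ maximalIdeal R) ∧
        RingTheory.Sequence.IsRegular M rs}.Nonempty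
    · have := hne.to_subtype
      obtain ⟨rs, h3, h4, h5⟩ := ENat.sSup_mem_of_nonempty_of_lt_top (by
        change depth R M < ⊤
        rw [h]; exact ENat.coe_lt_top d)
      change _ = depth R M at h3
      rw [h] at h3
      exact hcon ⟨rs, by exact_mod_cast h3, h4, h5⟩
    · rw [Set.not_nonempty_iff_eq_empty] at hne
      have h3 : depth R M = 0 := by unfold depth; rw [hne, sSup_empty]; rfl
      rw [h3] at h
      have hd : d = 0 := by exact_mod_cast h.symm
      subst hd
      apply hcon
      have : Nontrivial M := by
        by_contra hM
        rw [not_nontrivial_iff_subsingleton] at hM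
        have : Module.annihilator R M = ⊤ := Module.annihilator_eq_top_iff.2 hM
        unfold moduleDim at hdim
        have h5 : Subsingleton (R ⧸ Module.annihilator R M) := Ideal.Quotient.subsingleton_iff.2 this
        rw [ringKrullDim_eq_bot_of_subsingleton] at hdim
        simp at hdim
      exact ⟨[], rfl, by simp, RingTheory.Sequence.IsRegular.nil R M⟩
  · rintro ⟨rs, h1, h2, h3⟩
    have : depth R M = d := by
      apply le_antisymm
      · exact sSup_le hle
      · exact le_sSup ⟨rs, by exact_mod_cast h1, h2, h3⟩
    rw [this]
    rfl

lemma cm_of_dim (M : Type u) [AddCommGroup M] [Module R M] [Module.Finite R M] [Nontrivial M] (d g k : ℕ)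
    (hdim : moduleDim R M = (d : WithBot ℕ∞)) (hC : Sem C) (hM : ResDimLE R (GP C) g (ModuleCat.of R M))
    (hS : Setting C Fl W) (hW : Good W) (hR : Resolving (Gp W W))
    (hWC : ∀ w, W w → CF C Fl w) (hst : Star C Fl W)
    (hk : ResDimLE R (Gp W W) k (lcoh R (maximalIdeal R) d M))
    (hmin : ∀ j, ResDimLE R (Gp W W) j (lcoh R (maximalIdeal R) d M) → g + d ≤ j) : IsCohenMacaulayModule R M := by
  rw [CM_iff M d hdim]
  have := hC.fin
  have := hC.nontrivial
  obtain ⟨s, hs1, hs2⟩ := exists_depth C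
  have h1 := hmin s (bound' hS hC hW hR hWC hst hs1 hs2 (fun r hr h => lcoh_torsion _ d M h r hr) hk)
  have h2 : Dep (s - g) (ModuleCat.of R M) :=
    Dep.res (fun v hv => hs1.CF (setting_p C).flat hv) hM
  exact exists_reg_of_Dep (ModuleCat.of R M) d (h2.mono (by omega))

end loc
end GC
end

section
open CategoryTheory IsLocalRing Paper TensorProduct
namespace GC
variable {R : Type u} [CommRing R]
variable {A B D A' B' D' X Y K L N w Ω P C H F F0 F1 : ModuleCat.{u} R} {Fl W : ModuleCat.{u} R → Prop}

lemma exists_loc (N : ModuleCat.{u} R) (y : R) (hy : IsSMulRegular N y) :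
    ∃ (L : ModuleCat.{u} R) (f : N →ₗ[R] L) (e : L ≃ₗ[R] L), Function.Injective f ∧ (∀ l, e l = y • l) ∧
      ∀ l, ∃ (j : ℕ) (n : N), y ^ j • l = f n := by
  let f := LocalizedModule.mkLinearMap (Submonoid.powers y) N
  have hb : Function.Bijective (LinearMap.lsmul R (LocalizedModule (Submonoid.powers y) N) y) := by
    have := IsLocalizedModule.map_units f (⟨y, Submonoid.mem_powers y⟩ : Submonoid.powers y)
    exact (Module.End.isUnit_iff _).1 this
  refine ⟨ModuleCat.of R (LocalizedModule (Submonoid.powers y) N), f, LinearEquiv.ofBijective _ hb, ?_, fun l => rfl, ?_⟩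
  · rw [injective_iff_map_eq_zero]
    intro n hn
    obtain ⟨⟨_, j, rfl⟩, hc⟩ := (IsLocalizedModule.eq_zero_iff (Submonoid.powers y) f).1 hn
    exact (hy.pow j) (hc.trans (smul_zero (y ^ j)).symm)
  · intro l
    obtain ⟨⟨n, ⟨_, j, rfl⟩⟩, h⟩ := IsLocalizedModule.surj (Submonoid.powers y) f l
    exact ⟨j, n, h⟩

noncomputable def TT (N : ModuleCat.{u} R) (y : R) : fs N →ₗ[R] fs N :=
  y • (LinearMap.id : (ℕ →₀ N) →ₗ[R] (ℕ →₀ N)) - Finsupp.lcomapDomain Nat.succ Nat.succ_injective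

lemma TT_apply (y : R) (x : ℕ →₀ N) (j : ℕ) : (TT N y x : ℕ →₀ N) j = y • x j - x (j + 1) := rfl

lemma TT_zero (y : R) (n : N) : TT N y (Finsupp.single 0 n) = Finsupp.single 0 (y • n) := by
  refine Finsupp.ext fun j => ?_
  rw [TT_apply]
  cases j <;> simp [Finsupp.single_apply]

lemma TT_succ (y : R) (i : ℕ) (n : N) :
    TT N y (Finsupp.single (i + 1) n) = (Finsupp.single (i + 1) (y • n) - Finsupp.single i n : ℕ →₀ N) := by
  refine Finsupp.ext fun j => ?_
  rw [TT_apply]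
  simp [Finsupp.single_apply]

lemma TT_inj (y : R) (hy : IsSMulRegular N y) : Function.Injective (TT N y) := by
  rw [injective_iff_map_eq_zero]
  intro x hx
  change ℕ →₀ N at x
  have h1 : ∀ j, x (j + 1) = y • x j := fun j => by
    have : (TT N y x : ℕ →₀ N) j = 0 := by rw [hx]; rfl
    rw [TT_apply, sub_eq_zero] at this
    exact this.symm
  have h2 : ∀ j, x j = y ^ j • x 0 := fun j => by
    induction j with
    | zero => simp
    | succ j ih => rw [h1, ih, smul_smul, pow_succ']
  obtain ⟨J, hJ⟩ := x.support.exists_notMem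
  rw [Finsupp.notMem_support_iff, h2] at hJ
  have h0 : x 0 = 0 := (hy.pow J) (hJ.trans (smul_zero (y ^ J)).symm)
  refine Finsupp.ext fun j => ?_
  rw [h2, h0, smul_zero]; rfl

lemma sub_sub_sub_comm' {G : Type*} [AddCommGroup G] (a b c : G) : a - b - (c - b) = a - c := by abel

lemma sub_sub_sub_add' {G : Type*} [AddCommGroup G] (a b c : G) : a - b - (c - b) + c = a := by abel

lemma TT_single (y : R) (i k : ℕ) (n : N) :
    ∃ z, TT N y z = (Finsupp.single i n - Finsupp.single (i + k) (y ^ k • n) : ℕ →₀ N) := by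
  induction k with
  | zero => exact ⟨0, by simp⟩
  | succ k ih =>
    obtain ⟨z, hz⟩ := ih
    refine ⟨z - (Finsupp.single (i + k + 1) (y ^ k • n) : ℕ →₀ N), ?_⟩
    rw [map_sub, hz, TT_succ, smul_smul, ← pow_succ']
    exact sub_sub_sub_comm' _ _ _

lemma TT_red (y : R) (x : ℕ →₀ N) : ∃ J0, ∀ J ≥ J0, ∃ n z, TT N y z = (x - Finsupp.single J n : ℕ →₀ N) := by
  induction x using Finsupp.induction_linear with
  | zero => exact ⟨0, fun J _ => ⟨0, 0, by simp⟩⟩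
  | add a b ha hb =>
    obtain ⟨J1, h1⟩ := ha
    obtain ⟨J2, h2⟩ := hb
    refine ⟨max J1 J2, fun J hJ => ?_⟩
    obtain ⟨n1, z1, h1⟩ := h1 J (le_trans (le_max_left _ _) hJ)
    obtain ⟨n2, z2, h2⟩ := h2 J (le_trans (le_max_right _ _) hJ)
    refine ⟨n1 + n2, z1 + z2, ?_⟩
    rw [map_add, h1, h2, Finsupp.single_add]
    exact (add_sub_add_comm _ _ _ _).symm
  | single i n =>
    refine ⟨i, fun J hJ => ?_⟩
    obtain ⟨k, rfl⟩ := Nat.exists_eq_add_of_le hJ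
    exact ⟨_, TT_single y i k n⟩

lemma exists_step (N : ModuleCat.{u} R) (y : R) (hy : IsSMulRegular N y) :
    ∃ (L Q : ModuleCat.{u} R) (f : N →ₗ[R] L) (g : L →ₗ[R] Q) (e : L ≃ₗ[R] L) (q : fs N →ₗ[R] Q)
      (i : QuotSMulTop y N →ₗ[R] Q), SES f g ∧ (∀ l, e l = y • l) ∧ SES (TT N y) q ∧
      SES (A := ModuleCat.of R (QuotSMulTop y N)) i (y • LinearMap.id : Q →ₗ[R] Q) ∧ ∀ x : Q, ∃ n : ℕ, y ^ n • x = 0 := by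
  obtain ⟨L, f, e, hf, he, hL⟩ := exists_loc N y hy
  have hes : ∀ l, y • e.symm l = l := fun l => by rw [← he, e.apply_symm_apply]
  have hes' : ∀ l, e.symm (y • l) = l := fun l => by rw [← he, e.symm_apply_apply]
  let Q := ModuleCat.of R (L ⧸ LinearMap.range f)
  let g : L →ₗ[R] Q := (LinearMap.range f).mkQ
  have hg : ∀ l, g l = 0 ↔ ∃ n, f n = l := fun l => (Submodule.Quotient.mk_eq_zero _).trans Iff.rfl
  have hgs : Function.Surjective g := Submodule.mkQ_surjective _
  let v : ℕ → (L →ₗ[R] L) := fun j => (e.symm.toLinearMap) ^ j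
  have hv : ∀ j l, y ^ j • v j l = l := fun j l => by
    induction j with
    | zero => simp [v]
    | succ j ih =>
      have : v (j + 1) l = e.symm (v j l) := by simp [v, pow_succ']
      rw [this, pow_succ, mul_smul, hes, ih]
  have hyr : ∀ j, Function.Injective fun l : L => y ^ j • l := fun j => by
    induction j with
    | zero => intro a b h; simpa using h
    | succ j ih =>
      intro a b h
      simp only [pow_succ, mul_smul] at h
      have := ih h
      rw [← he, ← he] at this
      exact e.injective this
  let q : fs N →ₗ[R] Q := (Finsupp.lsum R fun j => g ∘ₗ v (j + 1) ∘ₗ f : (ℕ →₀ N) →ₗ[R] Q)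
  have hq : ∀ j n, q (Finsupp.single j n : ℕ →₀ N) = g (v (j + 1) (f n)) := fun j n => by
    exact (Finsupp.lsum_single R _ _ _)
  let i : QuotSMulTop y N →ₗ[R] Q := Submodule.liftQ _ (g ∘ₗ e.symm.toLinearMap ∘ₗ f) (by
    intro x hx
    obtain ⟨n, -, rfl⟩ := (Submodule.mem_smul_pointwise_iff_exists _ _ _).1 hx
    refine (hg _).2 ⟨n, ?_⟩
    simp [hes])
  have hi : ∀ n, i (Submodule.Quotient.mk n) = g (e.symm (f n)) := fun n => rfl
  have hvv : ∀ j l, v (j + 1) (y • l) = v j l := fun j l => by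
    apply hyr (j + 1)
    change y ^ (j + 1) • _ = y ^ (j + 1) • _
    rw [hv, pow_succ', mul_smul, hv]
  have hqT : q ∘ₗ TT N y = 0 := by
    refine Finsupp.lhom_ext fun j n => ?_
    cases j with
    | zero =>
      rw [LinearMap.comp_apply, TT_zero, hq, map_smul, hvv]
      exact (hg _).2 ⟨n, rfl⟩
    | succ j =>
      rw [LinearMap.comp_apply, TT_succ]
      refine (map_sub q _ _).trans ?_
      rw [hq, hq, map_smul, hvv]
      exact sub_self _
  refine ⟨L, Q, f, g, e, q, i, ⟨hf, fun l => hg l, hgs⟩, he, ⟨TT_inj y hy, ?_, ?_⟩, ⟨?_, ?_, ?_⟩, ?_⟩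
  · intro x
    constructor
    · intro hx
      obtain ⟨J, hJ⟩ := TT_red y x
      obtain ⟨n, z, hz⟩ := hJ J le_rfl
      have h1 : q (Finsupp.single J n : ℕ →₀ N) = 0 := by
        have h2 : q (TT N y z) = 0 := LinearMap.congr_fun hqT z
        rw [hz] at h2
        have h3 := (map_sub q x (Finsupp.single J n : ℕ →₀ N)).symm.trans h2
        rw [hx, zero_sub, neg_eq_zero] at h3
        exact h3
      rw [hq, hg] at h1
      obtain ⟨n', hn'⟩ := h1
      have h4 : n = y ^ J • (y • n') := hf (by
        rw [map_smul, map_smul, smul_smul, ← pow_succ, hn', hv])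
      obtain ⟨z', hz'⟩ := TT_single y 0 J (y • n')
      rw [← h4, zero_add] at hz'
      refine ⟨z - z' + (Finsupp.single 0 n' : ℕ →₀ N), ?_⟩
      rw [map_add, map_sub, hz, hz', TT_zero]
      exact sub_sub_sub_add' _ _ _
    · rintro ⟨z, rfl⟩
      exact LinearMap.congr_fun hqT z
  · intro x
    obtain ⟨l, rfl⟩ := hgs x
    obtain ⟨j, n, hn⟩ := hL l
    refine ⟨(Finsupp.single j (y • n) : ℕ →₀ N), ?_⟩
    rw [hq]
    congr 1
    apply hyr (j + 1)
    change y ^ (j + 1) • _ = y ^ (j + 1) • _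
    rw [hv, pow_succ', mul_smul, hn, map_smul]
  · rw [injective_iff_map_eq_zero]
    intro x hx
    obtain ⟨n, rfl⟩ := Submodule.Quotient.mk_surjective _ x
    rw [hi, hg] at hx
    obtain ⟨n', hn'⟩ := hx
    have : n = y • n' := hf (by rw [map_smul, hn', hes])
    rw [this]
    exact (Submodule.Quotient.mk_eq_zero _).2 (Submodule.smul_mem_pointwise_smul _ _ _ trivial)
  · intro x
    obtain ⟨l, rfl⟩ := hgs x
    constructor
    · intro h
      change y • g l = 0 at h
      rw [← map_smul, hg] at h
      obtain ⟨n, hn⟩ := h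
      refine ⟨Submodule.Quotient.mk n, ?_⟩
      rw [hi, hn, hes']
    · rintro ⟨z, hz⟩
      obtain ⟨n, rfl⟩ := Submodule.Quotient.mk_surjective _ z
      rw [← hz, hi]
      change y • g _ = 0
      rw [← map_smul, hes]
      exact (hg _).2 ⟨n, rfl⟩
  · intro x
    obtain ⟨l, rfl⟩ := hgs x
    refine ⟨g (e.symm l), ?_⟩
    change y • g _ = _
    rw [← map_smul, hes]
  · intro x
    obtain ⟨l, rfl⟩ := hgs x
    obtain ⟨j, n, hn⟩ := hL l
    exact ⟨j, by rw [← map_smul]; exact (hg _).2 ⟨n, hn.symm⟩⟩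

end GC
end

section
open CategoryTheory IsLocalRing Paper TensorProduct RingTheory.Sequence
namespace GC
variable {R : Type u} [CommRing R]
variable {A B D A' B' D' X Y K L N Q T w Ω P C H F F0 F1 : ModuleCat.{u} R} {Fl W : ModuleCat.{u} R → Prop}

lemma mk_eq_zero_iff (z : R) (M : Type u) [AddCommGroup M] [Module R M] (x : M) :
    (Submodule.Quotient.mk x : QuotSMulTop z M) = 0 ↔ ∃ x', z • x' = x := by
  rw [Submodule.Quotient.mk_eq_zero, Submodule.mem_smul_pointwise_iff_exists]
  simp

lemma wreg_up (y : R) (zs : List R) : ∀ {K Q : ModuleCat.{u} R} {i : K →ₗ[R] Q}, 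
    SES i (y • LinearMap.id : Q →ₗ[R] Q) → (∀ x : Q, ∃ n : ℕ, y ^ n • x = 0) → IsWeaklyRegular K zs →
    IsWeaklyRegular Q zs := by
  induction zs with
  | nil => intros; exact IsWeaklyRegular.nil R _
  | cons z zs ih =>
    intro K Q i h ht hz
    rw [isWeaklyRegular_cons_iff] at hz ⊢
    obtain ⟨hz1, hz2⟩ := hz
    have hK : ∀ x : Q, y • x = 0 → ∃ k, i k = x := fun x hx => (h.exact x).1 hx
    have hKy : ∀ k, y • i k = 0 := fun k => h.exact.apply_apply_eq_zero k
    have hs : ∀ x : Q, ∃ x', y • x' = x := h.surj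
    have hreg : ∀ n (x : Q), y ^ n • x = 0 → z • x = 0 → x = 0 := by
      intro n
      induction n with
      | zero => intro x hx _; simpa using hx
      | succ n ihn =>
        intro x hx hzx
        have h1 : y • x = 0 := ihn (y • x) (by rw [smul_smul, ← pow_succ, hx]) (by rw [smul_comm, hzx, smul_zero])
        obtain ⟨k, rfl⟩ := hK x h1
        rw [← map_smul] at hzx
        have h2 : z • k = 0 := h.inj (by rw [hzx, map_zero])
        rw [hz1 (h2.trans (smul_zero z).symm), map_zero]
    have hreg' : IsSMulRegular Q z := by
      intro a b hab
      obtain ⟨n, hn⟩ := ht (a - b)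
      refine sub_eq_zero.1 (hreg n _ hn ?_)
      rw [smul_sub, sub_eq_zero]; exact hab
    refine ⟨hreg', ?_⟩
    refine ih (K := ModuleCat.of R (QuotSMulTop z K)) (Q := ModuleCat.of R (QuotSMulTop z Q))
      (i := QuotSMulTop.map z i) ⟨?_, ?_, ?_⟩ ?_ hz2
    · rw [injective_iff_map_eq_zero]
      intro k hk
      obtain ⟨k, rfl⟩ := Submodule.Quotient.mk_surjective _ k
      change (Submodule.Quotient.mk (i k) : QuotSMulTop z Q) = 0 at hk
      rw [mk_eq_zero_iff] at hk
      obtain ⟨x, hx⟩ := hk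
      have h1 : y • x = 0 := hreg' (by
        change z • y • x = z • 0
        rw [smul_comm, hx, hKy, smul_zero])
      obtain ⟨k', rfl⟩ := hK x h1
      refine (mk_eq_zero_iff _ _ _).2 ⟨k', h.inj ?_⟩
      rw [map_smul, hx]
    · intro x
      obtain ⟨x, rfl⟩ := Submodule.Quotient.mk_surjective _ x
      change y • (Submodule.Quotient.mk x : QuotSMulTop z Q) = 0 ↔ _
      rw [← Submodule.Quotient.mk_smul, mk_eq_zero_iff]
      constructor
      · rintro ⟨x', hx'⟩
        obtain ⟨x'', rfl⟩ := hs x'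
        obtain ⟨k, hk⟩ := hK (x - z • x'') (by rw [smul_sub, ← hx', smul_comm, sub_self])
        refine ⟨Submodule.Quotient.mk k, ?_⟩
        change (Submodule.Quotient.mk (i k) : QuotSMulTop z Q) = _
        rw [hk, Submodule.Quotient.mk_sub, sub_eq_self]
        exact (mk_eq_zero_iff _ _ _).2 ⟨x'', rfl⟩
      · rintro ⟨k, hk⟩
        obtain ⟨k, rfl⟩ := Submodule.Quotient.mk_surjective _ k
        change (Submodule.Quotient.mk (i k) : QuotSMulTop z Q) = _ at hk
        rw [← mk_eq_zero_iff, Submodule.Quotient.mk_smul]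
        refine (congrArg (y • ·) hk.symm).trans ?_
        rw [← Submodule.Quotient.mk_smul, hKy]; rfl
    · intro x
      obtain ⟨x, rfl⟩ := Submodule.Quotient.mk_surjective _ x
      obtain ⟨x', rfl⟩ := hs x
      exact ⟨Submodule.Quotient.mk x', rfl⟩
    · intro x
      obtain ⟨x, rfl⟩ := Submodule.Quotient.mk_surjective _ x
      obtain ⟨n, hn⟩ := ht x
      refine ⟨n, ?_⟩
      change y ^ n • (Submodule.Quotient.mk x : QuotSMulTop z Q) = 0
      rw [← Submodule.Quotient.mk_smul, hn]; rfl

/-- Ext into a module on which `y` is invertible -/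
lemma EV_inv (y : R) (e : L ≃ₗ[R] L) (he : ∀ l, e l = y • l) (n : ℕ) (hX : ∀ x : X, y ^ n • x = 0) (i : ℕ) :
    EV i X L := by
  intro x
  have h1 : (y ^ n • LinearMap.id : X →ₗ[R] X) = 0 := by exact LinearMap.ext fun a => hX a
  have h2 : y ^ n • x = 0 := by
    have := pre_smul (w := L) (y ^ n) (LinearMap.id : X →ₗ[R] X) i x
    rw [h1, pre_zero, pre_id] at this
    exact this.symm
  have h3 : ∀ m (x : EX X L i), y ^ m • x = 0 → x = 0 := by
    intro m
    induction m with
    | zero => intro x hx; simpa using hx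
    | succ m ih =>
      intro x hx
      rw [pow_succ, mul_smul] at hx
      have h4 := ih _ hx
      have h5 : post X e.toLinearMap i x = 0 := by
        have : e.toLinearMap = y • LinearMap.id := by ext l; simp [he]
        rw [this, post_smul, post_id, h4]
      have h6 := post_comp (N := X) e.toLinearMap e.symm.toLinearMap i x
      rw [h5, map_zero] at h6
      have h7 : e.symm.toLinearMap ∘ₗ e.toLinearMap = LinearMap.id := by ext l; simp
      rw [h7, post_id] at h6
      exact h6
  exact h3 n x h2

lemma dr_bij {f : A →ₗ[R] B} {g : B →ₗ[R] D} (h : SES f g) (n : ℕ) (h1 : EV n N B) (h2 : EV (n + 1) N B) :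
    Function.Bijective (h.dr N n) := by
  constructor
  · rw [injective_iff_map_eq_zero]
    intro x hx
    obtain ⟨y, rfl⟩ := (h.dr_exact₃ N n x).1 hx
    rw [h1 y, map_zero]
  · intro x
    exact (h.dr_exact₁ N n x).1 (h2 _)

lemma fs_surj_tors {q : fs N →ₗ[R] Q} (hq : Function.Surjective q) (r : R) (h : ∀ n : N, ∃ k : ℕ, r ^ k • n = 0) (x : Q) :
    ∃ k : ℕ, r ^ k • x = 0 := by
  obtain ⟨x, rfl⟩ := hq x
  change ℕ →₀ N at x
  have : ∃ k : ℕ, r ^ k • x = 0 := by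
    induction x using Finsupp.induction_linear with
    | zero => exact ⟨0, by simp⟩
    | add a b ha hb =>
      obtain ⟨k, hk⟩ := ha
      obtain ⟨l, hl⟩ := hb
      refine ⟨k + l, ?_⟩
      rw [smul_add, pow_add, mul_smul, mul_smul, hl, smul_zero, add_zero, smul_comm, hk, smul_zero]
    | single j n =>
      obtain ⟨k, hk⟩ := h n
      exact ⟨k, by rw [Finsupp.smul_single, hk, Finsupp.single_zero]⟩
  obtain ⟨k, hk⟩ := this
  exact ⟨k, by rw [← map_smul]; exact (congrArg q hk).trans (map_zero q)⟩

lemma fs_surj_kill {q : fs N →ₗ[R] Q} (hq : Function.Surjective q) (r : R) (h : ∀ n : N, r • n = 0) (x : Q) :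
    r • x = 0 := by
  obtain ⟨x, rfl⟩ := hq x
  change ℕ →₀ N at x
  have : r • x = 0 := by
    refine Finsupp.ext fun j => ?_
    exact h (x j)
  rw [← map_smul]
  exact (congrArg q this).trans (map_zero q)

/-- lower bound invariant -/
def LB [IsLocalRing R] (N w : ModuleCat.{u} R) (j : ℕ) : Prop :=
  (∀ i, EV (j + i + 1) N w) ∧ ∃ (S : ModuleCat.{u} R) (β : EX N w j →ₗ[R] S), Nontrivial S ∧
    (∀ r ∈ maximalIdeal R, ∀ s : S, r • s = 0) ∧ Function.Surjective β

lemma ses_smul (N : ModuleCat.{u} R) (y : R) (hy : IsSMulRegular N y) :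
    SES (D := ModuleCat.of R (QuotSMulTop y N)) (y • LinearMap.id : N →ₗ[R] N) (Submodule.mkQ _) where
  inj := hy
  exact x := by
    change (Submodule.Quotient.mk x : QuotSMulTop y N) = 0 ↔ _
    rw [mk_eq_zero_iff]; rfl
  surj := Submodule.mkQ_surjective _

lemma LB.step [IsLocalRing R] {j : ℕ} {y : R} (hym : y ∈ maximalIdeal R) (hy : IsSMulRegular N y) {q : fs N →ₗ[R] Q}
    (hq : SES (TT N y) q) {i : QuotSMulTop y N →ₗ[R] Q}
    (hi : SES (A := ModuleCat.of R (QuotSMulTop y N)) i (y • LinearMap.id : Q →ₗ[R] Q)) (h : LB N w j) : LB Q w (j + 1) := by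
  obtain ⟨h1, S, β, hS, hm, hβ⟩ := h
  have hQ : ∀ i, EV (j + 1 + i + 1) Q w := fun i => by
    refine hq.EV_right (n := j + 1 + i) ?_ ?_
    · have := (h1 i).fs
      rwa [show j + i + 1 = j + 1 + i by omega] at this
    · have := (h1 (i + 1)).fs
      rwa [show j + (i + 1) + 1 = j + 1 + i + 1 by omega] at this
  refine ⟨hQ, S, ?_⟩
  have hs := ses_smul N y hy
  have hd : Function.Surjective (hs.dl w j) := fun x => (hs.dl_exact₃ w j x).1 (h1 0 _)
  obtain ⟨γ, hγ⟩ := exists_desc (A := ModuleCat.of R (EX N w j)) (B := ModuleCat.of R (EX (ModuleCat.of R (QuotSMulTop y N)) w (j + 1)))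
    (D := S) (hs.dl w j) hd β (fun x hx => by
      obtain ⟨z, rfl⟩ := (hs.dl_exact₁ w j x).1 hx
      have := pre_smul (w := w) y (LinearMap.id : N →ₗ[R] N) j z
      rw [pre_id] at this
      rw [this]
      exact (map_smul β y z).trans (hm y hym _))
  refine ⟨γ ∘ₗ pre (A := ModuleCat.of R (QuotSMulTop y N)) i w (j + 1), hS, hm, ?_⟩
  intro s
  obtain ⟨x, rfl⟩ := hβ s
  obtain ⟨z, hz⟩ := (hi.dl_exact₁ w (j + 1) (hs.dl w j x)).1 (hQ 0 _)
  refine ⟨z, ?_⟩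
  rw [LinearMap.comp_apply, hz]
  exact hγ x

structure Cech [IsLocalRing R] (N : ModuleCat.{u} R) (ys : List R) (T : ModuleCat.{u} R) : Prop where
  up : ∀ (G : ModuleCat.{u} R → Prop), Resolving G → (∀ N, G N → G (fs N)) → ∀ k, ResDimLE R G k N → ResDimLE R G (k + ys.length) T
  low : ∀ w j, LB N w j → LB T w (j + ys.length)
  kill : ∀ r : R, (∀ n : N, r • n = 0) → ∀ t : T, r • t = 0
  tors' : ∀ r : R, (∀ n : N, ∃ k : ℕ, r ^ k • n = 0) → ∀ t : T, ∃ k : ℕ, r ^ k • t = 0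
  tors : ∀ r ∈ ys, ∀ t : T, ∃ k : ℕ, r ^ k • t = 0
  coh : ∃ κ : ∀ X : ModuleCat.{u} R, EX X T 0 →ₗ[R] EX X N ys.length, (∀ (X X' : ModuleCat.{u} R) (f : X →ₗ[R] X') (x : EX X' T 0),
    κ X (pre f T 0 x) = pre f N ys.length (κ X' x)) ∧
    ∀ X : ModuleCat.{u} R, (∀ y ∈ ys, ∃ n : ℕ, ∀ x : X, y ^ n • x = 0) → Function.Bijective (κ X)

lemma exists_cech [IsLocalRing R] (ys : List R) : ∀ N : ModuleCat.{u} R, (∀ y ∈ ys, y ∈ maximalIdeal R) → IsWeaklyRegular N ys →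
    ∃ T, Cech N ys T := by
  induction ys with
  | nil =>
    intro N _ _
    exact ⟨N, ⟨fun _ _ _ _ h => h, fun _ _ h => h, fun _ h => h, fun _ h => h, fun r hr => absurd hr (List.not_mem_nil),
      fun X => LinearMap.id, fun _ _ _ _ => rfl, fun _ _ => Function.bijective_id⟩⟩
  | cons y ys ih =>
    intro N hm hr
    rw [isWeaklyRegular_cons_iff] at hr
    obtain ⟨L, Q, f, g, e, q, i, h1, he, hq, hi, ht⟩ := exists_step N y hr.1
    obtain ⟨T, hT⟩ := ih Q (fun z hz => hm z (List.mem_cons_of_mem _ hz)) (wreg_up y ys hi ht hr.2)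
    refine ⟨T, ?_, ?_, ?_, ?_, ?_, ?_⟩
    · intro G hG hfs k hk
      have h2 := hG.dim_fs hfs hk
      have := hT.up G hG hfs (k + 1) (hG.dim_coker hq h2 h2)
      rwa [show k + 1 + ys.length = k + (y :: ys).length by simp; omega] at this
    · intro w j h
      have := hT.low w (j + 1) (h.step (hm y List.mem_cons_self) hr.1 hq hi)
      rwa [show j + 1 + ys.length = j + (y :: ys).length by simp; omega] at this
    · intro r h
      exact hT.kill r (fs_surj_kill hq.surj r h)
    · intro r h
      exact hT.tors' r (fs_surj_tors hq.surj r h)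
    · intro r hr'
      rcases List.mem_cons.1 hr' with rfl | hr'
      · exact hT.tors' r ht
      · exact hT.tors r hr'
    · obtain ⟨κ, hκ1, hκ2⟩ := hT.coh
      refine ⟨fun X => h1.dr X ys.length ∘ₗ κ X, fun X X' k x => ?_, fun X hX => ?_⟩
      · rw [LinearMap.comp_apply, hκ1]
        exact (h1.pre_dr k ys.length (κ X' x)).symm
      · obtain ⟨n, hn⟩ := hX y List.mem_cons_self
        exact (dr_bij h1 ys.length (EV_inv y e he n hn _) (EV_inv y e he n hn _)).comp
          (hκ2 X fun z hz => hX z (List.mem_cons_of_mem _ hz))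

end GC
end

section
open CategoryTheory IsLocalRing Paper TensorProduct RingTheory.Sequence
namespace GC
variable {R : Type u} [CommRing R] [IsNoetherianRing R] [IsLocalRing R]

lemma le_zero_of_add_nat {s : WithBot ℕ∞} {n : ℕ} (h : s + (n : WithBot ℕ∞) = n) : s ≤ 0 := by
  induction s using WithBot.recBotCoe with
  | bot => exact bot_le
  | coe a =>
    induction a using ENat.recTopCoe with
    | top =>
      have h' : ((⊤ + (n : ℕ∞) : ℕ∞) : WithBot ℕ∞) = ((n : ℕ∞) : WithBot ℕ∞) := h
      rw [WithBot.coe_inj, top_add] at h'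
      exact absurd h'.symm (ENat.natCast_ne_top n)
    | coe a =>
      have h' : ((a + n : ℕ) : WithBot ℕ∞) = ((n : ℕ) : WithBot ℕ∞) := by push_cast; exact h
      have h'' : a + n = n := by exact_mod_cast h'
      have : a = 0 := by omega
      subst this
      exact le_rfl

/-- a system of parameters together with the annihilator generates an `m`-primary ideal -/
lemma le_radical_of_sop (M : Type u) [AddCommGroup M] [Module R M] [Module.Finite R M] [Nontrivial M]
    (rs : List R) (h : RingTheory.Sequence.IsRegular M rs) (hdim : moduleDim R M = (rs.length : WithBot ℕ∞))
    (J : Ideal R) (h1 : ∀ r ∈ rs, r ∈ J.radical) (h2 : ∀ r : R, (∀ x : M, r • x = 0) → r ∈ J) :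
    maximalIdeal R ≤ J.radical := by
  have h3 := Module.supportDim_add_length_eq_supportDim_of_isRegular rs h
  rw [Module.supportDim_eq_ringKrullDim_quotient_annihilator R M] at h3
  change _ = moduleDim R M at h3
  rw [hdim] at h3
  have hs : Module.supportDim R (M ⧸ Ideal.ofList rs • (⊤ : Submodule R M)) ≤ 0 := by
    exact le_zero_of_add_nat h3
  have hmax := Order.krullDim_nonpos_iff_forall_isMax.1 hs
  rw [Ideal.radical_eq_sInf]
  refine le_sInf fun p hp => ?_
  obtain ⟨hJp, hpp⟩ := hp
  have hmem : (⟨p, hpp⟩ : PrimeSpectrum R) ∈ Module.support R (M ⧸ Ideal.ofList rs • (⊤ : Submodule R M)) := by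
    rw [Module.support_quotient]
    refine ⟨?_, ?_⟩
    · rw [Module.mem_support_iff_of_finite]
      intro r hr
      exact hJp (h2 r (Module.mem_annihilator.1 hr))
    · rw [PrimeSpectrum.mem_zeroLocus]
      refine Ideal.span_le.2 fun r hr => ?_
      exact (hpp.radical_le_iff.2 hJp) (h1 r hr)
  have : Nontrivial (M ⧸ Ideal.ofList rs • (⊤ : Submodule R M)) :=
    Submodule.Quotient.nontrivial_iff.2 h.top_ne_smul.symm
  have hm := IsLocalRing.closedPoint_mem_support R (M ⧸ Ideal.ofList rs • (⊤ : Submodule R M))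
  have := hmax ⟨_, hmem⟩ (b := ⟨_, hm⟩) (show p ≤ maximalIdeal R from le_maximalIdeal hpp.ne_top)
  exact this

lemma lcoh_iso (M : Type u) [AddCommGroup M] [Module R M] [Module.Finite R M] [Nontrivial M]
    (rs : List R) (hm : ∀ r ∈ rs, r ∈ maximalIdeal R)
    (h : RingTheory.Sequence.IsRegular M rs) (hdim : moduleDim R M = (rs.length : WithBot ℕ∞))
    (T : ModuleCat.{u} R) (hT : Cech (ModuleCat.of R M) rs T) :
    Nonempty (lcoh R (maximalIdeal R) rs.length M ≃ₗ[R] T) := by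
  obtain ⟨κ, hnat, hbij⟩ := hT.coh
  have hb : ∀ t : ℕ, Function.Bijective (κ (ModuleCat.of R (R ⧸ maximalIdeal R ^ t))) := fun t =>
    hbij _ fun y hy => ⟨t, fun x => by
      obtain ⟨x, rfl⟩ := Ideal.Quotient.mk_surjective x
      exact Ideal.Quotient.eq_zero_iff_mem.2 (Ideal.mul_mem_right _ _ (Ideal.pow_mem_pow (hm y hy) t))⟩
  let ke := fun t => LinearEquiv.ofBijective _ (hb t)
  let ev : ∀ t : ℕ, ((ModuleCat.of R (R ⧸ maximalIdeal R ^ t) : ModuleCat.{u} R) →ₗ[R] T) →ₗ[R] T :=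
    fun t => LinearMap.applyₗ (Submodule.Quotient.mk 1 : R ⧸ maximalIdeal R ^ t)
  refine lcoh_equiv _ _ M T (fun t => ev t ∘ₗ (e0 (ModuleCat.of R (R ⧸ maximalIdeal R ^ t)) T).toLinearMap ∘ₗ (ke t).symm.toLinearMap) ?_ ?_ ?_
  · intro s t hst x
    obtain ⟨x, rfl⟩ := (ke s).surjective x
    have h1 := hnat (ModuleCat.of R (R ⧸ maximalIdeal R ^ t)) (ModuleCat.of R (R ⧸ maximalIdeal R ^ s)) (Submodule.mapQ (maximalIdeal R ^ t) (maximalIdeal R ^ s) LinearMap.id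
        (Ideal.pow_le_pow_right hst)) x
    have h2 : (ke t).symm (pre (A := ModuleCat.of R (R ⧸ maximalIdeal R ^ t)) (B := ModuleCat.of R (R ⧸ maximalIdeal R ^ s)) (Submodule.mapQ (maximalIdeal R ^ t) (maximalIdeal R ^ s) LinearMap.id
        (Ideal.pow_le_pow_right hst)) (ModuleCat.of R M) rs.length (ke s x)) = pre (A := ModuleCat.of R (R ⧸ maximalIdeal R ^ t)) (B := ModuleCat.of R (R ⧸ maximalIdeal R ^ s)) (Submodule.mapQ (maximalIdeal R ^ t) (maximalIdeal R ^ s) LinearMap.id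
        (Ideal.pow_le_pow_right hst)) T 0 x := (LinearEquiv.symm_apply_eq _).2 h1.symm
    simp only [LinearMap.comp_apply, LinearEquiv.coe_coe]
    rw [h2, e0_pre, LinearEquiv.symm_apply_apply]
    rfl
  · intro t
    refine Function.Injective.comp (g := ev t) ?_ ((e0 _ T).injective.comp (ke t).symm.injective)
    intro f g hfg
    refine LinearMap.ext fun x => ?_
    obtain ⟨x, rfl⟩ := Ideal.Quotient.mk_surjective x
    have hx : (Ideal.Quotient.mk (maximalIdeal R ^ t) x) = x • (Submodule.Quotient.mk 1 : R ⧸ maximalIdeal R ^ t) := by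
      rw [← Submodule.Quotient.mk_smul, smul_eq_mul, mul_one]; rfl
    have h3 : f (Submodule.Quotient.mk 1 : R ⧸ maximalIdeal R ^ t) = g (Submodule.Quotient.mk 1 : R ⧸ maximalIdeal R ^ t) := hfg
    refine (congrArg f hx).trans (Eq.trans ?_ (congrArg g hx).symm)
    exact (map_smul f x _).trans ((congrArg _ h3).trans (map_smul g x _).symm)
  · intro y
    let J : Ideal R := LinearMap.ker (LinearMap.toSpanSingleton R T y)
    have hJ : ∀ r, r ∈ J ↔ r • y = 0 := fun r => Iff.rfl
    have h4 : maximalIdeal R ≤ J.radical := le_radical_of_sop M rs h hdim J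
      (fun r hr => by
        obtain ⟨k, hk⟩ := hT.tors r hr y
        exact ⟨k, hk⟩) (fun r hr => hT.kill r hr y)
    obtain ⟨t, ht⟩ := Ideal.exists_pow_le_of_le_radical_of_fg h4 (IsNoetherian.noetherian _)
    let f : (ModuleCat.of R (R ⧸ maximalIdeal R ^ t) : ModuleCat.{u} R) →ₗ[R] T :=
      Submodule.liftQ _ (LinearMap.toSpanSingleton R T y) ht
    refine ⟨t, ke t ((e0 _ T).symm f), ?_⟩
    simp only [LinearMap.comp_apply, LinearEquiv.coe_coe]
    rw [LinearEquiv.symm_apply_apply, LinearEquiv.apply_symm_apply]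
    exact one_smul R y

end GC
end

section
open CategoryTheory IsLocalRing Paper TensorProduct RingTheory.Sequence
namespace GC
variable {R : Type u} [CommRing R] [IsNoetherianRing R]
variable {A B D X Y K N w C F : ModuleCat.{u} R}

lemma EX_finite (X w : ModuleCat.{u} R) [Module.Finite R X] [Module.Finite R w] (n : ℕ) : Module.Finite R (EX X w n) := by
  induction n generalizing X with
  | zero => exact Module.Finite.equiv (e0 X w).symm
  | succ n ih =>
    obtain ⟨m, K, i, p, hs, hK⟩ := exists_fin_cover X
    have := ih K
    have hE : EV (n + 1) (ModuleCat.of R (Fin m → R)) w :=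
      EV_of_projective (inferInstanceAs (Module.Projective R (Fin m → R))) n
    refine Module.Finite.of_surjective (hs.dl w n) fun x => ?_
    exact (hs.dl_exact₃ w n x).1 (hE _)

lemma EX_tensor_zero (X C P : ModuleCat.{u} R) [Module.Finite R X] [Module.Flat R P] {n : ℕ} (h : EV n X C) :
    EV n X (ModuleCat.of R (C ⊗[R] P)) := by
  intro x
  obtain ⟨y, rfl⟩ := (tau_bij X C P n).2 x
  have : y = 0 := by
    induction y using TensorProduct.induction_on with
    | zero => rfl
    | tmul a b => rw [h a, TensorProduct.zero_tmul]
    | add a b ha hb => rw [ha, hb, add_zero]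
  rw [this, map_zero]

lemma EX_min_ne (hC : Sem C) (X : ModuleCat.{u} R) [Module.Finite R X] [Nontrivial X] (g : ℕ)
    (h : ResDimLE R (GP C) g X) (hmin : ∀ j, ResDimLE R (GP C) j X → g ≤ j) : ¬ EV g X C := by
  intro hE
  have hW : ∀ w, Wp C w → EV g X w := by
    rintro w ⟨P, hP, ⟨e⟩⟩
    exact EV.of_iso_right (A := ModuleCat.of R (C ⊗[R] P)) e.symm (EX_tensor_zero X C P hE)
  rcases g with _ | g
  · obtain ⟨v, X', f, g, hv, hs, -⟩ := Gp.step h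
    have hf : f = 0 := by
      have h1 := hW v hv ((e0 X v).symm f)
      exact (e0 X v).symm.map_eq_zero_iff.1 h1
    obtain ⟨x, y, hxy⟩ := exists_pair_ne X
    exact hxy (hs.inj (by rw [hf]; rfl))
  · have := hmin g ((good_p hC).dim_drop (res_p hC) h hW)
    omega

variable [IsLocalRing R]

lemma exists_LB (hC : Sem C) (X : ModuleCat.{u} R) [Module.Finite R X] [Nontrivial X] (g : ℕ)
    (h : ResDimLE R (GP C) g X) (hmin : ∀ j, ResDimLE R (GP C) j X → g ≤ j) (F : ModuleCat.{u} R) [Module.Flat R F]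
    (ι : R →ₗ[R] F) (hι : ∀ J : ModuleCat.{u} R, Function.Injective (ι.rTensor J))
    (e : w ≃ₗ[R] C ⊗[R] F) : LB X w g := by
  have := hC.fin
  have hne := EX_min_ne hC X g h hmin
  have hfin := EX_finite X C g
  have hCw : Wp C C := ⟨ModuleCat.of R R, inferInstanceAs (Module.Projective R R), ⟨(TensorProduct.rid R C).symm⟩⟩
  let A := EX X C g
  let S := A ⧸ (maximalIdeal R • (⊤ : Submodule R A))
  have hS : Nontrivial S := by
    rw [Submodule.Quotient.nontrivial_iff]
    intro htop
    have h1 := Submodule.eq_bot_of_le_smul_of_le_jacobson_bot (maximalIdeal R) (⊤ : Submodule R A)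
      Module.Finite.fg_top (by rw [htop]) (IsLocalRing.maximalIdeal_le_jacobson _)
    exact hne fun x => (Submodule.mem_bot R).1 (h1 ▸ Submodule.mem_top : x ∈ (⊥ : Submodule R A))
  refine ⟨fun i => ?_, ModuleCat.of R (S ⊗[R] F),
    (Submodule.mkQ (maximalIdeal R • (⊤ : Submodule R A))).rTensor F ∘ₗ (LinearEquiv.ofBijective _ (tau_bij X C F g)).symm.toLinearMap ∘ₗ
      (post (B := ModuleCat.of R (C ⊗[R] F)) X e.toLinearMap g), ?_, ?_, ?_⟩
  · exact EV.of_iso_right (A := ModuleCat.of R (C ⊗[R] F)) e.symm (EX_tensor_zero X C F (dim_EV h hCw i))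
  · have h2 := hι (ModuleCat.of R S)
    have e1 : S ≃ₗ[R] R ⊗[R] S := (TensorProduct.lid R S).symm
    have hn : Nontrivial (F ⊗[R] S) := Function.Injective.nontrivial (h2.comp e1.injective)
    exact (TensorProduct.comm R S F).surjective.nontrivial
  · intro r hr s
    have hr' : ∀ s : S ⊗[R] F, r • s = 0 := fun s => by
      induction s using TensorProduct.induction_on with
      | zero => exact smul_zero _
      | tmul a b =>
        obtain ⟨a, rfl⟩ := Submodule.Quotient.mk_surjective _ a
        rw [TensorProduct.smul_tmul', ← Submodule.Quotient.mk_smul,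
          (Submodule.Quotient.mk_eq_zero _).2 (Submodule.smul_mem_smul hr Submodule.mem_top), TensorProduct.zero_tmul]
      | add a b ha hb => rw [smul_add, ha, hb, add_zero]
    exact hr' s
  · refine (LinearMap.rTensor_surjective F (Submodule.mkQ_surjective (maximalIdeal R • (⊤ : Submodule R A)))).comp ((LinearEquiv.ofBijective _ (tau_bij X C F g)).symm.surjective.comp (f := post (B := ModuleCat.of R (C ⊗[R] F)) X e.toLinearMap g) fun x => ?_)
    refine ⟨post (A := ModuleCat.of R (C ⊗[R] F)) X e.symm.toLinearMap g x, ?_⟩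
    rw [← post_comp]
    have : e.toLinearMap ∘ₗ e.symm.toLinearMap = LinearMap.id := by ext; simp
    erw [this]
    exact post_id g x

lemma exists_LB_p (hC : Sem C) (X : ModuleCat.{u} R) [Module.Finite R X] [Nontrivial X] (g : ℕ)
    (h : ResDimLE R (GP C) g X) (hmin : ∀ j, ResDimLE R (GP C) j X → g ≤ j) : ∃ w, Wp C w ∧ LB X w g := by
  refine ⟨ModuleCat.of R (C ⊗[R] R), ⟨ModuleCat.of R R, inferInstanceAs (Module.Projective R R), ⟨LinearEquiv.refl R _⟩⟩, ?_⟩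
  have : Module.Flat R (ModuleCat.of R R) := inferInstanceAs (Module.Flat R R)
  exact exists_LB hC X g h hmin (ModuleCat.of R R) (LinearMap.id : R →ₗ[R] R)
    (fun J => by
      have : (LinearMap.id : R →ₗ[R] R).rTensor J = LinearMap.id := LinearMap.rTensor_id _ _
      intro x y hxy
      erw [this] at hxy
      exact hxy) (LinearEquiv.refl R _)

lemma exists_LB_f (hC : Sem C) (X : ModuleCat.{u} R) [Module.Finite R X] [Nontrivial X] (g : ℕ)
    (h : ResDimLE R (GP C) g X) (hmin : ∀ j, ResDimLE R (GP C) j X → g ≤ j) : ∃ w, Wf C w ∧ LB X w g := by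
  have := hC.fin
  have hI := EE_injective (R := R)
  have hfl : Module.Flat R (CharacterModule (EE R)) := flat_char (EE R) hI
  have hfl' : Module.Flat R (ModuleCat.of R (CharacterModule (EE R))) := hfl
  refine ⟨ModuleCat.of R (CharacterModule (C →ₗ[R] EE R)), ⟨ModuleCat.of R (EE R), hI, ⟨LinearEquiv.refl R _⟩⟩, ?_⟩
  let e1 : CharacterModule (C →ₗ[R] EE R) ≃ₗ[R] ((C →ₗ[R] EE R) →ₗ[R] EE R) := (charEquiv (C →ₗ[R] EE R)).symm
  let e2 : C ⊗[R] (EE R →ₗ[R] EE R) ≃ₗ[R] ((C →ₗ[R] EE R) →ₗ[R] EE R) := LinearEquiv.ofBijective _ (te_bij (R := R) (Ω := C) (B := EE R) hI)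
  let e3 : C ⊗[R] (EE R →ₗ[R] EE R) ≃ₗ[R] C ⊗[R] CharacterModule (EE R) :=
    TensorProduct.congr (LinearEquiv.refl R C) (charEquiv (EE R))
  exact exists_LB hC X g h hmin (ModuleCat.of R (CharacterModule (EE R))) (evc (R := R) R)
    (fun J => evc_rTensor_inj R J) (e1.trans (e2.symm.trans e3))

end GC
end

open CategoryTheory IsLocalRing Paper TensorProduct RingTheory.Sequence
namespace GC
variable {R : Type u} [CommRing R] [IsNoetherianRing R]
variable {A B D X Y K N w C F : ModuleCat.{u} R}

lemma C_mem (C : ModuleCat.{u} R) : Wp C C :=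
  ⟨ModuleCat.of R R, inferInstanceAs (Module.Projective R R), ⟨(TensorProduct.rid R C).symm⟩⟩

lemma Cn_mem (C : ModuleCat.{u} R) (n : ℕ) : Wp C (ModuleCat.of R (Fin n → C)) :=
  ⟨ModuleCat.of R (Fin n → R), inferInstanceAs (Module.Projective R (Fin n → R)),
    ⟨(TensorProduct.piScalarRight R R C (Fin n)).symm⟩⟩

lemma GP_fin_step (hC : Sem C) (K : ModuleCat.{u} R) [Module.Finite R K] (hK : GP C K) :
    ∃ (n : ℕ) (X : ModuleCat.{u} R) (f : K →ₗ[R] (ModuleCat.of R (Fin n → C) : ModuleCat.{u} R))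
      (g : (ModuleCat.of R (Fin n → C) : ModuleCat.{u} R) →ₗ[R] X), SES f g ∧ Module.Finite R X ∧ GP C X := by
  have := hC.fin
  obtain ⟨n, p, hp⟩ := Module.Finite.exists_fin' R (K →ₗ[R] C)
  let f : K →ₗ[R] (ModuleCat.of R (Fin n → C) : ModuleCat.{u} R) :=
    LinearMap.pi fun i => p (Pi.single i 1)
  have hf : ∀ k : K →ₗ[R] C, ∃ l : (ModuleCat.of R (Fin n → C) : ModuleCat.{u} R) →ₗ[R] C, l ∘ₗ f = k := by
    intro k
    obtain ⟨c, rfl⟩ := hp k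
    let l : (Fin n → C) →ₗ[R] C := ∑ i, c i • LinearMap.proj i
    refine ⟨l, LinearMap.ext fun x => ?_⟩
    have h1 : c = ∑ i, c i • (Pi.single i 1 : Fin n → R) := by
      ext j
      simp [Finset.sum_apply, Pi.single_apply]
    have h2 : l (f x) = ∑ i, c i • p (Pi.single i 1) x := by
      simp only [l, LinearMap.sum_apply, LinearMap.smul_apply, LinearMap.proj_apply]
      rfl
    refine h2.trans ?_
    conv_rhs => rw [h1, map_sum, LinearMap.sum_apply]
    simp only [map_smul, LinearMap.smul_apply]
  have hf' : ∀ w, Wp C w → ∀ k : K →ₗ[R] w, ∃ l : (ModuleCat.of R (Fin n → C) : ModuleCat.{u} R) →ₗ[R] w, l ∘ₗ f = k := by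
    rintro w ⟨P, hP, ⟨e⟩⟩ k
    obtain ⟨l, hl⟩ := extend_tensor_proj C (ModuleCat.of R (Fin n → C)) P hP f hf (e.toLinearMap ∘ₗ k)
    refine ⟨e.symm.toLinearMap ∘ₗ l, LinearMap.ext fun x => ?_⟩
    exact (e.symm_apply_eq).2 (LinearMap.congr_fun hl x)
  obtain ⟨v', X', f', g', hv', hs', hX'⟩ := hK.step
  have hinj : Function.Injective f := by
    obtain ⟨l, hl⟩ := hf' v' hv' f'
    have h3 := hs'.inj
    rw [← hl] at h3
    exact Function.Injective.of_comp h3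
  have hs := ses_coker hinj
  refine ⟨n, _, f, _, hs, ?_, ?_⟩
  · exact Module.Finite.of_surjective _ hs.surj
  · obtain ⟨U, i, p, j, q, h1, h2, -, -⟩ := pushout_ses hs hs'
    have hU : GP C U := (good_p hC).ext h2 ((good_p hC).mem (Cn_mem C n)) hX'
    have hE := hs.EV_one_of_extend (w := v') ((setting_p C).CF_EV hC (Cn_mem C n) hv' 0) (hf' v' hv')
    obtain ⟨l, hl⟩ := h1.extend hE LinearMap.id
    have hl' : ∀ x, l (i x) = x := LinearMap.congr_fun hl
    obtain ⟨s, hsp⟩ := exists_desc p h1.surj (LinearMap.id - i ∘ₗ l) fun x hx => by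
      obtain ⟨y, rfl⟩ := (h1.exact x).1 hx
      simp [hl']
    have hss : SES s l := by
      refine ⟨?_, ?_, ?_⟩
      · rw [injective_iff_map_eq_zero]
        intro y hy
        obtain ⟨y, rfl⟩ := h1.surj y
        rw [hsp] at hy
        have : y = i (l y) := sub_eq_zero.1 hy
        rw [this]
        exact h1.exact.apply_apply_eq_zero _
      · intro y
        constructor
        · intro hy
          refine ⟨p y, ?_⟩
          rw [hsp]
          simp [hy]
        · rintro ⟨z, rfl⟩
          obtain ⟨z, rfl⟩ := h1.surj z
          rw [hsp]
          simp [hl']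
      · exact fun y => ⟨i y, hl' y⟩
    exact (good_p hC).ker hss hU ((good_p hC).mem hv')

lemma GP_fin_GF (hC : Sem C) (K : ModuleCat.{u} R) [Module.Finite R K] (hK : GP C K) : GF C K := by
  refine Gp_Cf_sub hC ⟨fun X => Module.Finite R X ∧ GP C X, ⟨inferInstance, hK⟩, ?_⟩
  rintro X ⟨hX, hXG⟩
  refine ⟨fun i w hw => ?_, ?_⟩
  · have := (setting_f C).K2 X (fun i => hXG.EV i (C_mem C)) (F := ModuleCat.of R R) (inferInstanceAs (Module.Flat R R)) hw i
    exact EV.of_iso (A := ModuleCat.of R (X ⊗[R] R)) (TensorProduct.rid R X) this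
  · obtain ⟨n, X', f, g, hs, h1, h2⟩ := GP_fin_step hC X hXG
    exact ⟨_, X', f, g, ⟨ModuleCat.of R (Fin n → R), inferInstanceAs (Module.Flat R (Fin n → R)),
      ⟨(TensorProduct.piScalarRight R R C (Fin n)).symm⟩⟩, hs, h1, h2⟩

lemma dim_GP_GF (hC : Sem C) (K : ModuleCat.{u} R) [Module.Finite R K] (g : ℕ) (hK : ResDimLE R (GP C) g K) :
    ResDimLE R (GF C) g K := by
  induction g generalizing K with
  | zero => exact GP_fin_GF hC K hK
  | succ g ih =>
    obtain ⟨m, L, i, p, hs, hL⟩ := exists_fin_cover K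
    have hP : Module.Projective R (ModuleCat.of R (Fin m → R)) := inferInstanceAs (Module.Projective R (Fin m → R))
    exact (res_f hC).dim_succ hs ((res_f hC).proj hP) (ih L ((res_p hC).dim_syz hs hP hK))

lemma LB.le [IsLocalRing R] {W V : ModuleCat.{u} R → Prop} {j k : ℕ} (h : LB N w j) (hw : W w) (hk : ResDimLE R (Gp V W) k N) : j ≤ k := by
  by_contra hcon
  push Not at hcon
  obtain ⟨-, S, β, hS, -, hβ⟩ := h
  have hE := dim_EV hk hw (j - k - 1)
  rw [show k + (j - k - 1) + 1 = j by omega] at hE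
  obtain ⟨x, y, hxy⟩ := exists_pair_ne S
  obtain ⟨a, rfl⟩ := hβ x
  obtain ⟨b, rfl⟩ := hβ y
  exact hxy (by rw [hE a, hE b])

lemma resDim_eq {G : ModuleCat.{u} R → Prop} {n : ℕ} :
    ResDim R G N = n ↔ ResDimLE R G n N ∧ ∀ j, ResDimLE R G j N → n ≤ j := by
  unfold ResDim
  constructor
  · intro h
    have hne : {n : ℕ∞ | ∃ k : ℕ, (k : ℕ∞) = n ∧ ResDimLE R G k N}.Nonempty := by
      by_contra hcon
      rw [Set.not_nonempty_iff_eq_empty.1 hcon, sInf_empty] at h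
      exact ENat.natCast_ne_top n h.symm
    have h1 := csInf_mem hne
    rw [h] at h1
    obtain ⟨k, hk, hk'⟩ := h1
    obtain rfl : k = n := by exact_mod_cast hk
    refine ⟨hk', fun j hj => ?_⟩
    have : ((k : ℕ) : ℕ∞) ≤ j := h ▸ sInf_le ⟨j, rfl, hj⟩
    exact_mod_cast this
  · rintro ⟨h1, h2⟩
    refine le_antisymm (sInf_le ⟨n, rfl, h1⟩) (le_sInf ?_)
    rintro _ ⟨k, rfl, hk⟩
    exact_mod_cast h2 k hk

lemma main_imp [IsLocalRing R] (hC : Sem C) (M : Type u) [AddCommGroup M] [Module R M] [Module.Finite R M] [Nontrivial M]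
    (d g : ℕ) (hdim : moduleDim R M = (d : WithBot ℕ∞)) (h : ResDimLE R (GP C) g (ModuleCat.of R M))
    (hmin : ∀ j, ResDimLE R (GP C) j (ModuleCat.of R M) → g ≤ j) (hCM : IsCohenMacaulayModule R M) :
    ResDim R (GF C) (lcoh R (maximalIdeal R) d M) = (g + d : ℕ) ∧ ResDim R (GP C) (lcoh R (maximalIdeal R) d M) = (g + d : ℕ) := by
  obtain ⟨rs, rfl, hm, hr⟩ := (CM_iff M d hdim).1 hCM
  obtain ⟨T, hT⟩ := exists_cech rs (ModuleCat.of R M) hm hr.toIsWeaklyRegular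
  obtain ⟨e⟩ := lcoh_iso M rs hm hr hdim T hT
  have : Module.Finite R (ModuleCat.of R M) := inferInstanceAs (Module.Finite R M)
  have : Nontrivial (ModuleCat.of R M) := inferInstanceAs (Nontrivial M)
  constructor
  · rw [resDim_eq]
    obtain ⟨w, hw, hL⟩ := exists_LB_f hC (ModuleCat.of R M) g h hmin
    exact ⟨(res_f hC).dim_iso (hT.up _ (res_f hC) (fun N hN => GF_fs hC N hN) g (dim_GP_GF hC _ g h)) e.symm,
      fun j hj => (hT.low w g hL).le hw ((res_f hC).dim_iso hj e)⟩
  · rw [resDim_eq]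
    obtain ⟨w, hw, hL⟩ := exists_LB_p hC (ModuleCat.of R M) g h hmin
    exact ⟨(res_p hC).dim_iso (hT.up _ (res_p hC) (fun N hN => GP_fs N hN) g h) e.symm,
      fun j hj => (hT.low w g hL).le hw ((res_p hC).dim_iso hj e)⟩

end GC

open Paper IsLocalRing

/-- **Corollary 4.6.** Let `R` be a Cohen-Macaulay Noetherian local ring, `C` a
semidualizing module, and `M` a `d`-dimensional non-zero finitely generated module of
finite `G_C`-projective dimension. Then `M` is Cohen-Macaulay iff
`G_C-fd_R H^d_𝔪(M) = G_C-pd_R M + d` iff `G_C-pd_R H^d_𝔪(M) = G_C-pd_R M + d`. -/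
theorem isCohenMacaulay_iff_GCflatDim_localCohomology
    (R : Type u) [CommRing R] [IsNoetherianRing R] [IsLocalRing R]
    (hR : IsCohenMacaulayRing R)
    (C : Type u) [AddCommGroup C] [Module R C] (hC : IsSemidualizing R C)
    (M : Type u) [AddCommGroup M] [Module R M] [Module.Finite R M]
    (hM : Nontrivial M) (d : ℕ) (hdim : moduleDim R M = (d : WithBot ℕ∞))
    (hfin : GCprojDim R C M ≠ ⊤) :
    ((IsCohenMacaulayModule R M ↔
        GCflatDim R C (lcoh R (maximalIdeal R) d M) = GCprojDim R C M + d) ∧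
     (GCflatDim R C (lcoh R (maximalIdeal R) d M) = GCprojDim R C M + d ↔
        GCprojDim R C (lcoh R (maximalIdeal R) d M) = GCprojDim R C M + d)) := by
  have hS : GC.Sem (ModuleCat.of R C) := GC.Sem.of_semidualizing hC
  have hP : (fun N : ModuleCat.{u} R => IsGCProjective R C N) = GC.GP (ModuleCat.of R C) :=
    funext fun N => propext (GC.GP_iff hS N)
  have hF : (fun N : ModuleCat.{u} R => IsGCFlat R C N) = GC.GF (ModuleCat.of R C) :=
    funext fun N => propext (GC.GF_iff hS N)
  unfold GCflatDim GCprojDim at *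
  rw [hP] at hfin ⊢
  rw [hF]
  obtain ⟨g, hg⟩ := ENat.ne_top_iff_exists.1 hfin
  obtain ⟨h, hmin⟩ := GC.resDim_eq.1 hg.symm
  rw [← hg, ← Nat.cast_add]
  have hi := GC.main_imp hS M d g hdim h hmin
  have h2 : ResDim R (GC.GF (ModuleCat.of R C)) (lcoh R (maximalIdeal R) d M) = (g + d : ℕ) → IsCohenMacaulayModule R M := fun h2 => by
    obtain ⟨h3, h4⟩ := GC.resDim_eq.1 h2
    exact GC.cm_of_dim M d g _ hdim hS h (GC.setting_f _) (GC.good_f hS) (GC.res_f hS) (fun w hw => GC.Wf_sub_Cf hS hw)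
      (GC.star_f hS) h3 h4
  have h3 : ResDim R (GC.GP (ModuleCat.of R C)) (lcoh R (maximalIdeal R) d M) = (g + d : ℕ) → IsCohenMacaulayModule R M := fun h2 => by
    obtain ⟨h3, h4⟩ := GC.resDim_eq.1 h2
    exact GC.cm_of_dim M d g _ hdim hS h (GC.setting_p _) (GC.good_p hS) (GC.res_p hS) (fun w hw => hw)
      (GC.star_p hS) h3 h4
  exact ⟨⟨fun h => (hi h).1, h2⟩, fun h => (hi (h2 h)).2, fun h => (hi (h3 h)).1⟩
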